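/- (Corollary 1.6, claim (1.49)) Assume d ≥ 4 is such that ρ := 7(2/(d+1) + (1 − 2/(d+1)) q(d−1)) < 1, let c_0 = 8d/log(1/ρ), and let u_0 > 0 be the constant of Theorem 1.2 part 2 with m = 2 and λ = λ_0 where e^{λ_0} = 7 ρ^{−1/2}. Then lim_{N→∞} N^{2d} sup_{j∈ℤ} P[(G_{j,u_0 N^{d−1}})^c] = 0, where G_{j,t} = V_{c_0,j,t} ∩ U_{c_0,j,t}. -/

import Mathlib

open MeasureTheory Filter
open scoped ENNReal Classical

namespace DiscCyl

/-- The lattice `ℤ^{d+1}`. -/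
abbrev Lat (d : ℕ) := Fin (d + 1) → ℤ

/-- The discrete cylinder `E = (ℤ/Nℤ)^d × ℤ`. -/
abbrev Cyl (d N : ℕ) := (Fin d → ZMod N) × ℤ

instance (N : ℕ) : MeasurableSpace (ZMod N) := ⊤

instance (N : ℕ) : Countable (ZMod N) := by
  cases N with
  | zero => exact inferInstanceAs (Countable ℤ)
  | succ n => exact inferInstanceAs (Countable (Fin (n + 1)))

/-- The canonical projection `π_E : ℤ^{d+1} → E`. -/
def projE (d N : ℕ) (v : Lat d) : Cyl d N :=
  (fun i => (v i.castSucc : ZMod N), v (Fin.last d))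

/-- The `2(d+1)` unit vectors `±e_i` of `ℤ^{d+1}`. -/
def unitVecs (d : ℕ) : Finset (Lat d) :=
  Finset.image (fun p : Fin (d + 1) × Bool => Pi.single p.1 (if p.2 then (1 : ℤ) else -1))
    Finset.univ

/-- One-step transition probability of simple random walk on the cylinder:
each of the `2(d+1)` unit moves of `ℤ^{d+1}` is taken with probability `1/(2(d+1))`
and projected to `E`. -/
noncomputable def stepProb (d N : ℕ) (x y : Cyl d N) : ℝ≥0∞ :=
  (((unitVecs d).filter fun e => x + projE d N e = y).card : ℝ≥0∞) / (2 * (d + 1))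

/-- `Pl` is the family of laws (indexed by the starting point) of simple random walk
on the cylinder `E = (ℤ/Nℤ)^d × ℤ`. -/
def IsCylRW (d N : ℕ) (Pl : Cyl d N → Measure (ℕ → Cyl d N)) : Prop :=
  (∀ x, IsProbabilityMeasure (Pl x)) ∧
    ∀ (x : Cyl d N) (n : ℕ) (γ : ℕ → Cyl d N),
      Pl x {ω | ∀ i ≤ n, ω i = γ i} =
        (if γ 0 = x then 1 else 0) * ∏ i ∈ Finset.range n, stepProb d N (γ i) (γ (i + 1))

/-- The lattice `ℤ^ν`. -/
abbrev ZLat (ν : ℕ) := Fin ν → ℤ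

/-- Unit vectors of `ℤ^ν`. -/
def zUnitVecs (ν : ℕ) : Set (ZLat ν) :=
  {v | ∃ i, v = Pi.single i 1 ∨ v = Pi.single i (-1)}

/-- One-step transition probability of simple random walk on `ℤ^ν`. -/
noncomputable def zStep (ν : ℕ) (x y : ZLat ν) : ℝ≥0∞ :=
  if y - x ∈ zUnitVecs ν then (2 * ν : ℝ≥0∞)⁻¹ else 0

/-- `Ql` is the family of laws of simple random walk on `ℤ^ν`. -/
def IsLatRW (ν : ℕ) (Ql : ZLat ν → Measure (ℕ → ZLat ν)) : Prop :=
  (∀ x, IsProbabilityMeasure (Ql x)) ∧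
    ∀ (x : ZLat ν) (n : ℕ) (γ : ℕ → ZLat ν),
      Ql x {ω | ∀ i ≤ n, ω i = γ i} =
        (if γ 0 = x then 1 else 0) * ∏ i ∈ Finset.range n, zStep ν (γ i) (γ (i + 1))

/-- `q(ν)`: the return probability to the origin of simple random walk on `ℤ^ν`. -/
noncomputable def retProb (ν : ℕ) (Ql : ZLat ν → Measure (ℕ → ZLat ν)) : ℝ :=
  ((Ql 0) {ω | ∃ n : ℕ, 1 ≤ n ∧ ω n = 0}).toReal

/-- Entrance time `H_U` (with value `⊤` if `U` is never entered). -/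
noncomputable def entT {X : Type*} (U : Set X) (ω : ℕ → X) : ℕ∞ :=
  sInf {t : ℕ∞ | ∃ n : ℕ, ω n ∈ U ∧ t = n}

/-- Exit time `T_U`. -/
noncomputable def exitT {X : Type*} (U : Set X) (ω : ℕ → X) : ℕ∞ :=
  entT Uᶜ ω

/-- `after t f ω = t + f (θ_t ω)`, with value `⊤` when `t = ⊤`. -/
noncomputable def after {X : Type*} (t : ℕ∞) (f : (ℕ → X) → ℕ∞) (ω : ℕ → X) : ℕ∞ :=
  t.recTopCoe ⊤ fun m => (m : ℕ∞) + f fun k => ω (k + m)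

/-- The block `C_j = (ℤ/Nℤ)^d × ([(j-3/4)N, (j+3/4)N] ∩ ℤ)`. -/
def Cblk (d N : ℕ) (j : ℤ) : Set (Cyl d N) :=
  {x | ((j : ℝ) - 3 / 4) * N ≤ (x.2 : ℝ) ∧ (x.2 : ℝ) ≤ ((j : ℝ) + 3 / 4) * N}

/-- The block `B_j = (ℤ/Nℤ)^d × [(j-1)N, (j+1)N]`. -/
def Bblk (d N : ℕ) (j : ℤ) : Set (Cyl d N) :=
  {x | (j - 1) * (N : ℤ) ≤ x.2 ∧ x.2 ≤ (j + 1) * (N : ℤ)}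

/-- The block `B̃_j = (ℤ/Nℤ)^d × [(j-2)N+1, (j+2)N-1]`. -/
def Btl (d N : ℕ) (j : ℤ) : Set (Cyl d N) :=
  {x | (j - 2) * (N : ℤ) + 1 ≤ x.2 ∧ x.2 ≤ (j + 2) * (N : ℤ) - 1}

/-- `D^j_1`: time of the first departure from `B̃_j` after the first return to `B_j`. -/
noncomputable def oneExc (d N : ℕ) (j : ℤ) (ω : ℕ → Cyl d N) : ℕ∞ :=
  after (entT (Bblk d N j) ω) (exitT (Btl d N j)) ω

/-- `D^j_k`: time of the `k`-th departure from `B̃_j` (after successive returns to `B_j`). -/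
noncomputable def DD (d N : ℕ) (j : ℤ) : ℕ → (ℕ → Cyl d N) → ℕ∞
  | 0, _ => 0
  | k + 1, ω => after (DD d N j k ω) (oneExc d N j) ω

/-- The law `P` of the walk with initial distribution uniform on `B_0`. -/
noncomputable def lawP (d N : ℕ) (Pl : Cyl d N → Measure (ℕ → Cyl d N)) :
    Measure (ℕ → Cyl d N) :=
  ((N : ℝ≥0∞) ^ d * (2 * N + 1))⁻¹ •
    Measure.sum fun x : Cyl d N => if x ∈ Bblk d N 0 then Pl x else 0

/-- Nearest-neighbour adjacency on the cylinder. -/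
def adj (d N : ℕ) (x y : Cyl d N) : Prop :=
  x ≠ y ∧ ∃ e ∈ unitVecs d, y = x + projE d N e

/-- `x` and `y` are connected by a nearest-neighbour path inside `S`. -/
def connIn (d N : ℕ) (S : Set (Cyl d N)) (x y : Cyl d N) : Prop :=
  Relation.ReflTransGen (fun a b => a ∈ S ∧ b ∈ S ∧ adj d N a b) x y

/-- `S` is a connected set. -/
def IsConnIn (d N : ℕ) (S : Set (Cyl d N)) : Prop :=
  ∀ x ∈ S, ∀ y ∈ S, connIn d N S x y

/-- The boundary `∂U`. -/
def bdry (d N : ℕ) (U : Set (Cyl d N)) : Set (Cyl d N) :=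
  {x | x ∉ U ∧ ∃ y ∈ U, adj d N x y}

/-- `ℓ^∞`-norm on `ℤ^{d+1}`. -/
def linf {d : ℕ} (v : Lat d) : ℕ := Finset.univ.sup fun i => (v i).natAbs

/-- `ℓ^∞`-distance induced on the cylinder. -/
noncomputable def cylDist (d N : ℕ) (x y : Cyl d N) : ℕ :=
  sInf {r : ℕ | ∃ v : Lat d, projE d N v = y - x ∧ linf v = r}

/-- `S` has `ℓ^∞`-diameter at least `L`. -/
def diamGE (d N : ℕ) (S : Set (Cyl d N)) (L : ℕ) : Prop :=
  ∃ x ∈ S, ∃ y ∈ S, L ≤ cylDist d N x y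

/-- `X_{[0,n]}`: the set of points visited up to time `n`. -/
def ran {X : Type*} (ω : ℕ → X) (n : ℕ) : Set X := {y | ∃ i ≤ n, ω i = y}

/-- The set of points visited up to the (possibly infinite) time `t`. -/
def ranE {X : Type*} (ω : ℕ → X) (t : ℕ∞) : Set X :=
  {y | ∃ i : ℕ, (i : ℕ∞) ≤ t ∧ ω i = y}

/-- `L_m`: projections to `E` of `m`-dimensional affine coordinate lattices of `ℤ^{d+1}`. -/
def Lcoll (d N m : ℕ) : Set (Set (Cyl d N)) :=
  {F | ∃ I : Finset (Fin (d + 1)), I.card = m ∧ ∃ y : Lat d,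
      F = (fun v => projE d N (y + v)) '' {v : Lat d | ∀ i ∉ I, v i = 0}}

/-- `A^j_m`: nonempty subsets of `C_j` contained in some `F ∈ L_m`. -/
def Adm (d N : ℕ) (j : ℤ) (m : ℕ) : Set (Finset (Cyl d N)) :=
  {A | A.Nonempty ∧ ↑A ⊆ Cblk d N j ∧ ∃ F ∈ Lcoll d N m, (↑A : Set (Cyl d N)) ⊆ F}

/-- The segment `{x + k·e : 0 ≤ k ≤ L}` (addition via `π_E`). -/
def segment (d N : ℕ) (x : Cyl d N) (e : Lat d) (L : ℕ) : Set (Cyl d N) :=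
  {y | ∃ k : ℕ, k ≤ L ∧ y = x + projE d N ((k : ℤ) • e)}

/-- The event `V_{K,j,t}` (with `k = ⌊t⌋` excursions). -/
def Vev (d N : ℕ) (K : ℝ) (j : ℤ) (k : ℕ) : Set (ℕ → Cyl d N) :=
  {ω | ∀ x ∈ Cblk d N j, ∀ e ∈ unitVecs d, ∃ i : ℕ, (i : ℝ) < Real.sqrt N ∧
      ∀ l : ℕ, i ≤ l → l ≤ i + ⌊K * Real.log N⌋₊ →
        x + projE d N ((l : ℤ) • e) ∉ ranE ω (DD d N j k ω)}

/-- The event `U_{K,j,t}` (with `k = ⌊t⌋` excursions). -/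
def Uev (d N : ℕ) (K : ℝ) (j : ℤ) (k : ℕ) : Set (ℕ → Cyl d N) :=
  {ω | ∀ F ∈ Lcoll d N 2, ∀ n : ℕ, (n : ℕ∞) ≤ DD d N j k ω →
      ∀ O₁ O₂ : Set (Cyl d N),
        O₁ ⊆ (F ∩ Cblk d N j) \ ran ω n → O₂ ⊆ (F ∩ Cblk d N j) \ ran ω n →
        IsConnIn d N O₁ → IsConnIn d N O₂ →
        diamGE d N O₁ ⌊K * Real.log N⌋₊ → diamGE d N O₂ ⌊K * Real.log N⌋₊ →
        ∀ p ∈ O₁, ∀ q ∈ O₂, connIn d N ((F ∩ Cblk d N j) \ ran ω n) p q}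

/-- A (finite) set `S` disconnects the cylinder. -/
def Disconnects (d N : ℕ) (S : Set (Cyl d N)) : Prop :=
  S.Finite ∧ ∃ M₀ : ℕ, ∀ M : ℕ, M₀ ≤ M → ∀ x y : Cyl d N,
    (M : ℤ) ≤ x.2 → y.2 ≤ -(M : ℤ) → ¬ connIn d N Sᶜ x y

/-- The disconnection time `T_N`. -/
noncomputable def discT (d N : ℕ) (ω : ℕ → Cyl d N) : ℕ∞ :=
  sInf {t : ℕ∞ | ∃ n : ℕ, Disconnects d N (ran ω n) ∧ t = n}

/-- `r ≤ t` for `t : ℕ∞` and a real threshold `r` (trivially true when `t = ⊤`). -/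
def geReal (t : ℕ∞) (r : ℝ) : Prop := ∀ n : ℕ, t = (n : ℕ∞) → r ≤ n

/-- `r < t` for `t : ℕ∞` and a real threshold `r` (trivially true when `t = ⊤`). -/
def gtReal (t : ℕ∞) (r : ℝ) : Prop := ∀ n : ℕ, t = (n : ℕ∞) → r < n

/-- `φ_j(z) = E_z[exp(λ Σ_{x∈A} 1{H_x < T_{B̃_j}})]`. -/
noncomputable def phi (d N : ℕ) (Pl : Cyl d N → Measure (ℕ → Cyl d N)) (j : ℤ) (lam : ℝ)
    (A : Finset (Cyl d N)) (z : Cyl d N) : ℝ :=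
  ∫ ω, Real.exp (lam * ∑ x ∈ A, if entT {x} ω < exitT (Btl d N j) ω then (1 : ℝ) else 0)
    ∂(Pl z)

/-- `‖φ_j‖_∞`. -/
noncomputable def phiSup (d N : ℕ) (Pl : Cyl d N → Measure (ℕ → Cyl d N)) (j : ℤ) (lam : ℝ)
    (A : Finset (Cyl d N)) : ℝ :=
  ⨆ z : Cyl d N, phi d N Pl j lam A z

/-- `q_N = sup {P_z[H_F < T_{B̃_j}] : F ∈ L_m, z ∈ ∂F}`. -/
noncomputable def qNval (d N m : ℕ) (Pl : Cyl d N → Measure (ℕ → Cyl d N)) (j : ℤ) : ℝ :=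
  sSup {r : ℝ | ∃ F ∈ Lcoll d N m, ∃ z ∈ bdry d N F,
      r = ((Pl z) {ω | entT F ω < exitT (Btl d N j) ω}).toReal}

/-- The times `τ_k`: `τ_0` is the entrance time of `(ℤ/Nℤ)^d × Nℤ`, and `τ_{k+1}` is the
first time after `τ_k` at which the vertical component has moved by exactly `N`. -/
noncomputable def tauT (d N : ℕ) : ℕ → (ℕ → Cyl d N) → ℕ∞
  | 0, ω => entT {x : Cyl d N | (N : ℤ) ∣ x.2} ω
  | k + 1, ω =>
      (tauT d N k ω).recTopCoe ⊤ fun m =>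
        sInf {t : ℕ∞ | ∃ n : ℕ, m < n ∧ ((ω n).2 - (ω m).2).natAbs = N ∧ t = n}

/-- `*`-adjacency on `ℤ²`. -/
def starAdj (x y : ℤ × ℤ) : Prop :=
  x ≠ y ∧ (x.1 - y.1).natAbs ≤ 1 ∧ (x.2 - y.2).natAbs ≤ 1


lemma exp_geom_sum (s : ℝ) (hs : 0 < s) (m : ℕ) :
    ∑ k ∈ Finset.range m, Real.exp (-(s * k)) ≤ 1 + 1 / s := by
  have h1 : Real.exp (-s) < 1 := by simpa using hs
  have h2 : ∀ k : ℕ, Real.exp (-(s * k)) = (Real.exp (-s)) ^ k := by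
    intro k; rw [← Real.exp_nat_mul]; congr 1; ring
  simp_rw [h2]
  have h0 := (Real.exp_pos (-s)).le
  refine (Summable.sum_le_tsum _ (fun i _ => pow_nonneg h0 i)
    (summable_geometric_of_lt_one h0 h1)).trans ?_
  rw [tsum_geometric_of_lt_one h0 h1, inv_le_comm₀ (by linarith) (by positivity)]
  have h4 : Real.exp (-s) ≤ (1 + s)⁻¹ := by
    rw [Real.exp_neg]
    exact inv_anti₀ (by positivity) (by linarith [Real.add_one_le_exp s])
  have h5 : (1 + 1 / s)⁻¹ = 1 - (1 + s)⁻¹ := by field_simp; ring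
  linarith

lemma gauss_sum_bound (c : ℝ) (hc : 0 < c) (m : ℕ) :
    ∑ k ∈ Finset.range m, Real.exp (-(c * (k : ℝ) ^ 2)) ≤
      Real.exp 1 * (1 + 1 / (2 * Real.sqrt c)) := by
  have hsq : 0 < Real.sqrt c := Real.sqrt_pos.2 hc
  calc ∑ k ∈ Finset.range m, Real.exp (-(c * (k : ℝ) ^ 2))
      ≤ ∑ k ∈ Finset.range m, Real.exp 1 * Real.exp (-((2 * Real.sqrt c) * k)) := by
        apply Finset.sum_le_sum
        intro k _
        rw [← Real.exp_add]
        apply Real.exp_le_exp.2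
        have := sq_nonneg (Real.sqrt c * k - 1)
        have h2 := Real.sq_sqrt hc.le
        nlinarith
    _ ≤ _ := by
        rw [← Finset.mul_sum]
        exact mul_le_mul_of_nonneg_left (exp_geom_sum _ (by positivity) m) (Real.exp_pos _).le

lemma gauss_sum_shift (c : ℝ) (hc : 0 < c) (N : ℕ) (r : ℕ) (hr : r = 0 ∨ r = 1 ∨ r = 2) :
    ∑ k ∈ Finset.range N, Real.exp (-(c * (2 * (k : ℝ) - r * N) ^ 2)) ≤
      2 * (Real.exp 1 * (1 + 1 / (2 * Real.sqrt c))) := by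
  have hg := gauss_sum_bound c hc
  have hpos : 0 ≤ Real.exp 1 * (1 + 1 / (2 * Real.sqrt c)) := by positivity
  have key : ∀ (a b : ℝ), b ^ 2 ≤ a ^ 2 → Real.exp (-(c * a ^ 2)) ≤ Real.exp (-(c * b ^ 2)) := by
    intro a b h
    apply Real.exp_le_exp.2
    nlinarith
  rcases hr with rfl | rfl | rfl
  · refine le_trans (Finset.sum_le_sum fun k _ => key _ (k : ℝ) ?_) ((hg N).trans (by linarith))
    push_cast; nlinarith [sq_nonneg (k : ℝ)]
  · set q := N / 2 with hq
    have hN : (N : ℝ) = 2 * q ∨ (N : ℝ) = 2 * q + 1 := by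
      rcases Nat.even_or_odd' N with ⟨b, hb | hb⟩
      · left; have : q = b := by omega
        rw [this]; exact_mod_cast hb
      · right; have : q = b := by omega
        rw [this]; exact_mod_cast hb
    calc ∑ k ∈ Finset.range N, Real.exp (-(c * (2 * (k : ℝ) - (1 : ℕ) * N) ^ 2))
        ≤ ∑ k ∈ Finset.range (q + 1 + N), Real.exp (-(c * (2 * (k : ℝ) - (1 : ℕ) * N) ^ 2)) := by
          apply Finset.sum_le_sum_of_subset_of_nonneg
          · intro x; simp; omega
          · intros; positivity
      _ ≤ _ := by
          rw [Finset.sum_range_add, two_mul]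
          apply add_le_add
          · rw [← Finset.sum_range_reflect]
            refine le_trans (Finset.sum_le_sum fun k hk => key _ (k : ℝ) ?_) (hg (q + 1))
            have hk' : k ≤ q := by have := Finset.mem_range.1 hk; omega
            have : ((q + 1 - 1 - k : ℕ) : ℝ) = q - k := by
              rw [show q + 1 - 1 - k = q - k by omega, Nat.cast_sub hk']
            rw [this]; push_cast
            have h0 : (0 : ℝ) ≤ k := by positivity
            rcases hN with h | h <;> rw [h] <;> nlinarith
          · refine le_trans (Finset.sum_le_sum fun k hk => key _ (k : ℝ) ?_) (hg N)
            push_cast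
            have h0 : (0 : ℝ) ≤ k := by positivity
            rcases hN with h | h <;> rw [h] <;> nlinarith
  · rw [← Finset.sum_range_reflect]
    refine le_trans (Finset.sum_le_sum fun k hk => key _ (k : ℝ) ?_) ((hg N).trans (by linarith))
    have hk' : k + 1 ≤ N := by have := Finset.mem_range.1 hk; omega
    have : ((N - 1 - k : ℕ) : ℝ) = N - (k + 1) := by
      rw [show N - 1 - k = N - (k + 1) by omega, Nat.cast_sub hk']; push_cast; ring
    rw [this]; push_cast
    have h0 : (0 : ℝ) ≤ k := by positivity
    nlinarith

lemma sin_sq_sum (N : ℕ) (hN : 0 < N) (a : ℝ) (ha : 0 < a) :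
    ∑ k ∈ Finset.range N, Real.exp (-(a * Real.sin (2 * Real.pi * k / N) ^ 2)) ≤
      6 * (Real.exp 1 * (1 + N / (4 * Real.sqrt a))) := by
  have hNr : (0 : ℝ) < N := by exact_mod_cast hN
  set c : ℝ := 4 * a / N ^ 2 with hc
  have hcpos : 0 < c := by positivity
  have hsc : Real.sqrt c = 2 * Real.sqrt a / N := by
    rw [hc, Real.sqrt_div (by positivity), Real.sqrt_sq hNr.le, Real.sqrt_mul (by norm_num)]
    congr 2
    rw [show (4 : ℝ) = 2 ^ 2 by norm_num, Real.sqrt_sq (by norm_num)]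
  have h1 : ∀ k ∈ Finset.range N, Real.exp (-(a * Real.sin (2 * Real.pi * k / N) ^ 2)) ≤
      ∑ r ∈ ({0, 1, 2} : Finset ℕ), Real.exp (-(c * (2 * (k : ℝ) - r * N) ^ 2)) := by
    intro k hk
    have hk' : (k : ℝ) < N := by exact_mod_cast Finset.mem_range.1 hk
    have hk0 : (0 : ℝ) ≤ k := by positivity
    have main : ∀ r : ℕ, r ∈ ({0, 1, 2} : Finset ℕ) → |2 * (k : ℝ) - r * N| ≤ N / 2 →
        Real.exp (-(a * Real.sin (2 * Real.pi * k / N) ^ 2)) ≤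
      ∑ r ∈ ({0, 1, 2} : Finset ℕ), Real.exp (-(c * (2 * (k : ℝ) - r * N) ^ 2)) := by
      intro r hr hd
      refine le_trans ?_ (Finset.single_le_sum (f := fun r : ℕ =>
        Real.exp (-(c * (2 * (k : ℝ) - r * N) ^ 2))) (fun i _ => (Real.exp_pos _).le) hr)
      apply Real.exp_le_exp.2
      have e1 : Real.sin (2 * Real.pi * k / N) ^ 2 =
          Real.sin (Real.pi * (2 * (k : ℝ) - r * N) / N) ^ 2 := by
        have : Real.pi * (2 * (k : ℝ) - r * N) / N = 2 * Real.pi * k / N - r * Real.pi := by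
          field_simp
        rw [this, Real.sin_sub_nat_mul_pi, mul_pow, ← pow_mul, mul_comm r 2, pow_mul]; norm_num
      set y := Real.pi * (2 * (k : ℝ) - r * N) / N with hy
      have hyabs : |y| ≤ Real.pi / 2 := by
        rw [hy, abs_div, abs_mul, abs_of_pos Real.pi_pos, abs_of_pos hNr, div_le_iff₀ hNr]
        nlinarith [Real.pi_pos]
      have h2 := Real.mul_abs_le_abs_sin hyabs
      have h3 : (2 / Real.pi * |y|) ^ 2 ≤ Real.sin y ^ 2 := by
        rw [← sq_abs (Real.sin y)]
        exact pow_le_pow_left₀ (by positivity) h2 2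
      have h4 : a * (2 / Real.pi * |y|) ^ 2 = c * (2 * (k : ℝ) - r * N) ^ 2 := by
        rw [mul_pow, sq_abs, hy, hc]; field_simp; ring
      rw [e1, ← h4]
      nlinarith
    by_cases c1 : 2 * (k : ℝ) ≤ N / 2
    · apply main 0 (by simp); push_cast; rw [abs_le]; constructor <;> linarith
    · by_cases c2 : 2 * (k : ℝ) ≤ 3 * N / 2
      · apply main 1 (by simp); push_cast; rw [abs_le]; constructor <;> linarith
      · apply main 2 (by simp); push_cast; rw [abs_le]; constructor <;> linarith
  refine (Finset.sum_le_sum h1).trans ?_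
  rw [Finset.sum_comm]
  have h2 : ∀ r ∈ ({0, 1, 2} : Finset ℕ),
      ∑ k ∈ Finset.range N, Real.exp (-(c * (2 * (k : ℝ) - r * N) ^ 2)) ≤
      2 * (Real.exp 1 * (1 + 1 / (2 * Real.sqrt c))) := by
    intro r hr
    exact gauss_sum_shift c hcpos N r (by simpa using hr)
  refine (Finset.sum_le_card_nsmul _ _ _ h2).trans (le_of_eq ?_)
  rw [hsc]
  have hsa : 0 < Real.sqrt a := Real.sqrt_pos.2 ha
  simp only [Finset.mem_insert, Finset.mem_singleton, OfNat.zero_ne_ofNat, zero_ne_one, or_self, not_false_eq_true, Finset.card_insert_of_notMem, OfNat.one_ne_ofNat, Finset.card_singleton, Nat.reduceAdd, nsmul_eq_mul, Nat.cast_ofNat]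
  field_simp
  ring

/-- The (real or complex) averaging operator of the walk. -/
noncomputable def Pop {d N : ℕ} {V : Type*} [AddCommGroup V] [Module ℝ V] (f : Cyl d N → V) (x : Cyl d N) : V :=
  (1 / (2 * ((d : ℝ) + 1))) • ∑ e ∈ unitVecs d, f (x + projE d N e)

lemma sum_unitVecs {d : ℕ} {V : Type*} [AddCommMonoid V] (g : Lat d → V) :
    ∑ e ∈ unitVecs d, g e =
      ∑ i : Fin (d + 1), (g (Pi.single i 1) + g (Pi.single i (-1))) := by
  unfold unitVecs
  rw [Finset.sum_image, Fintype.sum_prod_type]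
  · apply Finset.sum_congr rfl
    intro i _
    simp
  · rintro ⟨i, b⟩ _ ⟨i', b'⟩ _ h
    simp only at h
    have hi : i = i' := by
      by_contra hne
      have := congrFun h i
      rw [Pi.single_eq_same, Pi.single_eq_of_ne hne] at this
      split_ifs at this
      all_goals simp at this
    subst hi
    have := congrFun h i
    simp only [Pi.single_eq_same] at this
    cases b <;> cases b' <;> simp_all

lemma card_unitVecs (d : ℕ) : (unitVecs d).card = 2 * (d + 1) := by
  have := sum_unitVecs (d := d) (fun _ => (1 : ℕ))
  simp at this
  rw [this]; ring

/-- The coordinate `i` of a point, mod `N`. -/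
def cc {d N : ℕ} (i : Fin (d + 1)) (x : Cyl d N) : ZMod N :=
  Fin.lastCases (motive := fun _ => ZMod N) (x.2 : ZMod N) (fun k => x.1 k) i

@[simp] lemma cc_last {d N : ℕ} (x : Cyl d N) : cc (Fin.last d) x = (x.2 : ZMod N) := by
  simp [cc]
@[simp] lemma cc_castSucc {d N : ℕ} (k : Fin d) (x : Cyl d N) : cc k.castSucc x = x.1 k := by
  simp [cc]

lemma cc_add {d N : ℕ} (i : Fin (d + 1)) (x : Cyl d N) (v : Lat d) :
    cc i (x + projE d N v) = cc i x + (v i : ZMod N) := by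
  refine Fin.lastCases ?_ (fun k => ?_) i <;> simp [projE]

lemma cc_projE {d N : ℕ} (i : Fin (d + 1)) (v : Lat d) :
    cc i (projE d N v) = (v i : ZMod N) := by
  refine Fin.lastCases ?_ (fun k => ?_) i <;> simp [projE]

@[simp] lemma projE_snd {d N : ℕ} (v : Lat d) : (projE d N v).2 = v (Fin.last d) := rfl

section basic
variable {d N : ℕ}

lemma Pop_mono {f g : Cyl d N → ℝ} {x : Cyl d N} (h : ∀ e ∈ unitVecs d, f (x + projE d N e) ≤ g (x + projE d N e)) :
    Pop f x ≤ Pop g x := by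
  unfold Pop
  simp only [smul_eq_mul]
  apply mul_le_mul_of_nonneg_left _ (by positivity)
  exact Finset.sum_le_sum h

lemma Pop_nonneg {f : Cyl d N → ℝ} (h : ∀ x, 0 ≤ f x) (x : Cyl d N) : 0 ≤ Pop f x := by
  unfold Pop
  simp only [smul_eq_mul]
  exact mul_nonneg (by positivity) (Finset.sum_nonneg fun e _ => h _)

lemma Pop_add {f g : Cyl d N → ℝ} (x : Cyl d N) : Pop (fun y => f y + g y) x = Pop f x + Pop g x := by
  unfold Pop
  simp only [smul_eq_mul, Finset.sum_add_distrib]; ring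

lemma Pop_sum {ι : Type*} (s : Finset ι) {V : Type*} [AddCommGroup V] [Module ℝ V] (f : ι → Cyl d N → V) (x : Cyl d N) :
    Pop (fun y => ∑ i ∈ s, f i y) x = ∑ i ∈ s, Pop (f i) x := by
  unfold Pop
  rw [Finset.sum_comm, Finset.smul_sum]

lemma Pop_const (c : ℝ) (x : Cyl d N) : Pop (fun _ => c) x = c := by
  unfold Pop
  simp only [smul_eq_mul, Finset.sum_const, card_unitVecs, nsmul_eq_mul]
  push_cast
  have : (2 * ((d : ℝ) + 1)) ≠ 0 := by positivity
  field_simp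

lemma Pop_smul (c : ℝ) (f : Cyl d N → ℝ) (x : Cyl d N) : Pop (fun y => c * f y) x = c * Pop f x := by
  unfold Pop
  simp only [smul_eq_mul, ← Finset.mul_sum]; ring

lemma Pop_cmul (c : ℂ) (f : Cyl d N → ℂ) (x : Cyl d N) : Pop (fun y => c * f y) x = c * Pop f x := by
  unfold Pop
  simp only [← Finset.mul_sum, mul_smul_comm]

lemma Pop_eq (f : Cyl d N → ℝ) (x : Cyl d N) :
    Pop f x = (∑ i : Fin (d + 1), (f (x + projE d N (Pi.single i 1)) +
      f (x + projE d N (Pi.single i (-1))))) / (2 * ((d : ℝ) + 1)) := by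
  unfold Pop
  rw [sum_unitVecs (fun e => f (x + projE d N e)), smul_eq_mul]; ring

lemma iter_mono {f g : Cyl d N → ℝ} (h : ∀ x, f x ≤ g x) (n : ℕ) (x : Cyl d N) :
    Pop^[n] f x ≤ Pop^[n] g x := by
  induction n generalizing x with
  | zero => exact h x
  | succ n ih =>
    rw [Function.iterate_succ_apply', Function.iterate_succ_apply']
    exact Pop_mono fun e _ => ih _

end basic

section eigen
variable {d N : ℕ} [NeZero N]

/-- Complex exponential eigenfunctions. -/
noncomputable def Fk (t : ℝ) (k y : Fin (d + 1) → ZMod N) (x : Cyl d N) : ℂ :=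
  (Real.exp (t * x.2) : ℂ) * ∏ i, ZMod.stdAddChar (k i * (cc i x - y i))

/-- The eigenvalue. -/
noncomputable def phik (t : ℝ) (k : Fin (d + 1) → ZMod N) : ℂ :=
  (1 / (2 * ((d : ℝ) + 1))) • ∑ l : Fin (d + 1),
    ((Real.exp (if l = Fin.last d then t else 0) : ℂ) * ZMod.stdAddChar (k l) +
     (Real.exp (-(if l = Fin.last d then t else 0)) : ℂ) * ZMod.stdAddChar (-(k l)))

lemma Fk_step (t : ℝ) (k y : Fin (d + 1) → ZMod N) (x : Cyl d N) (l : Fin (d + 1)) (s : ℤ) :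
    Fk t k y (x + projE d N (Pi.single l s)) =
      ((Real.exp (s * (if l = Fin.last d then t else 0)) : ℂ) * ZMod.stdAddChar ((s : ZMod N) * (k l))) * Fk t k y x := by
  unfold Fk
  have h1 : Real.exp (t * ((x + projE d N (Pi.single l s)).2 : ℤ)) =
      Real.exp (s * (if l = Fin.last d then t else 0)) * Real.exp (t * x.2) := by
    rw [← Real.exp_add]
    congr 1
    rw [Prod.snd_add, projE_snd]
    by_cases hl : l = Fin.last d
    · subst hl; simp; ring
    · simp [hl, Pi.single_eq_of_ne (Ne.symm hl)]
  have h2 : ∏ i, ZMod.stdAddChar (k i * (cc i (x + projE d N (Pi.single l s)) - y i)) =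
      ZMod.stdAddChar ((s : ZMod N) * (k l)) * ∏ i, ZMod.stdAddChar (k i * (cc i x - y i)) := by
    have : ∀ i, ZMod.stdAddChar (k i * (cc i (x + projE d N (Pi.single l s)) - y i)) =
        (if i = l then ZMod.stdAddChar ((s : ZMod N) * (k l)) else 1) * ZMod.stdAddChar (k i * (cc i x - y i)) := by
      intro i
      rw [cc_add]
      by_cases hi : i = l
      · subst hi
        rw [if_pos rfl, ← AddChar.map_add_eq_mul, Pi.single_eq_same]
        congr 1; ring
      · rw [if_neg hi, Pi.single_eq_of_ne hi]; simp
    rw [Finset.prod_congr rfl fun i _ => this i, Finset.prod_mul_distrib]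
    simp
  rw [h1, h2]; push_cast; ring

lemma Fk_eigen (t : ℝ) (k y : Fin (d + 1) → ZMod N) (x : Cyl d N) :
    Pop (Fk t k y) x = phik t k * Fk t k y x := by
  unfold Pop phik
  rw [sum_unitVecs (fun e => Fk t k y (x + projE d N e)), smul_mul_assoc, Finset.sum_mul]
  congr 1
  apply Finset.sum_congr rfl
  intro l _
  rw [Fk_step, Fk_step, add_mul]
  simp
  left; left; split_ifs <;> simp

lemma Fk_iter (t : ℝ) (k y : Fin (d + 1) → ZMod N) (n : ℕ) (x : Cyl d N) :
    Pop^[n] (Fk t k y) x = phik t k ^ n * Fk t k y x := by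
  induction n generalizing x with
  | zero => simp
  | succ n ih =>
    rw [Function.iterate_succ_apply']
    rw [show Pop^[n] (Fk t k y) = fun x => phik t k ^ n * Fk t k y x from funext ih]
    rw [Pop_cmul, Fk_eigen]; ring

lemma iter_csum {ι : Type*} (s : Finset ι) (c : ι → ℂ) (f : ι → Cyl d N → ℂ) (n : ℕ) (x : Cyl d N) :
    Pop^[n] (fun y => ∑ i ∈ s, c i * f i y) x = ∑ i ∈ s, c i * Pop^[n] (f i) x := by
  induction n generalizing x with
  | zero => simp
  | succ n ih =>
    rw [Function.iterate_succ_apply']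
    rw [show Pop^[n] (fun y => ∑ i ∈ s, c i * f i y) = fun x => ∑ i ∈ s, c i * Pop^[n] (f i) x from funext ih]
    rw [Pop_sum]
    apply Finset.sum_congr rfl
    intro i _
    rw [Pop_cmul, Function.iterate_succ_apply']

lemma iter_ofReal (f : Cyl d N → ℝ) (n : ℕ) (x : Cyl d N) :
    Pop^[n] (fun y => (f y : ℂ)) x = ((Pop^[n] f x : ℝ) : ℂ) := by
  induction n generalizing x with
  | zero => simp
  | succ n ih =>
    rw [Function.iterate_succ_apply', Function.iterate_succ_apply']
    rw [show Pop^[n] (fun y => (f y : ℂ)) = fun x => ((Pop^[n] f x : ℝ) : ℂ) from funext ih]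
    unfold Pop
    simp

end eigen

section hk
variable {d N : ℕ} [NeZero N]

/-- squared sine of a frequency -/
noncomputable def sn (k : ZMod N) : ℝ := Real.sin (2 * Real.pi * k.val / N) ^ 2

lemma std_eq (k : ZMod N) : ZMod.stdAddChar k =
    Complex.exp ((2 * Real.pi * k.val / N : ℝ) * Complex.I) := by
  have h := ZMod.stdAddChar_coe (N := N) (k.val : ℤ)
  rw [Int.cast_natCast, ZMod.natCast_zmod_val] at h
  rw [h]; congr 1; push_cast; ring

lemma std_neg (k : ZMod N) : (ZMod.stdAddChar (-k) : ℂ) =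
    Complex.exp (-(2 * Real.pi * k.val / N : ℝ) * Complex.I) := by
  rw [AddChar.map_neg_eq_inv, std_eq, ← Complex.exp_neg]; congr 1; ring

lemma std_norm (k : ZMod N) : ‖(ZMod.stdAddChar k : ℂ)‖ = 1 := by
  rw [std_eq, Complex.norm_exp_ofReal_mul_I]

lemma term_bound (s θ : ℝ) :
    ‖(Real.exp s : ℂ) * Complex.exp (θ * Complex.I) +
      (Real.exp (-s) : ℂ) * Complex.exp (-θ * Complex.I)‖ ≤
      2 - Real.sin θ ^ 2 + Real.sinh s ^ 2 := by
  set z : ℂ := (Real.exp s : ℂ) * Complex.exp (θ * Complex.I) +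
      (Real.exp (-s) : ℂ) * Complex.exp (-θ * Complex.I) with hz
  have hz2 : z = ((2 * Real.cosh s * Real.cos θ : ℝ) : ℂ) + ((2 * Real.sinh s * Real.sin θ : ℝ) : ℂ) * Complex.I := by
    have e1 : Real.exp s = Real.cosh s + Real.sinh s := (Real.cosh_add_sinh s).symm
    have e2 : Real.exp (-s) = Real.cosh s - Real.sinh s := (Real.cosh_sub_sinh s).symm
    rw [hz, e1, e2, Complex.exp_mul_I, show (-(θ : ℂ)) * Complex.I = ((-θ : ℝ) : ℂ) * Complex.I by push_cast; ring,
      Complex.exp_mul_I]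
    simp only [← Complex.ofReal_cos, ← Complex.ofReal_sin, Real.cos_neg, Real.sin_neg]
    push_cast; ring
  have hn : ‖z‖ ^ 2 = (2 * Real.cosh s * Real.cos θ) ^ 2 + (2 * Real.sinh s * Real.sin θ) ^ 2 := by
    rw [← Complex.normSq_eq_norm_sq, hz2, Complex.normSq_add_mul_I]
  have h1 := Real.cosh_sq s
  have h2 := Real.sin_sq_add_cos_sq θ
  have h3 : ‖z‖ ^ 2 = 4 * (1 - Real.sin θ ^ 2 + Real.sinh s ^ 2) := by
    rw [hn]
    have : Real.cos θ ^ 2 = 1 - Real.sin θ ^ 2 := by linarith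
    rw [mul_pow, mul_pow, mul_pow, mul_pow, h1, this]; ring
  nlinarith [sq_nonneg (‖z‖ - 2)]

lemma phik_norm (t : ℝ) (k : Fin (d + 1) → ZMod N) :
    ‖phik t k‖ ≤ 1 + (Real.sinh t ^ 2 - ∑ l, sn (k l)) / (2 * ((d : ℝ) + 1)) := by
  unfold phik
  have hD : (0 : ℝ) < 2 * ((d : ℝ) + 1) := by positivity
  rw [norm_smul, Real.norm_of_nonneg (by positivity)]
  have : ∀ l ∈ (Finset.univ : Finset (Fin (d + 1))), ‖((Real.exp (if l = Fin.last d then t else 0) : ℂ) * ZMod.stdAddChar (k l) +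
     (Real.exp (-(if l = Fin.last d then t else 0)) : ℂ) * ZMod.stdAddChar (-(k l)))‖ ≤
      2 - sn (k l) + (if l = Fin.last d then Real.sinh t ^ 2 else 0) := by
    intro l _
    rw [std_eq, std_neg]
    refine (term_bound _ _).trans (le_of_eq ?_)
    unfold sn
    split_ifs <;> simp
  refine (mul_le_mul_of_nonneg_left ((norm_sum_le _ _).trans (Finset.sum_le_sum this)) (by positivity)).trans ?_
  rw [Finset.sum_add_distrib, Finset.sum_sub_distrib]
  simp only [Finset.sum_const, Finset.card_univ, Fintype.card_fin, nsmul_eq_mul, Finset.sum_ite_eq', Finset.mem_univ, if_true]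
  apply le_of_eq
  push_cast
  field_simp
  ring

lemma sinh_bd (t : ℝ) (ht : |t| ≤ 1) : Real.sinh t ^ 2 ≤ 4 * t ^ 2 := by
  have h1 := Real.abs_exp_sub_one_le ht
  have h2 := Real.abs_exp_sub_one_le (x := -t) (by simpa using ht)
  rw [abs_neg] at h2
  have h3 : |Real.sinh t| ≤ 2 * |t| := by
    rw [Real.sinh_eq, abs_le]
    rw [abs_le] at h1 h2
    constructor <;> linarith [h1.1, h1.2, h2.1, h2.2]
  rw [← sq_abs, ← sq_abs t]
  nlinarith [abs_nonneg (Real.sinh t), abs_nonneg t]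

lemma phik_pow (t : ℝ) (k : Fin (d + 1) → ZMod N) (n : ℕ) (ht : |t| ≤ 1) (hn : n * t ^ 2 ≤ 1) :
    ‖phik t k‖ ^ n ≤ Real.exp 2 * ∏ l, Real.exp (-((n / (2 * ((d : ℝ) + 1))) * sn (k l))) := by
  have hD : (0 : ℝ) < 2 * ((d : ℝ) + 1) := by positivity
  have h1 : ‖phik t k‖ ≤ Real.exp ((Real.sinh t ^ 2 - ∑ l, sn (k l)) / (2 * ((d : ℝ) + 1))) := by
    refine (phik_norm t k).trans ?_
    have := Real.add_one_le_exp ((Real.sinh t ^ 2 - ∑ l, sn (k l)) / (2 * ((d : ℝ) + 1)))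
    linarith
  refine (pow_le_pow_left₀ (norm_nonneg _) h1 n).trans ?_
  rw [← Real.exp_nat_mul, ← Real.exp_sum, ← Real.exp_add]
  apply Real.exp_le_exp.2
  rw [Finset.sum_neg_distrib, ← Finset.mul_sum]
  have h2 := sinh_bd t ht
  have h3 : n * Real.sinh t ^ 2 / (2 * ((d : ℝ) + 1)) ≤ 2 := by
    rw [div_le_iff₀ hD]
    have : n * Real.sinh t ^ 2 ≤ n * (4 * t ^ 2) := by gcongr
    nlinarith [(Nat.cast_nonneg d : (0:ℝ) ≤ d)]
  have h4 : (n : ℝ) * ((Real.sinh t ^ 2 - ∑ l, sn (k l)) / (2 * ((d : ℝ) + 1))) =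
    n * Real.sinh t ^ 2 / (2 * ((d : ℝ) + 1)) + -(n / (2 * ((d : ℝ) + 1)) * ∑ l, sn (k l)) := by
    field_simp; ring
  rw [h4]; linarith

/-- weights -/
noncomputable def wgt (N : ℕ) (J : Finset (Fin (d + 1))) (i : Fin (d + 1)) : ℝ := if i ∈ J then 1 / N else 1
noncomputable def frq (N : ℕ) [NeZero N] (J : Finset (Fin (d + 1))) (i : Fin (d + 1)) : Finset (ZMod N) :=
  if i ∈ J then Finset.univ else {0}

lemma fourier (J : Finset (Fin (d + 1))) (y : Fin (d + 1) → ZMod N) (t : ℝ) (x : Cyl d N) :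
    ((Real.exp (t * x.2) * (if ∀ i ∈ J, cc i x = y i then 1 else 0) : ℝ) : ℂ) =
      ∑ k ∈ Fintype.piFinset (frq N J), (∏ i, (wgt N J i : ℂ)) * Fk t k y x := by
  unfold Fk
  have h1 : ∀ k : Fin (d + 1) → ZMod N, (∏ i, (wgt N J i : ℂ)) * ((Real.exp (t * x.2) : ℂ) * ∏ i, ZMod.stdAddChar (k i * (cc i x - y i))) =
     (Real.exp (t * x.2) : ℂ) * ∏ i, ((wgt N J i : ℂ) * ZMod.stdAddChar (k i * (cc i x - y i))) := by
    intro k; rw [Finset.prod_mul_distrib]; ring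
  simp_rw [h1]
  rw [← Finset.mul_sum, ← Finset.prod_univ_sum (frq N J) (fun i k => ((wgt N J i : ℂ) * ZMod.stdAddChar (k * (cc i x - y i))))]
  push_cast
  congr 1
  have h2 : ∀ i, ∑ k ∈ frq N J i, ((wgt N J i : ℂ) * ZMod.stdAddChar (k * (cc i x - y i))) =
     if i ∈ J → cc i x = y i then 1 else 0 := by
    intro i
    unfold frq wgt
    by_cases hi : i ∈ J
    · simp only [hi, if_true, ← Finset.mul_sum, forall_true_left]
      rw [AddChar.sum_mulShift (cc i x - y i) (ZMod.isPrimitive_stdAddChar N)]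
      have hN : (N : ℂ) ≠ 0 := by exact_mod_cast NeZero.ne N
      simp only [sub_eq_zero, ZMod.card]
      split_ifs
      · push_cast; field_simp
      · simp
    · simp [hi]
  simp_rw [h2]
  rw [Finset.prod_ite_zero]
  simp
  split_ifs <;> simp

lemma sum_zmod (f : ZMod N → ℝ) : ∑ k : ZMod N, f k = ∑ k ∈ Finset.range N, f (k : ZMod N) := by
  symm
  refine Finset.sum_bij' (fun k _ => (k : ZMod N)) (fun k _ => k.val) ?_ ?_ ?_ ?_ ?_
  · simp
  · intro a _; simpa using ZMod.val_lt a
  · intro a ha; exact ZMod.val_cast_of_lt (by simpa using ha)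
  · intro a _; simp
  · simp

lemma sn_sum (a : ℝ) (ha : 0 < a) :
    ∑ k : ZMod N, Real.exp (-(a * sn k)) ≤ 6 * (Real.exp 1 * (1 + N / (4 * Real.sqrt a))) := by
  rw [sum_zmod]
  refine le_trans (le_of_eq ?_) (sin_sq_sum N (NeZero.pos N) a ha)
  apply Finset.sum_congr rfl
  intro k hk
  unfold sn
  rw [ZMod.val_cast_of_lt (by simpa using hk)]

/-- constant of the heat kernel bound -/
noncomputable def hkc (d : ℕ) : ℝ := 6 * (Real.exp 1 * (1 + Real.sqrt (2 * ((d : ℝ) + 1))))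

lemma hkc_one (d : ℕ) : 1 ≤ hkc d := by
  unfold hkc
  have : 1 ≤ Real.exp 1 := by simp
  nlinarith [Real.sqrt_nonneg (2 * ((d : ℝ) + 1))]

theorem heat_kernel (J : Finset (Fin (d + 1))) (y : Fin (d + 1) → ZMod N) (n : ℕ) (hn1 : 1 ≤ n)
    (hnN : n ≤ N ^ 2) (t : ℝ) (ht : |t| ≤ 1) (hnt : n * t ^ 2 ≤ 1) (z : Cyl d N) :
    Pop^[n] (fun x => Real.exp (t * x.2) * (if ∀ i ∈ J, cc i x = y i then 1 else 0)) z ≤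
      Real.exp (t * z.2) * ((Real.exp 2 * hkc d ^ (d + 1)) / Real.sqrt n ^ J.card) := by
  have hnr : (0 : ℝ) < n := by exact_mod_cast hn1
  have hsn : 0 < Real.sqrt n := Real.sqrt_pos.2 hnr
  have hNr : (0 : ℝ) < N := by exact_mod_cast NeZero.pos N
  have hsN : Real.sqrt n ≤ N := by
    rw [Real.sqrt_le_left (by positivity)]; exact_mod_cast hnN
  set a : ℝ := n / (2 * ((d : ℝ) + 1)) with ha
  have hapos : 0 < a := by positivity
  set f : Cyl d N → ℝ := (fun x => Real.exp (t * x.2) * (if ∀ i ∈ J, cc i x = y i then 1 else 0)) with hf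
  have h1 : ((Pop^[n] f z : ℝ) : ℂ) = ∑ k ∈ Fintype.piFinset (frq N J), (∏ i, (wgt N J i : ℂ)) * (phik t k ^ n * Fk t k y z) := by
    rw [← iter_ofReal]
    rw [show (fun x => (f x : ℂ)) = fun x => ∑ k ∈ Fintype.piFinset (frq N J), (∏ i, (wgt N J i : ℂ)) * Fk t k y x from
      funext fun x => fourier J y t x]
    rw [iter_csum]
    simp_rw [Fk_iter]
  have hw : ∀ i : Fin (d + 1), 0 ≤ wgt N J i := by
    intro i; unfold wgt; split_ifs <;> positivity
  have h2 : Pop^[n] f z ≤ ∑ k ∈ Fintype.piFinset (frq N J), (∏ i, wgt N J i) *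
      ((Real.exp 2 * ∏ l, Real.exp (-(a * sn (k l)))) * Real.exp (t * z.2)) := by
    refine (le_abs_self _).trans ?_
    rw [← Real.norm_eq_abs, ← Complex.norm_real, h1]
    refine (norm_sum_le _ _).trans (Finset.sum_le_sum fun k _ => ?_)
    rw [norm_mul, norm_mul, norm_pow, norm_prod]
    simp only [Complex.norm_real, Real.norm_of_nonneg (hw _)]
    have hF : ‖Fk t k y z‖ = Real.exp (t * z.2) := by
      unfold Fk
      rw [norm_mul, norm_prod]
      simp only [std_norm, Finset.prod_const_one, mul_one, Complex.norm_real, Real.norm_of_nonneg (Real.exp_pos _).le]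
    rw [hF]
    have := phik_pow t k n ht hnt
    have hw2 : 0 ≤ ∏ i, wgt N J i := Finset.prod_nonneg fun i _ => hw i
    gcongr
  refine h2.trans ?_
  have h3 : ∑ k ∈ Fintype.piFinset (frq N J), (∏ i, wgt N J i) *
      ((Real.exp 2 * ∏ l, Real.exp (-(a * sn (k l)))) * Real.exp (t * z.2)) =
      Real.exp (t * z.2) * (Real.exp 2 * ∏ i, ∑ k ∈ frq N J i, (wgt N J i * Real.exp (-(a * sn k)))) := by
    rw [Finset.prod_univ_sum, Finset.mul_sum, Finset.mul_sum]
    apply Finset.sum_congr rfl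
    intro k _
    rw [Finset.prod_mul_distrib]; ring
  rw [h3]
  have h4 : ∏ i, ∑ k ∈ frq N J i, (wgt N J i * Real.exp (-(a * sn k))) ≤
      ∏ i, (if i ∈ J then hkc d / Real.sqrt n else 1) := by
    apply Finset.prod_le_prod
    · intro i _; exact Finset.sum_nonneg fun k _ => mul_nonneg (hw i) (Real.exp_pos _).le
    · intro i _
      unfold frq wgt
      by_cases hi : i ∈ J
      · simp only [hi, if_true, ← Finset.mul_sum]
        refine (mul_le_mul_of_nonneg_left (sn_sum a hapos) (by positivity)).trans ?_
        have hsa : Real.sqrt a = Real.sqrt n / Real.sqrt (2 * ((d : ℝ) + 1)) := by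
          rw [ha, Real.sqrt_div' _ (by positivity)]
        rw [hsa]
        have hsD : 0 < Real.sqrt (2 * ((d : ℝ) + 1)) := Real.sqrt_pos.2 (by positivity)
        set D := Real.sqrt (2 * ((d : ℝ) + 1))
        have e1 : 1 / (N : ℝ) * (6 * (Real.exp 1 * (1 + N / (4 * (Real.sqrt n / D))))) =
          6 * (Real.exp 1 * (1 / N + D / 4 / Real.sqrt n)) := by field_simp
        rw [e1]
        have e2 : hkc d / Real.sqrt n = 6 * (Real.exp 1 * (1 / Real.sqrt n + D / Real.sqrt n)) := by
          unfold hkc; field_simp; rfl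
        rw [e2]
        have e3 : 1 / (N : ℝ) ≤ 1 / Real.sqrt n := by gcongr
        have e4 : D / 4 / Real.sqrt n ≤ D / Real.sqrt n := by
          gcongr; linarith
        gcongr
      · simp [hi, sn]
  have h5 : ∏ i : Fin (d + 1), (if i ∈ J then hkc d / Real.sqrt n else 1) = (hkc d / Real.sqrt n) ^ J.card := by
    rw [Finset.prod_ite, Finset.prod_const, Finset.prod_const_one, mul_one]
    congr 1
    simp
  rw [h5] at h4
  have h6 : (hkc d / Real.sqrt n) ^ J.card ≤ hkc d ^ (d + 1) / Real.sqrt n ^ J.card := by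
    rw [div_pow]
    have : hkc d ^ J.card ≤ hkc d ^ (d + 1) := by
      apply pow_le_pow_right₀ (hkc_one d)
      simpa using Finset.card_le_univ J
    gcongr
  rw [mul_div_assoc]
  have h7 := h4.trans h6
  gcongr
end hk

section killed
variable {d N : ℕ}

/-- killed operator -/
noncomputable def Kop (j : ℤ) (f : Cyl d N → ℝ) (x : Cyl d N) : ℝ :=
  if x ∈ Btl d N j then Pop f x else 0

lemma Kop_nonneg (j : ℤ) {f : Cyl d N → ℝ} (h : ∀ x, 0 ≤ f x) (x : Cyl d N) : 0 ≤ Kop j f x := by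
  unfold Kop; split_ifs
  · exact Pop_nonneg h x
  · exact le_rfl

lemma Kop_iter_nonneg (j : ℤ) {f : Cyl d N → ℝ} (h : ∀ x, 0 ≤ f x) (n : ℕ) (x : Cyl d N) :
    0 ≤ (Kop j)^[n] f x := by
  induction n generalizing x with
  | zero => exact h x
  | succ n ih => rw [Function.iterate_succ_apply']; exact Kop_nonneg j ih x

lemma Kop_le_Pop (j : ℤ) {f : Cyl d N → ℝ} (h : ∀ x, 0 ≤ f x) (n : ℕ) (x : Cyl d N) :
    (Kop j)^[n] f x ≤ Pop^[n] f x := by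
  induction n generalizing x with
  | zero => exact le_rfl
  | succ n ih =>
    rw [Function.iterate_succ_apply', Function.iterate_succ_apply']
    have h1 : Pop ((Kop j)^[n] f) x ≤ Pop (Pop^[n] f) x := Pop_mono fun e _ => ih _
    have h2 : 0 ≤ Pop ((Kop j)^[n] f) x := Pop_nonneg (Kop_iter_nonneg j h n) x
    unfold Kop at h1 h2 ⊢
    split_ifs
    · exact h1
    · exact h2.trans h1

/-- the eigenvalue of the killed walk -/
noncomputable def mu (d N : ℕ) : ℝ := (d + Real.cos (1 / (2 * N))) / (d + 1)

lemma Pop_cos (j : ℤ) (x : Cyl d N) :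
    Pop (fun x : Cyl d N => Real.cos ((1 / (2 * N)) * ((x.2 : ℝ) - j * N))) x =
      mu d N * Real.cos ((1 / (2 * N)) * ((x.2 : ℝ) - j * N)) := by
  rw [Pop_eq]
  rw [Fin.sum_univ_castSucc]
  have h1 : ∀ i : Fin d, ∀ s : ℤ, (x + projE d N (Pi.single i.castSucc s)).2 = x.2 := by
    intro i s
    rw [Prod.snd_add, projE_snd, Pi.single_eq_of_ne (Fin.castSucc_lt_last i).ne']; simp
  have h2 : ∀ s : ℤ, (x + projE d N (Pi.single (Fin.last d) s)).2 = x.2 + s := by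
    intro s; rw [Prod.snd_add, projE_snd]; simp
  simp only [h1, h2]
  set θ : ℝ := 1 / (2 * N) with hθ
  push_cast
  have e1 : θ * ((x.2 : ℝ) + 1 - j * N) = θ * ((x.2 : ℝ) - j * N) + θ := by ring
  have e2 : θ * ((x.2 : ℝ) + -1 - j * N) = θ * ((x.2 : ℝ) - j * N) - θ := by ring
  rw [e1, e2, Real.cos_add, Real.cos_sub]
  unfold mu
  rw [← hθ]
  simp only [Finset.sum_const, Finset.card_univ, Fintype.card_fin, nsmul_eq_mul]
  field_simp
  ring

lemma snd_unit (x : Cyl d N) {e : Lat d} (he : e ∈ unitVecs d) :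
    |(x + projE d N e).2 - x.2| ≤ 1 := by
  unfold unitVecs at he
  simp only [Finset.mem_image, Finset.mem_univ, true_and] at he
  obtain ⟨⟨i, b⟩, rfl⟩ := he
  rw [Prod.snd_add, projE_snd, add_sub_cancel_left]
  by_cases hi : Fin.last d = i
  · subst hi; rw [Pi.single_eq_same]; cases b <;> simp
  · rw [Pi.single_eq_of_ne hi]; simp

variable [NeZero N]

lemma cos_half {y : ℝ} (hy : |y| ≤ 2 * N) : 1 / 2 ≤ Real.cos ((1 / (2 * N)) * y) := by
  have hNr : (0 : ℝ) < N := by exact_mod_cast NeZero.pos N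
  have h1 : |(1 / (2 * (N : ℝ))) * y| ≤ 1 := by
    rw [abs_mul, abs_of_pos (by positivity)]
    rw [div_mul_eq_mul_div, div_le_iff₀ (by positivity)]; linarith
  have h2 := Real.one_sub_sq_div_two_le_cos (x := (1 / (2 * (N : ℝ))) * y)
  have h3 : ((1 / (2 * (N : ℝ))) * y) ^ 2 ≤ 1 := by rw [← sq_abs]; nlinarith [abs_nonneg ((1 / (2 * (N : ℝ))) * y)]
  linarith

lemma mu_nonneg (d N : ℕ) [NeZero N] : 0 ≤ mu d N := by
  unfold mu
  have h := cos_half (N := N) (y := 1) (by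
    have : (1 : ℝ) ≤ N := by exact_mod_cast NeZero.pos N
    simp; linarith)
  rw [mul_one] at h
  have : 0 ≤ Real.cos (1 / (2 * N)) := by linarith
  positivity

lemma mu_le (d N : ℕ) [NeZero N] : 1 / (20 * ((d : ℝ) + 1) * N ^ 2) ≤ 1 - mu d N := by
  have hNr : (1 : ℝ) ≤ N := by exact_mod_cast NeZero.pos N
  have h := Real.cos_le_one_sub_mul_cos_sq (x := 1 / (2 * (N : ℝ))) (by
    rw [abs_of_pos (by positivity), div_le_iff₀ (by positivity)]
    nlinarith [Real.pi_gt_three])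
  have hp : Real.pi ^ 2 ≤ 10 := by nlinarith [Real.pi_lt_d2, Real.pi_pos]
  have h2 : (1 : ℝ) / 5 ≤ 2 / Real.pi ^ 2 := by
    rw [div_le_div_iff₀ (by norm_num) (by positivity)]; linarith
  have h3 : Real.cos (1 / (2 * N)) ≤ 1 - 1 / (20 * (N : ℝ) ^ 2) := by
    have : (1 : ℝ) / (20 * (N : ℝ) ^ 2) = 1 / 5 * (1 / (2 * (N : ℝ))) ^ 2 := by field_simp; norm_num
    rw [this]
    nlinarith [sq_nonneg (1 / (2 * (N : ℝ)))]
  have h4 : 1 - mu d N = (1 - Real.cos (1 / (2 * N))) / (d + 1) := by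
    unfold mu; field_simp; ring
  rw [h4]
  have h5 : 1 / (20 * ((d : ℝ) + 1) * N ^ 2) = (1 / (20 * (N : ℝ) ^ 2)) / (d + 1) := by field_simp
  rw [h5]
  gcongr; linarith

lemma Kop_decay (j : ℤ) {f : Cyl d N → ℝ} {c : ℝ} (hc : 0 ≤ c) (hfc : ∀ x, f x ≤ c)
    (n : ℕ) (x : Cyl d N) : (Kop j)^[n] f x ≤ 2 * c * mu d N ^ n := by
  have hNr : (0 : ℝ) < N := by exact_mod_cast NeZero.pos N
  have hmu := mu_nonneg d N
  have main : ∀ n : ℕ, ∀ x : Cyl d N, |(x.2 : ℝ) - j * N| ≤ 2 * N →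
      (Kop j)^[n] f x ≤ 2 * c * mu d N ^ n * Real.cos ((1 / (2 * N)) * ((x.2 : ℝ) - j * N)) := by
    intro n
    induction n with
    | zero =>
      intro x hx
      have := cos_half hx
      have h2 := hfc x
      simp only [Function.iterate_zero, id, pow_zero, mul_one]
      nlinarith
    | succ n ih =>
      intro x hx
      rw [Function.iterate_succ_apply']
      unfold Kop
      split_ifs with hB
      · refine (Pop_mono (g := fun x : Cyl d N => 2 * c * mu d N ^ n * Real.cos ((1 / (2 * N)) * ((x.2 : ℝ) - j * N))) ?_).trans ?_
        · intro e he
          apply ih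
          have h1 := snd_unit x he
          have h2 : ((j - 2) * (N : ℤ) + 1 ≤ x.2 ∧ x.2 ≤ (j + 2) * (N : ℤ) - 1) := hB
          rw [abs_le] at h1
          have h3 : (j - 2) * (N : ℤ) ≤ (x + projE d N e).2 := by linarith
          have h4 : (x + projE d N e).2 ≤ (j + 2) * (N : ℤ) := by linarith
          have h3' : ((j : ℝ) - 2) * N ≤ (x + projE d N e).2 := by exact_mod_cast h3
          have h4' : ((x + projE d N e).2 : ℝ) ≤ (j + 2) * N := by exact_mod_cast h4
          rw [abs_le]; constructor <;> linarith
        · rw [Pop_smul, Pop_cos]; apply le_of_eq; ring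
      · have := cos_half hx
        positivity
  have hle : ∀ y : ℝ, Real.cos y ≤ 1 := Real.cos_le_one
  by_cases hx : |(x.2 : ℝ) - j * N| ≤ 2 * N
  · refine (main n x hx).trans ?_
    have := hle ((1 / (2 * N)) * ((x.2 : ℝ) - j * N))
    have h0 : 0 ≤ 2 * c * mu d N ^ n := by positivity
    nlinarith
  · cases n with
    | zero => simp; linarith [hfc x]
    | succ n =>
      rw [Function.iterate_succ_apply']
      unfold Kop
      rw [if_neg]
      · positivity
      · intro hB
        apply hx
        have h2 : ((j - 2) * (N : ℤ) + 1 ≤ x.2 ∧ x.2 ≤ (j + 2) * (N : ℤ) - 1) := hB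
        have h3' : ((j : ℝ) - 2) * N + 1 ≤ x.2 := by exact_mod_cast h2.1
        have h4' : (x.2 : ℝ) ≤ (j + 2) * N - 1 := by exact_mod_cast h2.2
        rw [abs_le]; constructor <;> linarith

lemma Kop_tail (j : ℤ) {f : Cyl d N → ℝ} {c : ℝ} (hc : 0 ≤ c) (m : ℕ)
    (hfc : ∀ x, (Kop j)^[m] f x ≤ c) (n : ℕ) (x : Cyl d N) :
    ∑ i ∈ Finset.range n, (Kop j)^[m + i] f x ≤ 40 * ((d : ℝ) + 1) * N ^ 2 * c := by
  have hNr : (0 : ℝ) < N := by exact_mod_cast NeZero.pos N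
  have h1 : ∀ i ∈ Finset.range n, (Kop j)^[m + i] f x ≤ 2 * c * mu d N ^ i := by
    intro i _
    rw [add_comm, Function.iterate_add_apply]
    exact Kop_decay j hc hfc i x
  refine (Finset.sum_le_sum h1).trans ?_
  rw [← Finset.mul_sum]
  have hmu := mu_nonneg d N
  have hmu2 := mu_le d N
  have hp : 0 < 1 / (20 * ((d : ℝ) + 1) * N ^ 2) := by positivity
  have hlt : mu d N < 1 := by linarith
  have h2 : ∑ i ∈ Finset.range n, mu d N ^ i ≤ (1 - mu d N)⁻¹ := by
    rw [← tsum_geometric_of_lt_one hmu hlt]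
    exact (summable_geometric_of_lt_one hmu hlt).sum_le_tsum _ (fun i _ => pow_nonneg hmu i)
  have h3 : (1 - mu d N)⁻¹ ≤ 20 * ((d : ℝ) + 1) * N ^ 2 := by
    rw [one_div] at hmu2
    exact inv_le_of_inv_le₀ (by positivity) hmu2
  calc 2 * c * ∑ i ∈ Finset.range n, mu d N ^ i ≤ 2 * c * (20 * ((d : ℝ) + 1) * N ^ 2) := by
        gcongr; exact h2.trans h3
    _ = _ := by ring

end killed

section hitting
variable {d N : ℕ}

/-- indicator -/
noncomputable def ind (A : Set (Cyl d N)) (x : Cyl d N) : ℝ := if x ∈ A then 1 else 0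

lemma ind_nonneg (A : Set (Cyl d N)) (x) : 0 ≤ ind A x := by unfold ind; split_ifs <;> simp
lemma ind_le_one (A : Set (Cyl d N)) (x) : ind A x ≤ 1 := by unfold ind; split_ifs <;> simp

/-- probability to hit `A` within `n` steps before exiting -/
noncomputable def hn (j : ℤ) (A : Set (Cyl d N)) : ℕ → Cyl d N → ℝ
  | 0, x => ind A x
  | n + 1, x => if x ∈ A then 1 else Kop j (hn j A n) x

lemma hn_nonneg (j : ℤ) (A : Set (Cyl d N)) (n : ℕ) (x) : 0 ≤ hn j A n x := by
  induction n generalizing x with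
  | zero => exact ind_nonneg A x
  | succ n ih =>
    unfold hn; split_ifs
    · simp
    · exact Kop_nonneg j ih x

lemma hn_in (j : ℤ) {A : Set (Cyl d N)} (n : ℕ) {x} (hx : x ∈ A) : hn j A n x = 1 := by
  cases n <;> simp [hn, ind, hx]

lemma Kop_mono (j : ℤ) {f g : Cyl d N → ℝ} (h : ∀ x, f x ≤ g x) (x : Cyl d N) : Kop j f x ≤ Kop j g x := by
  unfold Kop; split_ifs
  · exact Pop_mono fun e _ => h _
  · exact le_rfl

lemma Kop_sum (j : ℤ) {ι : Type*} (s : Finset ι) (f : ι → Cyl d N → ℝ) (x : Cyl d N) :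
    Kop j (fun y => ∑ i ∈ s, f i y) x = ∑ i ∈ s, Kop j (f i) x := by
  unfold Kop; split_ifs
  · rw [Pop_sum]
  · simp

lemma Kop_le_one (j : ℤ) {f : Cyl d N → ℝ} (h : ∀ x, f x ≤ 1) (x : Cyl d N) : Kop j f x ≤ 1 := by
  unfold Kop; split_ifs
  · refine (Pop_mono (g := fun _ => 1) fun e _ => h _).trans ?_
    rw [Pop_const]
  · simp

lemma hn_le_one (j : ℤ) (A : Set (Cyl d N)) (n : ℕ) (x) : hn j A n x ≤ 1 := by
  induction n generalizing x with
  | zero => exact ind_le_one A x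
  | succ n ih =>
    unfold hn; split_ifs
    · simp
    · exact Kop_le_one j ih x

lemma hn_mono_set (j : ℤ) {A B : Set (Cyl d N)} (h : A ⊆ B) (n : ℕ) (x) : hn j A n x ≤ hn j B n x := by
  induction n generalizing x with
  | zero => simp only [hn, ind]; split_ifs with h1 h2 <;> first | simp | exact absurd (h h1) h2
  | succ n ih =>
    by_cases hB : x ∈ B
    · rw [hn_in j _ hB]; exact hn_le_one j A _ x
    · have hA : x ∉ A := fun hh => hB (h hh)
      simp only [hn, hA, hB, if_false]
      exact Kop_mono j ih x

lemma hn_mono (j : ℤ) (A : Set (Cyl d N)) : Monotone (hn j A) := by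
  apply monotone_nat_of_le_succ
  intro n
  induction n with
  | zero =>
    intro x
    by_cases h : x ∈ A
    · rw [hn_in j _ h, hn_in j _ h]
    · show ind A x ≤ _
      unfold ind; rw [if_neg h]; exact hn_nonneg j A _ x
  | succ n ih =>
    intro x
    by_cases h : x ∈ A
    · rw [hn_in j _ h, hn_in j _ h]
    · simp only [hn, h, if_false]
      exact Kop_mono j ih x

lemma hn_le_sum (j : ℤ) (A : Set (Cyl d N)) (n : ℕ) (x) :
    hn j A n x ≤ ∑ i ∈ Finset.range (n + 1), (Kop j)^[i] (ind A) x := by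
  induction n generalizing x with
  | zero => simp [hn]
  | succ n ih =>
    rw [Finset.sum_range_succ']
    have h0 : 0 ≤ ∑ i ∈ Finset.range (n + 1), (Kop j)^[i + 1] (ind A) x :=
      Finset.sum_nonneg fun i _ => Kop_iter_nonneg j (ind_nonneg A) _ _
    unfold hn
    split_ifs with h
    · simp only [Function.iterate_zero, id, ind, h, if_true] at h0 ⊢; linarith
    · have := ind_nonneg A x
      simp only [Function.iterate_zero, id]
      refine (Kop_mono j ih x).trans ?_
      rw [Kop_sum]
      simp only [Function.iterate_succ_apply']
      linarith

lemma hn_diff (j : ℤ) (A : Set (Cyl d N)) (n : ℕ) (x) :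
    hn j A (n + 1) x ≤ hn j A n x + (Kop j)^[n + 1] (ind A) x := by
  induction n generalizing x with
  | zero =>
    have := Kop_nonneg j (ind_nonneg A) x
    by_cases h : x ∈ A
    · rw [hn_in j _ h, hn_in j _ h]; simpa using this
    · simp only [hn, h, if_false, ind, Function.iterate_succ_apply', Function.iterate_zero, id, zero_add]
      exact le_of_eq rfl
  | succ n ih =>
    by_cases h : x ∈ A
    · rw [hn_in j _ h, hn_in j _ h]
      have := Kop_iter_nonneg j (ind_nonneg A) (n + 1 + 1) x
      linarith
    · have e : hn j A (n + 1 + 1) x = Kop j (hn j A (n + 1)) x := by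
        conv_lhs => unfold hn
        rw [if_neg h]
      have e2 : hn j A (n + 1) x = Kop j (hn j A n) x := by
        conv_lhs => unfold hn
        rw [if_neg h]
      rw [e, e2, Function.iterate_succ_apply']
      refine (Kop_mono j ih x).trans (le_of_eq ?_)
      unfold Kop; split_ifs
      · rw [Pop_add]
      · simp

lemma hn_le_add (j : ℤ) (A : Set (Cyl d N)) (M k : ℕ) (x) :
    hn j A (M + k) x ≤ hn j A M x + ∑ i ∈ Finset.range k, (Kop j)^[M + 1 + i] (ind A) x := by
  induction k with
  | zero => simp
  | succ k ih =>
    rw [Finset.sum_range_succ]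
    have := hn_diff j A (M + k) x
    rw [show M + 1 + k = M + k + 1 by ring]
    rw [← add_assoc M k 1]
    linarith

lemma hn_subadd (j : ℤ) (A : Finset (Cyl d N)) (n : ℕ) (z) :
    hn j (A : Set (Cyl d N)) n z ≤ ∑ x ∈ A, hn j {x} n z := by
  have hin : ∀ n, ∀ z ∈ A, hn j (A : Set (Cyl d N)) n z ≤ ∑ x ∈ A, hn j {x} n z := by
    intro n z hz
    rw [hn_in j _ (by simpa using hz)]
    rw [← hn_in j (A := {z}) n (x := z) rfl]
    exact Finset.single_le_sum (f := fun x => hn j {x} n z) (fun x _ => hn_nonneg j _ _ _) hz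
  induction n generalizing z with
  | zero =>
    by_cases hz : z ∈ A
    · exact hin 0 z hz
    · have : hn j (A : Set (Cyl d N)) 0 z = 0 := by simp [hn, ind, hz]
      rw [this]
      exact Finset.sum_nonneg fun x _ => hn_nonneg j _ _ _
  | succ n ih =>
    by_cases hz : z ∈ A
    · exact hin _ z hz
    · have e : hn j (A : Set (Cyl d N)) (n + 1) z = Kop j (hn j A n) z := by
        conv_lhs => unfold hn
        rw [if_neg (by simpa using hz)]
      rw [e]
      refine (Kop_mono j ih z).trans (le_of_eq ?_)
      rw [Kop_sum]
      apply Finset.sum_congr rfl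
      intro x hx
      have : z ∉ ({x} : Set (Cyl d N)) := by
        simp only [Set.mem_singleton_iff]; rintro rfl; exact hz hx
      conv_rhs => unfold hn
      rw [if_neg this]

/-- hitting probability -/
noncomputable def hA (j : ℤ) (A : Set (Cyl d N)) (x : Cyl d N) : ℝ := ⨆ n, hn j A n x

lemma hn_bdd (j : ℤ) (A : Set (Cyl d N)) (x) : BddAbove (Set.range fun n => hn j A n x) :=
  ⟨1, by rintro _ ⟨n, rfl⟩; exact hn_le_one j A n x⟩

lemma hA_le {j : ℤ} {A : Set (Cyl d N)} {x} {c : ℝ} (h : ∀ n, hn j A n x ≤ c) : hA j A x ≤ c :=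
  ciSup_le h

lemma le_hA (j : ℤ) (A : Set (Cyl d N)) (n : ℕ) (x) : hn j A n x ≤ hA j A x := le_ciSup (hn_bdd j A x) n

lemma hA_tendsto (j : ℤ) (A : Set (Cyl d N)) (x) : Tendsto (fun n => hn j A n x) atTop (nhds (hA j A x)) :=
  tendsto_atTop_ciSup (fun _ _ h => hn_mono j A h x) (hn_bdd j A x)

lemma hA_nonneg (j : ℤ) (A : Set (Cyl d N)) (x) : 0 ≤ hA j A x := (hn_nonneg j A 0 x).trans (le_hA j A 0 x)
lemma hA_le_one (j : ℤ) (A : Set (Cyl d N)) (x) : hA j A x ≤ 1 := hA_le fun n => hn_le_one j A n x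
lemma hA_mono (j : ℤ) {A B : Set (Cyl d N)} (h : A ⊆ B) (x) : hA j A x ≤ hA j B x :=
  hA_le fun n => (hn_mono_set j h n x).trans (le_hA j B n x)
lemma hA_in (j : ℤ) {A : Set (Cyl d N)} {x} (h : x ∈ A) : hA j A x = 1 := by
  unfold hA; simp [hn_in j _ h]
lemma hA_out (j : ℤ) {A : Set (Cyl d N)} {x} (h : x ∉ A) (hB : x ∉ Btl d N j) : hA j A x = 0 := by
  apply le_antisymm _ (hA_nonneg j A x)
  apply hA_le
  intro n
  cases n with
  | zero => simp [hn, ind, h]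
  | succ n => simp [hn, h, Kop, hB]

lemma hA_harm (j : ℤ) {A : Set (Cyl d N)} {x} (h : x ∉ A) (hB : x ∈ Btl d N j) :
    Pop (hA j A) x = hA j A x := by
  have h1 : Tendsto (fun n => Pop (hn j A n) x) atTop (nhds (Pop (hA j A) x)) := by
    unfold Pop
    simp only [smul_eq_mul]
    apply Tendsto.const_mul
    exact tendsto_finsetSum _ fun e _ => hA_tendsto j A _
  have h2 := (hA_tendsto j A x).comp (tendsto_add_atTop_nat 1)
  refine tendsto_nhds_unique h1 (h2.congr fun n => ?_)
  simp [hn, h, Kop, hB]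

lemma hA_subadd (j : ℤ) (A : Finset (Cyl d N)) (z) :
    hA j (A : Set (Cyl d N)) z ≤ ∑ x ∈ A, hA j {x} z :=
  hA_le fun n => (hn_subadd j A n z).trans (Finset.sum_le_sum fun x _ => le_hA j _ n z)

end hitting

section ab
variable {d N : ℕ}

lemma iter_smul (c : ℝ) (f : Cyl d N → ℝ) (n : ℕ) (x : Cyl d N) :
    Pop^[n] (fun y => c * f y) x = c * Pop^[n] f x := by
  induction n generalizing x with
  | zero => rfl
  | succ n ih =>
    rw [Function.iterate_succ_apply', Function.iterate_succ_apply']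
    rw [show Pop^[n] (fun y => c * f y) = fun x => c * Pop^[n] f x from funext ih, Pop_smul]

/-- heat kernel constant -/
noncomputable def Chk (d : ℕ) : ℝ := Real.exp 2 * hkc d ^ (d + 1)

lemma Chk_pos (d : ℕ) : 0 < Chk d := by
  have := hkc_one d
  unfold Chk; positivity

lemma sum_iter_le_one (x : Cyl d N) (n : ℕ) (T : Finset (Cyl d N)) :
    ∑ z ∈ T, Pop^[n] (ind {x}) z ≤ 1 := by
  induction n generalizing T with
  | zero =>
    simp only [Function.iterate_zero, id, ind, Set.mem_singleton_iff, Finset.sum_ite_eq']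
    split_ifs <;> simp
  | succ n ih =>
    simp only [Function.iterate_succ_apply']
    unfold Pop at ih ⊢
    simp only [smul_eq_mul] at ih ⊢
    rw [← Finset.mul_sum, Finset.sum_comm]
    have h1 : ∀ e ∈ unitVecs d, ∑ z ∈ T, Pop^[n] (ind {x}) (z + projE d N e) ≤ 1 := by
      intro e _
      have := ih (T.map (addRightEmbedding (projE d N e)))
      rw [Finset.sum_map] at this
      exact this
    have h2 := Finset.sum_le_card_nsmul _ _ _ h1
    rw [card_unitVecs] at h2
    simp only [nsmul_eq_mul, mul_one] at h2
    push_cast at h2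
    rw [div_mul_eq_mul_div, div_le_iff₀ (by positivity)]
    unfold Pop at h2
    simpa using h2

variable [NeZero N]

lemma pt_hk (x z : Cyl d N) (n : ℕ) (hn1 : 1 ≤ n) (hnN : n ≤ N ^ 2) (t : ℝ) (ht : |t| ≤ 1) (hnt : n * t ^ 2 ≤ 1) :
    Pop^[n] (ind {x}) z ≤ Real.exp (-(t * ((x.2 : ℝ) - z.2))) * (Chk d / Real.sqrt n ^ (d + 1)) := by
  have h := heat_kernel (d := d) Finset.univ (fun i => cc i x) n hn1 hnN t ht hnt z
  have h2 : Pop^[n] (fun w => Real.exp (t * x.2) * ind {x} w) z ≤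
      Pop^[n] (fun w => Real.exp (t * w.2) * (if ∀ i ∈ Finset.univ, cc i w = cc i x then 1 else 0)) z := by
    apply iter_mono
    intro w
    unfold ind
    by_cases hw : w = x
    · subst hw; simp
    · simp only [Set.mem_singleton_iff, hw, if_false, mul_zero]
      split_ifs <;> simp [Real.exp_nonneg]
  rw [iter_smul] at h2
  have h3 := h2.trans h
  simp only [Finset.card_univ, Fintype.card_fin] at h3
  have e : Real.exp (-(t * ((x.2 : ℝ) - z.2))) = Real.exp (t * z.2) / Real.exp (t * x.2) := by
    rw [← Real.exp_sub]; congr 1; ring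
  rw [e, div_mul_eq_mul_div, le_div_iff₀ (Real.exp_pos _), mul_comm]
  exact h3

lemma pt_hk0 (x z : Cyl d N) : Pop^[N ^ 2] (ind {x}) z ≤ Chk d / N ^ (d + 1) := by
  have h := pt_hk x z (N ^ 2) (Nat.one_le_pow _ _ (NeZero.pos N)) le_rfl 0 (by simp) (by simp)
  push_cast at h
  rw [Real.sqrt_sq (by positivity)] at h
  simpa using h

lemma pt_far (x z : Cyl d N) (hxz : (N : ℝ) / 8 ≤ |(x.2 : ℝ) - z.2|) (n : ℕ) (hnN : n ≤ N ^ 2) :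
    Pop^[n] (ind {x}) z ≤ Chk d * ((d + 1).factorial * 8 ^ (d + 1)) / N ^ (d + 1) := by
  have hNr : (0 : ℝ) < N := by exact_mod_cast NeZero.pos N
  have hC := Chk_pos d
  rcases Nat.eq_zero_or_pos n with rfl | hn1
  · have : z ≠ x := by rintro rfl; simp at hxz; linarith
    simp only [Function.iterate_zero, id, ind, Set.mem_singleton_iff, this, if_false]
    positivity
  · have hnr : (0 : ℝ) < n := by exact_mod_cast hn1
    have hsn : 0 < Real.sqrt n := Real.sqrt_pos.2 hnr
    have hs1 : 1 ≤ Real.sqrt n := by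
      rw [Real.one_le_sqrt]; exact_mod_cast hn1
    have key : Pop^[n] (ind {x}) z ≤ Real.exp (-(|(x.2 : ℝ) - z.2| / Real.sqrt n)) * (Chk d / Real.sqrt n ^ (d + 1)) := by
      have hsq : Real.sqrt n ^ 2 = n := Real.sq_sqrt hnr.le
      rcases abs_cases ((x.2 : ℝ) - z.2) with ⟨h, _⟩ | ⟨h, _⟩
      · have := pt_hk x z n hn1 hnN (1 / Real.sqrt n)
          (by rw [abs_of_pos (by positivity), div_le_one hsn]; exact hs1)
          (by rw [div_pow, hsq]; field_simp; simp)
        rw [h]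
        convert this using 4
        field_simp
      · have := pt_hk x z n hn1 hnN (-(1 / Real.sqrt n))
          (by rw [abs_neg, abs_of_pos (by positivity), div_le_one hsn]; exact hs1)
          (by rw [neg_sq, div_pow, hsq]; field_simp; simp)
        rw [h]
        convert this using 4
        field_simp
    refine key.trans ?_
    set s := |(x.2 : ℝ) - z.2| / Real.sqrt n with hs
    have hs0 : N / (8 * Real.sqrt n) ≤ s := by
      rw [hs, ← div_div]; gcongr
    have hspos : 0 < N / (8 * Real.sqrt n) := by positivity
    have h1 : Real.exp (-s) ≤ Real.exp (-(N / (8 * Real.sqrt n))) := by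
      apply Real.exp_le_exp.2; linarith
    have h2 := Real.pow_div_factorial_le_exp (N / (8 * Real.sqrt n)) hspos.le (d + 1)
    have hf : (0 : ℝ) < (d + 1).factorial := by exact_mod_cast Nat.factorial_pos _
    have h3 : Real.exp (-(N / (8 * Real.sqrt n))) ≤ (d + 1).factorial * (8 ^ (d + 1) * Real.sqrt n ^ (d + 1)) / N ^ (d + 1) := by
      rw [Real.exp_neg]
      apply inv_le_of_inv_le₀ (by positivity)
      refine le_trans (le_of_eq ?_) h2
      rw [div_pow, mul_pow]
      field_simp
    calc Real.exp (-s) * (Chk d / Real.sqrt n ^ (d + 1)) ≤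
        ((d + 1).factorial * (8 ^ (d + 1) * Real.sqrt n ^ (d + 1)) / N ^ (d + 1)) * (Chk d / Real.sqrt n ^ (d + 1)) := by
          gcongr; exact h1.trans h3
      _ = _ := by field_simp

lemma sum_range_split {f : ℕ → ℝ} (hf : ∀ i, 0 ≤ f i) (m n : ℕ) :
    ∑ i ∈ Finset.range n, f i ≤ ∑ i ∈ Finset.range m, f i + ∑ i ∈ Finset.range n, f (m + i) := by
  rw [← Finset.sum_range_add]
  apply Finset.sum_le_sum_of_subset_of_nonneg
  · intro i; simp; omega
  · intro i _ _; exact hf i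

/-- tail constant -/
noncomputable def Ctl (d : ℕ) : ℝ := 40 * ((d : ℝ) + 1) * Chk d

lemma Ctl_pos (d : ℕ) : 0 < Ctl d := by have := Chk_pos d; unfold Ctl; positivity

lemma powN (hd : 1 ≤ d) : (N : ℝ) ^ (d + 1) = N ^ (d - 1) * N ^ 2 := by
  rw [← pow_add]; congr 1; omega

lemma head_tail (hd : 1 ≤ d) (j : ℤ) (x z : Cyl d N) (n : ℕ) :
    hn j {x} n z ≤ ∑ i ∈ Finset.range (N ^ 2), Pop^[i] (ind {x}) z + Ctl d / N ^ (d - 1) := by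
  have hNr : (0 : ℝ) < N := by exact_mod_cast NeZero.pos N
  have hC := Chk_pos d
  refine (hn_le_sum j {x} n z).trans ?_
  refine (sum_range_split (fun i => Kop_iter_nonneg j (ind_nonneg _) i z) (N ^ 2) (n + 1)).trans ?_
  apply add_le_add
  · exact Finset.sum_le_sum fun i _ => Kop_le_Pop j (ind_nonneg _) i z
  · refine (Kop_tail j (c := Chk d / N ^ (d + 1)) (by positivity) (N ^ 2)
      (fun w => (Kop_le_Pop j (ind_nonneg _) _ w).trans (pt_hk0 x w)) (n + 1) z).trans (le_of_eq ?_)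
    rw [powN hd]; unfold Ctl; field_simp

/-- constant for hitting from afar -/
noncomputable def Cfar (d : ℕ) : ℝ := Chk d * ((d + 1).factorial * 8 ^ (d + 1)) + Ctl d

lemma Cfar_pos (d : ℕ) : 0 < Cfar d := by have := Chk_pos d; have := Ctl_pos d; unfold Cfar; positivity

lemma hA_far (hd : 1 ≤ d) (j : ℤ) (x z : Cyl d N) (hxz : (N : ℝ) / 8 ≤ |(x.2 : ℝ) - z.2|) :
    hA j {x} z ≤ Cfar d / N ^ (d - 1) := by
  have hNr : (0 : ℝ) < N := by exact_mod_cast NeZero.pos N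
  apply hA_le
  intro n
  refine (head_tail hd j x z n).trans ?_
  have h1 := Finset.sum_le_card_nsmul (Finset.range (N ^ 2)) (fun i => Pop^[i] (ind {x}) z) _
    (fun i hi => pt_far x z hxz i (Finset.mem_range.1 hi).le)
  simp only [Finset.card_range, nsmul_eq_mul] at h1
  have h2 : ((N ^ 2 : ℕ) : ℝ) * (Chk d * ((d + 1).factorial * 8 ^ (d + 1)) / N ^ (d + 1)) =
     Chk d * ((d + 1).factorial * 8 ^ (d + 1)) / N ^ (d - 1) := by
    rw [powN hd]; push_cast; field_simp
  rw [h2] at h1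
  unfold Cfar
  rw [add_div]
  linarith

lemma hA_sum (hd : 1 ≤ d) (j : ℤ) (x : Cyl d N) (T : Finset (Cyl d N)) :
    ∑ z ∈ T, hA j {x} z ≤ N ^ 2 + T.card * (Ctl d / N ^ (d - 1)) := by
  have h1 : Tendsto (fun n => ∑ z ∈ T, hn j {x} n z) atTop (nhds (∑ z ∈ T, hA j {x} z)) :=
    tendsto_finsetSum _ fun z _ => hA_tendsto j {x} z
  refine le_of_tendsto' h1 fun n => ?_
  refine (Finset.sum_le_sum fun z _ => head_tail hd j x z n).trans ?_
  rw [Finset.sum_add_distrib, Finset.sum_comm]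
  have h2 := Finset.sum_le_card_nsmul (Finset.range (N ^ 2)) (fun i => ∑ z ∈ T, Pop^[i] (ind {x}) z) 1
    (fun i _ => sum_iter_le_one x i T)
  simp at h2 ⊢
  exact h2

end ab

section markov
variable {X : Type*} [Countable X] [MeasurableSpace X] [MeasurableSingletonClass X]

/-- extension of a finite path -/
def extp {n : ℕ} (g : Fin (n + 1) → X) (i : ℕ) : X := g ⟨min i n, by omega⟩

lemma extp_le {n : ℕ} (g : Fin (n + 1) → X) {i : ℕ} (h : i ≤ n) : extp g i = g ⟨i, by omega⟩ := by
  unfold extp; congr 2; omega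

/-- cylinder formula for a law -/
def CylForm (p : X → X → ℝ≥0∞) (a : X → ℝ≥0∞) (μ : Measure (ℕ → X)) : Prop :=
  ∀ (n : ℕ) (γ : ℕ → X), μ {ω | ∀ i ≤ n, ω i = γ i} =
    a (γ 0) * ∏ i ∈ Finset.range n, p (γ i) (γ (i + 1))

/-- depends on coordinates up to `n` -/
def DepTo {β : Type*} (n : ℕ) (f : (ℕ → X) → β) : Prop :=
  ∀ ω ω' : ℕ → X, (∀ i ≤ n, ω i = ω' i) → f ω = f ω'

lemma restr_meas (n : ℕ) : Measurable (fun (ω : ℕ → X) (i : Fin (n + 1)) => ω i) :=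
  measurable_pi_lambda _ fun i => measurable_pi_apply _

lemma DepTo.eq {β : Type*} {n : ℕ} {f : (ℕ → X) → β} (hf : DepTo n f) (ω : ℕ → X) :
    f ω = f (extp (fun i : Fin (n + 1) => ω i)) :=
  hf _ _ fun i hi => by rw [extp_le _ hi]

lemma DepTo.measurable {n : ℕ} {f : (ℕ → X) → ℝ≥0∞} (hf : DepTo n f) : Measurable f := by
  have : f = (fun g : Fin (n + 1) → X => f (extp g)) ∘ (fun (ω : ℕ → X) (i : Fin (n + 1)) => ω i) :=
    funext fun ω => hf.eq ω
  rw [this]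
  exact (measurable_of_countable _).comp (restr_meas n)

theorem markov_step {p : X → X → ℝ≥0∞} {a : X → ℝ≥0∞} {μ : Measure (ℕ → X)} (hμ : CylForm p a μ)
    {n : ℕ} {f : (ℕ → X) → ℝ≥0∞} (hf : DepTo (n + 1) f) :
    ∫⁻ ω, f ω ∂μ = ∫⁻ ω, ∑' y, p (ω n) y * f (Function.update ω (n + 1) y) ∂μ := by
  set r : (ℕ → X) → (Fin (n + 1) → X) := fun ω i => ω i with hr
  have hrm : Measurable r := restr_meas n
  set F : (Fin (n + 1) → X) × X → ℝ≥0∞ := fun q => f (Function.update (extp q.1) (n + 1) q.2) with hF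
  set G : (Fin (n + 1) → X) → ℝ≥0∞ := fun g => ∑' y, p (g (Fin.last n)) y * F (g, y) with hG
  have h1 : ∀ ω, f ω = F (r ω, ω (n + 1)) := by
    intro ω
    apply hf
    intro i hi
    by_cases h : i = n + 1
    · subst h; simp
    · rw [Function.update_of_ne h, extp_le _ (by omega)]
  have h2 : ∀ ω, ∑' y, p (ω n) y * f (Function.update ω (n + 1) y) = G (r ω) := by
    intro ω
    simp only [hG, hF]
    apply tsum_congr
    intro y
    congr 1
    apply hf
    intro i hi
    by_cases h : i = n + 1
    · subst h; simp
    · rw [Function.update_of_ne h, Function.update_of_ne h, extp_le _ (by omega)]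
  have hpm : Measurable fun ω : ℕ → X => (r ω, ω (n + 1)) := hrm.prodMk (measurable_pi_apply _)
  simp_rw [h2, h1]
  rw [← lintegral_map (f := F) (measurable_of_countable _) hpm, lintegral_countable']
  have hpr := ENNReal.tsum_prod (f := fun g y => F (g, y) * (Measure.map (fun ω : ℕ → X => (r ω, ω (n + 1))) μ) {(g, y)})
  refine hpr.trans ?_
  rw [← lintegral_map (f := G) (measurable_of_countable _) hrm, lintegral_countable']
  apply tsum_congr
  intro g
  simp only [hG]
  rw [← ENNReal.tsum_mul_right]
  apply tsum_congr
  intro y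
  rw [Measure.map_apply hpm (measurableSet_singleton _), Measure.map_apply hrm (measurableSet_singleton _)]
  have e1 : (fun ω : ℕ → X => (r ω, ω (n + 1))) ⁻¹' {(g, y)} =
      {ω | ∀ i ≤ n + 1, ω i = Function.update (extp g) (n + 1) y i} := by
    ext ω
    simp only [Set.mem_preimage, Set.mem_singleton_iff, Prod.mk.injEq, Set.mem_setOf_eq]
    constructor
    · rintro ⟨h, h'⟩ i hi
      by_cases hh : i = n + 1
      · subst hh; simpa using h'
      · rw [Function.update_of_ne hh, extp_le _ (by omega), ← h]
    · intro h
      refine ⟨?_, by simpa using h (n + 1) le_rfl⟩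
      ext i
      have hi : (i : ℕ) ≤ n := by omega
      have := h i (by omega)
      rw [Function.update_of_ne (by omega), extp_le _ hi] at this
      exact this
  have e2 : r ⁻¹' {g} = {ω | ∀ i ≤ n, ω i = extp g i} := by
    ext ω
    simp only [Set.mem_preimage, Set.mem_singleton_iff, Set.mem_setOf_eq]
    constructor
    · rintro h i hi
      rw [extp_le _ hi, ← h]
    · intro h
      ext i
      have hi : (i : ℕ) ≤ n := by omega
      have := h i hi
      rw [extp_le _ hi] at this
      exact this
  rw [e1, e2, hμ, hμ, Finset.prod_range_succ]
  have e3 : ∏ i ∈ Finset.range n, p (Function.update (extp g) (n + 1) y i) (Function.update (extp g) (n + 1) y (i + 1)) =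
      ∏ i ∈ Finset.range n, p (extp g i) (extp g (i + 1)) := by
    apply Finset.prod_congr rfl
    intro i hi
    have := Finset.mem_range.1 hi
    rw [Function.update_of_ne (by omega), Function.update_of_ne (by omega)]
  rw [e3, Function.update_self, Function.update_of_ne (by omega), Function.update_of_ne (by omega), extp_le g le_rfl]
  have : (⟨n, by omega⟩ : Fin (n + 1)) = Fin.last n := rfl
  rw [this]
  ring

/-- supermartingale lemma -/
theorem super_step {p : X → X → ℝ≥0∞} {a : X → ℝ≥0∞} {μ : Measure (ℕ → X)} (hμ : CylForm p a μ)
    {f : ℕ → (ℕ → X) → ℝ≥0∞} (hf : ∀ n, DepTo n (f n))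
    (hs : ∀ n ω, ∑' y, p (ω n) y * f (n + 1) (Function.update ω (n + 1) y) ≤ f n ω) (n : ℕ) :
    ∫⁻ ω, f n ω ∂μ ≤ ∫⁻ ω, f 0 ω ∂μ := by
  induction n with
  | zero => exact le_rfl
  | succ n ih =>
    rw [markov_step hμ (hf (n + 1))]
    exact (lintegral_mono fun ω => hs n ω).trans ih

end markov

section zlat
variable {ν : ℕ}

/-- averaging operator on `ℤ^ν` -/
noncomputable def Pz (f : ZLat ν → ℝ) (v : ZLat ν) : ℝ :=
  (∑ k : Fin ν, (f (v + Pi.single k 1) + f (v + Pi.single k (-1)))) / (2 * ν)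

/-- hitting probabilities of the origin -/
noncomputable def fz : ℕ → ZLat ν → ℝ
  | 0, v => if v = 0 then 1 else 0
  | n + 1, v => if v = 0 then 1 else Pz (fz n) v

lemma Pz_mono {f g : ZLat ν → ℝ} (h : ∀ v, f v ≤ g v) (v) : Pz f v ≤ Pz g v := by
  unfold Pz
  gcongr <;> apply h

lemma Pz_nonneg {f : ZLat ν → ℝ} (h : ∀ v, 0 ≤ f v) (v) : 0 ≤ Pz f v := by
  unfold Pz
  apply div_nonneg _ (by positivity)
  exact Finset.sum_nonneg fun k _ => add_nonneg (h _) (h _)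

lemma fz_nonneg (n : ℕ) (v : ZLat ν) : 0 ≤ fz n v := by
  induction n generalizing v with
  | zero => unfold fz; split_ifs <;> simp
  | succ n ih =>
    unfold fz; split_ifs
    · simp
    · exact Pz_nonneg ih v

lemma fz_zero (n : ℕ) : fz n (0 : ZLat ν) = 1 := by cases n <;> simp [fz]

lemma fz_succ (n : ℕ) (v : ZLat ν) : fz n v ≤ fz (n + 1) v := by
  induction n generalizing v with
  | zero =>
    by_cases h : v = 0
    · subst h; simp [fz_zero]
    · have : fz 0 v = 0 := by simp [fz, h]
      rw [this]; exact fz_nonneg _ _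
  | succ n ih =>
    by_cases h : v = 0
    · subst h; simp [fz_zero]
    · have e : fz (n + 1) v = Pz (fz n) v := by simp [fz, h]
      have e2 : fz (n + 1 + 1) v = Pz (fz (n + 1)) v := by
        conv_lhs => unfold fz
        rw [if_neg h]
      rw [e, e2]
      exact Pz_mono ih v

end zlat

lemma mem_zUnit {d : ℕ} (v : ZLat (d + 1)) : v ∈ zUnitVecs (d + 1) ↔ v ∈ unitVecs d := by
  unfold zUnitVecs unitVecs
  simp only [Set.mem_setOf_eq, Finset.mem_image, Finset.mem_univ, true_and, Prod.exists, Bool.exists_bool]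
  constructor
  · rintro ⟨i, rfl | rfl⟩
    · exact ⟨i, Or.inr (by simp)⟩
    · exact ⟨i, Or.inl (by simp)⟩
  · rintro ⟨i, h | h⟩
    · exact ⟨i, Or.inr (by simpa using h.symm)⟩
    · exact ⟨i, Or.inl (by simpa using h.symm)⟩

lemma zsum {d : ℕ} (x : ZLat (d + 1)) (g : ZLat (d + 1) → ℝ) (hg : ∀ v, 0 ≤ g v) :
    ∑' y, zStep (d + 1) x y * ENNReal.ofReal (g y) = ENNReal.ofReal (Pz g x) := by
  rw [tsum_eq_sum (s := (unitVecs d).image (fun e => x + e))]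
  · rw [Finset.sum_image (by intro a _ b _ h; exact add_left_cancel h)]
    have : ∀ e ∈ unitVecs d, zStep (d + 1) x (x + e) * ENNReal.ofReal (g (x + e)) =
        ENNReal.ofReal ((2 * ((d + 1 : ℕ) : ℝ))⁻¹ * g (x + e)) := by
      intro e he
      unfold zStep
      rw [add_sub_cancel_left, if_pos ((mem_zUnit e).2 he), ENNReal.ofReal_mul (by positivity)]
      congr 1
      rw [ENNReal.ofReal_inv_of_pos (by positivity), ENNReal.ofReal_mul (by norm_num)]
      simp only [ENNReal.ofReal_natCast, ENNReal.ofReal_ofNat]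
    rw [Finset.sum_congr rfl this, ← ENNReal.ofReal_sum_of_nonneg (fun e _ => mul_nonneg (by positivity) (hg _))]
    congr 1
    rw [sum_unitVecs (fun e => (2 * ((d + 1 : ℕ) : ℝ))⁻¹ * g (x + e))]
    unfold Pz
    rw [div_eq_inv_mul, Finset.mul_sum]
    apply Finset.sum_congr rfl
    intro i _; ring
  · intro y hy
    unfold zStep
    rw [if_neg, zero_mul]
    intro h
    apply hy
    rw [Finset.mem_image]
    exact ⟨y - x, (mem_zUnit _).1 h, by abel⟩

theorem ret_bound {ν : ℕ} (hν : 1 ≤ ν) (Q : ZLat ν → Measure (ℕ → ZLat ν)) (hQ : IsLatRW ν Q) (n : ℕ) :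
    Pz (fz n) (0 : ZLat ν) ≤ retProb ν Q := by
  obtain ⟨d, rfl⟩ : ∃ d, ν = d + 1 := ⟨ν - 1, by omega⟩
  have := hQ.1 0
  have hμ : CylForm (zStep (d + 1)) (fun y => if y = 0 then 1 else 0) (Q 0) := fun n γ => hQ.2 0 n γ
  set hit : ℕ → (ℕ → ZLat (d + 1)) → Prop := fun m ω => ∃ i, 1 ≤ i ∧ i ≤ m ∧ ω i = 0 with hhit
  set G : ℕ → (ℕ → ZLat (d + 1)) → ℝ≥0∞ := fun m ω =>
    if m = 0 then ENNReal.ofReal (Pz (fz n) (ω 0)) else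
      if hit m ω then 1 else ENNReal.ofReal (fz (n + 1 - m) (ω m)) with hG
  have hdep : ∀ m, DepTo m (G m) := by
    intro m ω ω' h
    have h1 : hit m ω ↔ hit m ω' := by
      constructor
      · rintro ⟨i, h1, h2, h3⟩; exact ⟨i, h1, h2, by rw [← h i h2, h3]⟩
      · rintro ⟨i, h1, h2, h3⟩; exact ⟨i, h1, h2, by rw [h i h2, h3]⟩
    simp only [hG, h1, h m le_rfl, h 0 (Nat.zero_le _)]
  have hstep : ∀ m, m ≤ n → ∫⁻ ω, G m ω ∂(Q 0) ≤ ∫⁻ ω, G (m + 1) ω ∂(Q 0) := by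
    intro m hm
    rw [markov_step hμ (hdep (m + 1))]
    apply lintegral_mono
    intro ω
    have hnn : ∀ k (v : ZLat (d + 1)), 0 ≤ fz k v := fz_nonneg
    by_cases hh : hit m ω
    · have hm0 : m ≠ 0 := by rintro rfl; obtain ⟨i, h1, h2, _⟩ := hh; omega
      have h1 : ∀ y, G (m + 1) (Function.update ω (m + 1) y) = ENNReal.ofReal 1 := by
        intro y
        simp only [hG]
        rw [if_neg (by omega), if_pos, ENNReal.ofReal_one]
        obtain ⟨i, h1, h2, h3⟩ := hh
        exact ⟨i, h1, by omega, by rw [Function.update_of_ne (by omega), h3]⟩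
      simp only [h1]
      rw [zsum _ (fun _ => 1) (fun _ => by norm_num)]
      have : G m ω = 1 := by simp only [hG]; rw [if_neg hm0, if_pos hh]
      rw [this]
      have : Pz (fun _ => (1 : ℝ)) (ω m) = 1 := by
        unfold Pz; simp; field_simp; norm_num
      rw [this]; simp
    · have h1 : ∀ y, G (m + 1) (Function.update ω (m + 1) y) = ENNReal.ofReal (fz (n - m) y) := by
        intro y
        simp only [hG]
        rw [if_neg (by omega), Function.update_self, show n + 1 - (m + 1) = n - m by omega]
        by_cases hy : y = 0
        · subst hy
          rw [if_pos, fz_zero, ENNReal.ofReal_one]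
          exact ⟨m + 1, by omega, le_rfl, by simp⟩
        · rw [if_neg]
          rintro ⟨i, h1, h2, h3⟩
          by_cases him : i = m + 1
          · subst him; simp at h3; exact hy h3
          · rw [Function.update_of_ne him] at h3
            exact hh ⟨i, h1, by omega, h3⟩
      simp only [h1]
      rw [zsum _ (fz (n - m)) (hnn _)]
      simp only [hG]
      by_cases hm0 : m = 0
      · subst hm0; simp
      · rw [if_neg hm0, if_neg hh, show n + 1 - m = (n - m) + 1 by omega]
        have hne : ω m ≠ 0 := fun h => hh ⟨m, by omega, le_rfl, h⟩
        conv_lhs => unfold fz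
        rw [if_neg hne]
  have hall : ∀ m, m ≤ n + 1 → ∫⁻ ω, G 0 ω ∂(Q 0) ≤ ∫⁻ ω, G m ω ∂(Q 0) := by
    intro m
    induction m with
    | zero => intro _; exact le_rfl
    | succ m ih => intro h; exact (ih (by omega)).trans (hstep m (by omega))
  have h1 := hall (n + 1) le_rfl
  have h2 : ∫⁻ ω, G (n + 1) ω ∂(Q 0) ≤ (Q 0) {ω | ∃ n : ℕ, 1 ≤ n ∧ ω n = 0} := by
    have hms : MeasurableSet {ω : ℕ → ZLat (d + 1) | ∃ n : ℕ, 1 ≤ n ∧ ω n = 0} := by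
      have : {ω : ℕ → ZLat (d + 1) | ∃ n : ℕ, 1 ≤ n ∧ ω n = 0} = ⋃ n : ℕ, ⋃ _ : 1 ≤ n, (fun ω => ω n) ⁻¹' {0} := by
        ext ω; simp
      rw [this]
      exact MeasurableSet.iUnion fun n => MeasurableSet.iUnion fun _ => (measurable_pi_apply n) (measurableSet_singleton _)
    rw [← lintegral_indicator_one hms]
    apply lintegral_mono
    intro ω
    simp only [hG, Set.indicator]
    rw [if_neg (by omega)]
    by_cases hh : hit (n + 1) ω
    · rw [if_pos hh, if_pos]
      · simp
      · obtain ⟨i, h1, h2, h3⟩ := hh; exact ⟨i, h1, h3⟩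
    · have hne : ω (n + 1) ≠ 0 := fun h => hh ⟨n + 1, by omega, le_rfl, h⟩
      rw [if_neg hh]
      simp [fz, hne]
  have h3 : ∫⁻ ω, G 0 ω ∂(Q 0) = ENNReal.ofReal (Pz (fz n) (0 : ZLat (d + 1))) := by
    have hae : ∀ᵐ ω ∂(Q 0), ω 0 = 0 := by
      have hc := hμ 0 (fun _ => 0)
      simp at hc
      have hm : MeasurableSet {ω : ℕ → ZLat (d + 1) | ω 0 = 0} := (measurable_pi_apply 0) (measurableSet_singleton _)
      exact (mem_ae_iff_prob_eq_one hm).2 hc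
    rw [lintegral_congr_ae (g := fun _ => ENNReal.ofReal (Pz (fz n) (0 : ZLat (d + 1))))]
    · simp
    · filter_upwards [hae] with ω hω
      simp [hG, hω]
  rw [h3] at h1
  have h4 := h1.trans h2
  unfold retProb
  rw [ENNReal.ofReal_le_iff_le_toReal (measure_ne_top _ _)] at h4
  exact h4

section cmp
variable {d N : ℕ}

/-- the coordinates outside of `I` -/
noncomputable def sg {I : Finset (Fin (d + 1))} {ν : ℕ} (hI : Iᶜ.card = ν) (k : Fin ν) : Fin (d + 1) :=
  Iᶜ.orderEmbOfFin hI k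

lemma sg_notMem {I : Finset (Fin (d + 1))} {ν : ℕ} (hI : Iᶜ.card = ν) (k : Fin ν) : sg hI k ∉ I := by
  have := Finset.orderEmbOfFin_mem Iᶜ hI k
  rw [Finset.mem_compl] at this
  exact this

lemma sum_split (I : Finset (Fin (d + 1))) {ν : ℕ} (hI : Iᶜ.card = ν) (g : Fin (d + 1) → ℝ) :
    ∑ i, g i = ∑ i ∈ I, g i + ∑ k : Fin ν, g (sg hI k) := by
  rw [← Finset.sum_add_sum_compl I g]
  congr 1
  conv_lhs => rw [← Finset.map_orderEmbOfFin_univ Iᶜ hI]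
  rw [Finset.sum_map]; rfl

/-- restriction of a lattice vector to the coordinates outside of `I` -/
noncomputable def rs {I : Finset (Fin (d + 1))} {ν : ℕ} (hI : Iᶜ.card = ν) (w : Lat d) : ZLat ν :=
  fun k => w (sg hI k)

lemma rs_in {I : Finset (Fin (d + 1))} {ν : ℕ} (hI : Iᶜ.card = ν) (w : Lat d) {i} (hi : i ∈ I) (s : ℤ) :
    rs hI (w + Pi.single i s) = rs hI w := by
  ext k
  have : sg hI k ≠ i := fun h => sg_notMem hI k (h ▸ hi)
  simp [rs, Pi.single_eq_of_ne this]

lemma rs_out {I : Finset (Fin (d + 1))} {ν : ℕ} (hI : Iᶜ.card = ν) (w : Lat d) (k : Fin ν) (s : ℤ) :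
    rs hI (w + Pi.single (sg hI k) s) = rs hI w + Pi.single k s := by
  ext l
  by_cases h : l = k
  · subst h; simp [rs]
  · have : sg hI l ≠ sg hI k := fun hh => h ((Iᶜ.orderEmbOfFin hI).injective hh)
    simp [rs, Pi.single_eq_of_ne h, Pi.single_eq_of_ne this]

lemma projE_add (v w : Lat d) : projE d N (v + w) = projE d N v + projE d N w := by
  unfold projE; ext <;> simp

lemma Pop_split (I : Finset (Fin (d + 1))) {ν : ℕ} (hI : Iᶜ.card = ν) (f : Cyl d N → ℝ) (b w : Lat d)
    (g : ZLat ν → ℝ)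
    (h : ∀ i, ∀ s : ℤ, s = 1 ∨ s = -1 → f (projE d N (b + (w + Pi.single i s))) ≤ g (rs hI (w + Pi.single i s))) :
    Pop f (projE d N (b + w)) ≤ (2 * I.card * g (rs hI w) + 2 * ν * Pz g (rs hI w)) / (2 * (d + 1)) := by
  rw [Pop_eq, sum_split I hI]
  have e : ∀ i s, projE d N (b + w) + projE d N (Pi.single i s) = projE d N (b + (w + Pi.single i s)) := by
    intro i s; rw [← projE_add, add_assoc]
  simp only [e]
  have h1 : ∑ i ∈ I, (f (projE d N (b + (w + Pi.single i 1))) + f (projE d N (b + (w + Pi.single i (-1))))) ≤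
      2 * I.card * g (rs hI w) := by
    refine (Finset.sum_le_card_nsmul _ _ (2 * g (rs hI w)) ?_).trans (le_of_eq ?_)
    · intro i hi
      have a1 := h i 1 (Or.inl rfl)
      have a2 := h i (-1) (Or.inr rfl)
      rw [rs_in hI _ hi] at a1 a2
      linarith
    · rw [nsmul_eq_mul]; ring
  have h2 : ∑ k : Fin ν, (f (projE d N (b + (w + Pi.single (sg hI k) 1))) + f (projE d N (b + (w + Pi.single (sg hI k) (-1))))) ≤
      2 * ν * Pz g (rs hI w) := by
    unfold Pz
    rcases Nat.eq_zero_or_pos ν with h0 | h0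
    · subst h0; simp
    · have : (0 : ℝ) < ν := by exact_mod_cast h0
      rw [mul_div_cancel₀ _ (by positivity)]
      apply Finset.sum_le_sum
      intro k _
      have a1 := h (sg hI k) 1 (Or.inl rfl)
      have a2 := h (sg hI k) (-1) (Or.inr rfl)
      rw [rs_out] at a1 a2
      linarith
  gcongr

lemma cmp_hn (j : ℤ) (I : Finset (Fin (d + 1))) {ν : ℕ} (hI : Iᶜ.card = ν) (hI2 : I.card = 2) (b : Lat d)
    (F : Set (Cyl d N)) (hF : ∀ z ∈ F, ∀ i, i ∉ I → cc i z = (b i : ZMod N)) (n : ℕ) (w : Lat d)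
    (hw : ∀ i, (w i).natAbs + n < N) :
    hn j F n (projE d N (b + w)) ≤ fz n (rs hI w) := by
  have hin : ∀ (w : Lat d), (∀ i, (w i).natAbs < N) → projE d N (b + w) ∈ F → rs hI w = 0 := by
    intro w hw h
    ext k
    have h1 := hF _ h (sg hI k) (sg_notMem hI k)
    rw [cc_projE] at h1
    simp only [Pi.add_apply, Int.cast_add, add_eq_left] at h1
    rw [ZMod.intCast_zmod_eq_zero_iff_dvd] at h1
    exact Int.eq_zero_of_abs_lt_dvd h1 (by have := hw (sg hI k); change |w (sg hI k)| < (N : ℤ); rw [Int.abs_eq_natAbs]; omega)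
  induction n generalizing w with
  | zero =>
    by_cases h : projE d N (b + w) ∈ F
    · rw [hin w (by simpa using hw) h, fz_zero]; exact hn_le_one _ _ _ _
    · have : hn j F 0 (projE d N (b + w)) = 0 := by simp [hn, ind, h]
      rw [this]; exact fz_nonneg _ _
  | succ n ih =>
    by_cases h0 : rs hI w = 0
    · rw [h0, fz_zero]; exact hn_le_one _ _ _ _
    · have h : projE d N (b + w) ∉ F := fun h => h0 (hin w (fun i => by have := hw i; omega) h)
      have e : fz (n + 1) (rs hI w) = Pz (fz n) (rs hI w) := by simp [fz, h0]
      have hle := fz_succ n (rs hI w)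
      have h1 : hn j F (n + 1) (projE d N (b + w)) ≤ Pop (hn j F n) (projE d N (b + w)) := by
        simp only [hn, h, if_false, Kop]
        split_ifs
        · exact le_rfl
        · exact Pop_nonneg (hn_nonneg j F n) _
      refine h1.trans ((Pop_split I hI (hn j F n) b w (fz n) ?_).trans ?_)
      · intro i s hs
        apply ih
        intro l
        have := hw l
        by_cases hl : l = i
        · subst hl; simp only [Pi.add_apply, Pi.single_eq_same]; omega
        · simp only [Pi.add_apply, Pi.single_eq_of_ne hl]; omega
      · rw [← e, hI2]
        have hc : (I.card : ℝ) + ν = d + 1 := by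
          rw [← hI]; exact_mod_cast (by simpa using Finset.card_add_card_compl I)
        rw [hI2] at hc
        push_cast at hc ⊢
        rw [div_le_iff₀ (by positivity), ← hc]
        nlinarith

lemma Pop_hn_F (j : ℤ) (I : Finset (Fin (d + 1))) {ν : ℕ} (hI : Iᶜ.card = ν) (hI2 : I.card = 2) (b : Lat d)
    (F : Set (Cyl d N)) (hF : ∀ z ∈ F, ∀ i, i ∉ I → cc i z = (b i : ZMod N)) (n : ℕ) (hn' : n + 1 < N)
    (q : ℝ) (hq : Pz (fz n) (0 : ZLat ν) ≤ q) :
    Pop (hn j F n) (projE d N b) ≤ 2 / ((d : ℝ) + 1) + (1 - 2 / ((d : ℝ) + 1)) * q := by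
  have h := Pop_split I hI (hn j F n) b 0 (fz n) (by
    intro i s hs
    apply cmp_hn j I hI hI2 b F hF
    intro l
    by_cases hl : l = i
    · subst hl; simp only [Pi.add_apply, Pi.single_eq_same, Pi.zero_apply]; omega
    · simp only [Pi.add_apply, Pi.single_eq_of_ne hl, Pi.zero_apply]; omega)
  rw [add_zero] at h
  refine h.trans ?_
  have hrs : rs hI (0 : Lat d) = 0 := by ext; simp [rs]
  rw [hrs, fz_zero, hI2]
  have hc : (I.card : ℝ) + ν = d + 1 := by
    rw [← hI]; exact_mod_cast (by simpa using Finset.card_add_card_compl I)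
  rw [hI2] at hc
  push_cast at hc ⊢
  have e : 2 / ((d : ℝ) + 1) + (1 - 2 / ((d : ℝ) + 1)) * q = (2 * 2 * 1 + 2 * ν * q) / (2 * (d + 1)) := by
    rw [← hc]; field_simp; ring
  rw [e]
  gcongr

lemma tail_sum (ε : ℝ) (hε : 0 < ε) : ∃ M : ℕ, ∀ k : ℕ,
    ∑ i ∈ Finset.range k, 1 / Real.sqrt ((M + 1 + i : ℕ) : ℝ) ^ 3 ≤ ε := by
  have hs : Summable (fun i : ℕ => 1 / Real.sqrt (i : ℝ) ^ 3) := by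
    have := Real.summable_one_div_nat_rpow (p := 3 / 2)
    refine (this.2 (by norm_num)).congr fun i => ?_
    rw [Real.sqrt_eq_rpow, ← Real.rpow_natCast, ← Real.rpow_mul (by positivity)]
    norm_num
  have ht := tendsto_sum_nat_add (fun i : ℕ => 1 / Real.sqrt (i : ℝ) ^ 3)
  have := (ht.eventually (gt_mem_nhds hε)).exists_forall_of_atTop
  obtain ⟨M, hM⟩ := this
  refine ⟨M, fun k => ?_⟩
  refine le_trans ?_ (hM (M + 1) (by omega)).le
  have hs2 := (summable_nat_add_iff (M + 1)).2 hs
  refine le_trans (le_of_eq ?_) (hs2.sum_le_tsum (Finset.range k) (fun i _ => by positivity))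
  apply Finset.sum_congr rfl
  intro i _
  rw [add_comm]

variable [NeZero N]

lemma plane_hk (j : ℤ) (J : Finset (Fin (d + 1))) (hJ : 3 ≤ J.card) (y : Fin (d + 1) → ZMod N)
    (F : Set (Cyl d N)) (hF : ∀ z ∈ F, ∀ i ∈ J, cc i z = y i) (n : ℕ) (hn1 : 1 ≤ n) (hnN : n ≤ N ^ 2)
    (z : Cyl d N) : (Kop j)^[n] (ind F) z ≤ Chk d * (1 / Real.sqrt n ^ 3) := by
  refine (Kop_le_Pop j (ind_nonneg F) n z).trans ?_
  have h := heat_kernel (d := d) J y n hn1 hnN 0 (by simp) (by simp) z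
  have h2 : Pop^[n] (ind F) z ≤ Pop^[n] (fun x : Cyl d N => Real.exp (0 * x.2) * (if ∀ i ∈ J, cc i x = y i then 1 else 0)) z := by
    apply iter_mono
    intro w
    unfold ind
    by_cases hw : w ∈ F
    · rw [if_pos hw, if_pos (hF w hw)]; simp
    · rw [if_neg hw]; split_ifs <;> simp
  refine (h2.trans h).trans ?_
  rw [zero_mul, Real.exp_zero, one_mul]
  have h3 : (1 : ℝ) ≤ Real.sqrt n := by rw [Real.one_le_sqrt]; exact_mod_cast hn1
  have h4 : Real.sqrt n ^ 3 ≤ Real.sqrt n ^ J.card := pow_le_pow_right₀ h3 hJ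
  rw [mul_one_div]
  have hC := Chk_pos d
  unfold Chk at hC ⊢
  gcongr

lemma plane_tail (j : ℤ) (J : Finset (Fin (d + 1))) (hJ : 3 ≤ J.card) (y : Fin (d + 1) → ZMod N)
    (F : Set (Cyl d N)) (hF : ∀ z ∈ F, ∀ i ∈ J, cc i z = y i) (M : ℕ) (hM : M + 1 ≤ N ^ 2) (ε : ℝ)
    (hε : ∀ k : ℕ, ∑ i ∈ Finset.range k, 1 / Real.sqrt ((M + 1 + i : ℕ) : ℝ) ^ 3 ≤ ε) (z : Cyl d N) :
    hA j F z ≤ hn j F M z + (Chk d * ε + Ctl d / N) := by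
  have hC := Chk_pos d
  have hNr : (0 : ℝ) < N := by exact_mod_cast NeZero.pos N
  apply hA_le
  intro n
  refine (hn_mono j F (show n ≤ M + n by omega) z).trans ((hn_le_add j F M n z).trans ?_)
  gcongr
  refine (sum_range_split (fun i => Kop_iter_nonneg j (ind_nonneg F) _ z) (N ^ 2 - (M + 1)) n).trans ?_
  apply add_le_add
  · calc ∑ i ∈ Finset.range (N ^ 2 - (M + 1)), (Kop j)^[M + 1 + i] (ind F) z ≤
        ∑ i ∈ Finset.range (N ^ 2 - (M + 1)), Chk d * (1 / Real.sqrt ((M + 1 + i : ℕ) : ℝ) ^ 3) := by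
          apply Finset.sum_le_sum
          intro i hi
          have := Finset.mem_range.1 hi
          exact plane_hk j J hJ y F hF _ (by omega) (by omega) z
      _ ≤ _ := by rw [← Finset.mul_sum]; have := hε (N ^ 2 - (M + 1)); gcongr
  · have h1 : ∀ i, M + 1 + (N ^ 2 - (M + 1) + i) = N ^ 2 + i := by intro i; omega
    simp only [h1]
    refine (Kop_tail j (c := Chk d * (1 / N ^ 3)) (by positivity) (N ^ 2) ?_ n z).trans ?_
    · intro w
      have := plane_hk j J hJ y F hF (N ^ 2) (Nat.one_le_pow _ _ (NeZero.pos N)) le_rfl w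
      push_cast at this
      rwa [Real.sqrt_sq hNr.le] at this
    · apply le_of_eq; unfold Ctl; field_simp

end cmp

theorem q_bound (d : ℕ) (hd : 4 ≤ d) (q : ℝ) (hq : ∀ n, Pz (fz n) (0 : ZLat (d - 1)) ≤ q) (ε : ℝ) (hε : 0 < ε) :
    ∃ N₀ : ℕ, ∀ N : ℕ, N₀ ≤ N → ∀ (j : ℤ), ∀ F ∈ Lcoll d N 2, ∀ x ∈ F,
      Pop (hA j F) x ≤ 2 / ((d : ℝ) + 1) + (1 - 2 / ((d : ℝ) + 1)) * q + ε := by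
  have hC := Chk_pos d
  have hC2 := Ctl_pos d
  obtain ⟨M, hM⟩ := tail_sum (ε / (2 * Chk d)) (by positivity)
  obtain ⟨N1, hN1⟩ := exists_nat_ge (2 * Ctl d / ε)
  refine ⟨N1 + M + 2, fun N hN j F hF x hx => ?_⟩
  haveI : NeZero N := ⟨by omega⟩
  have hNr : (0 : ℝ) < N := by exact_mod_cast NeZero.pos N
  obtain ⟨I, hI2, y, rfl⟩ := hF
  obtain ⟨v, hv, rfl⟩ := hx
  set F : Set (Cyl d N) := (fun v => projE d N (y + v)) '' {v : Lat d | ∀ i ∉ I, v i = 0} with hFdef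
  have hI : Iᶜ.card = d - 1 := by
    rw [Finset.card_compl, hI2]; simp
  have hF : ∀ z ∈ F, ∀ i, i ∉ I → cc i z = ((y + v) i : ZMod N) := by
    rintro z ⟨v', hv', rfl⟩ i hi
    simp only
    rw [cc_projE, Pi.add_apply, Pi.add_apply, hv' i hi, hv i hi]
  have h1 := Pop_hn_F j I hI hI2 (y + v) F hF M (by omega) q (hq M)
  have h2 := fun z => plane_tail j Iᶜ (by omega) (fun i => (((y + v) i : ℤ) : ZMod N)) F
    (fun z hz i hi => hF z hz i (by simpa using hi)) M (by nlinarith) _ hM z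
  have h3 : Pop (hA j F) (projE d N (y + v)) ≤ Pop (hn j F M) (projE d N (y + v)) +
      (Chk d * (ε / (2 * Chk d)) + Ctl d / N) := by
    refine (Pop_mono (g := fun z => hn j F M z + (Chk d * (ε / (2 * Chk d)) + Ctl d / N)) fun e _ => h2 _).trans ?_
    rw [Pop_add, Pop_const]
  have h4 : Chk d * (ε / (2 * Chk d)) = ε / 2 := by field_simp
  have h5 : Ctl d / N ≤ ε / 2 := by
    have : (N1 : ℝ) ≤ N := by exact_mod_cast (by omega)
    have := hN1.trans this
    rw [div_le_iff₀ hε] at this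
    rw [div_le_iff₀ hNr]; linarith
  rw [h4] at h3
  simp only
  linarith

section super
variable {d N : ℕ}

/-- supersolution -/
noncomputable def uA (j : ℤ) (m : ℝ) (A : Set (Cyl d N)) (x : Cyl d N) : ℝ := 1 + m * hA j A x

lemma one_le_uA (j : ℤ) {m : ℝ} (hm : 0 ≤ m) (A : Set (Cyl d N)) (x) : 1 ≤ uA j m A x := by
  unfold uA; have := mul_nonneg hm (hA_nonneg j A x); linarith

lemma uA_le (j : ℤ) {m : ℝ} (hm : 0 ≤ m) (A : Set (Cyl d N)) (x) : uA j m A x ≤ 1 + m := by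
  unfold uA; have := mul_le_mul_of_nonneg_left (hA_le_one j A x) hm; linarith

lemma Pop_uA (j : ℤ) (m : ℝ) (A : Set (Cyl d N)) (x) : Pop (uA j m A) x = 1 + m * Pop (hA j A) x := by
  unfold uA
  rw [Pop_add, Pop_const, Pop_smul]

lemma uA_super (j : ℤ) {E r m : ℝ} (hE : 1 ≤ E) (hr1 : E * r < 1) (hm : m = (E - 1) / (1 - E * r))
    {A : Set (Cyl d N)} (hr : ∀ x ∈ A, Pop (hA j A) x ≤ r) {x : Cyl d N} (hx : x ∈ Btl d N j) :
    (if x ∈ A then E else 1) * Pop (uA j m A) x ≤ uA j m A x := by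
  have h1 : 0 < 1 - E * r := by linarith
  have hm0 : 0 ≤ m := by rw [hm]; apply div_nonneg <;> linarith
  have hm2 : m * (1 - E * r) = E - 1 := by rw [hm]; field_simp
  rw [Pop_uA]
  by_cases h : x ∈ A
  · rw [if_pos h]
    unfold uA
    rw [hA_in j h]
    have := mul_le_mul_of_nonneg_left (hr x h) (mul_nonneg (by linarith : (0:ℝ) ≤ E) hm0)
    nlinarith
  · rw [if_neg h, hA_harm j h hx]; unfold uA; simp

lemma cylsum (x : Cyl d N) (g : Cyl d N → ℝ) (hg : ∀ v, 0 ≤ g v) :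
    ∑' y, stepProb d N x y * ENNReal.ofReal (g y) = ENNReal.ofReal (Pop g x) := by
  have h1 : ∀ y, stepProb d N x y * ENNReal.ofReal (g y) =
      ∑ e ∈ unitVecs d, (if y = x + projE d N e then (2 * ((d : ℝ≥0∞) + 1))⁻¹ * ENNReal.ofReal (g (x + projE d N e)) else 0) := by
    intro y
    unfold stepProb
    rw [div_eq_mul_inv, mul_assoc, ← nsmul_eq_mul, ← Finset.sum_const, Finset.sum_filter]
    apply Finset.sum_congr rfl
    intro e _
    by_cases h : x + projE d N e = y
    · rw [if_pos h, if_pos h.symm, h]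
    · rw [if_neg h, if_neg (fun hh => h hh.symm)]
  simp_rw [h1]
  rw [Summable.tsum_finsetSum (fun _ _ => ENNReal.summable)]
  simp only [tsum_ite_eq]
  rw [← Finset.mul_sum, ← ENNReal.ofReal_sum_of_nonneg (fun e _ => hg _)]
  unfold Pop
  rw [smul_eq_mul, ENNReal.ofReal_mul (by positivity)]
  congr 1
  rw [one_div, ENNReal.ofReal_inv_of_pos (by positivity), ENNReal.ofReal_mul (by norm_num), ENNReal.ofReal_add (by positivity) (by norm_num)]
  simp

/-- `B_0` as a finset -/
noncomputable def B0f (d N : ℕ) [NeZero N] : Finset (Cyl d N) :=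
  Finset.univ ×ˢ Finset.Icc (-(N : ℤ)) N

lemma mem_B0f [NeZero N] (x : Cyl d N) : x ∈ B0f d N ↔ x ∈ Bblk d N 0 := by
  unfold B0f Bblk; simp

lemma card_B0f [NeZero N] : (B0f d N).card = N ^ d * (2 * N + 1) := by
  unfold B0f
  rw [Finset.card_product]
  simp [ZMod.card]
  left; omega

lemma law_form {Pl : Cyl d N → Measure (ℕ → Cyl d N)} (h : IsCylRW d N Pl) :
    CylForm (stepProb d N) (fun x => ((N : ℝ≥0∞) ^ d * (2 * N + 1))⁻¹ * (if x ∈ Bblk d N 0 then 1 else 0)) (lawP d N Pl) := by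
  intro n γ
  unfold lawP
  rw [Measure.smul_apply, Measure.sum_apply_of_countable, smul_eq_mul, mul_assoc]
  congr 1
  rw [tsum_eq_single (γ 0)]
  · split_ifs
    · rw [h.2]; simp
    · simp
  · intro x hx
    split_ifs
    · rw [h.2, if_neg (Ne.symm hx), zero_mul]
    · simp

lemma law_init [NeZero N] {Pl : Cyl d N → Measure (ℕ → Cyl d N)} (h : IsCylRW d N Pl) (g : Cyl d N → ℝ) (hg : ∀ x, 0 ≤ g x) :
    ∫⁻ ω, ENNReal.ofReal (g (ω 0)) ∂(lawP d N Pl) = ENNReal.ofReal ((∑ x ∈ B0f d N, g x) / (N ^ d * (2 * N + 1))) := by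
  have hNr : (0 : ℝ) < N := by exact_mod_cast NeZero.pos N
  unfold lawP
  rw [lintegral_smul_measure, lintegral_sum_measure, tsum_eq_sum (s := B0f d N)]
  · have h1 : ∀ x ∈ B0f d N, ∫⁻ ω, ENNReal.ofReal (g (ω 0)) ∂(if x ∈ Bblk d N 0 then Pl x else 0) = ENNReal.ofReal (g x) := by
      intro x hx
      rw [if_pos ((mem_B0f x).1 hx)]
      haveI := h.1 x
      have h2 : ∀ᵐ ω ∂(Pl x), ω 0 = x := by
        have h3 := h.2 x 0 (fun _ => x)
        simp only [if_true, Finset.range_zero, Finset.prod_empty, mul_one, Nat.le_zero, forall_eq] at h3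
        rw [← prob_compl_eq_zero_iff] at h3
        · exact h3
        · exact measurableSet_preimage (measurable_pi_apply (X := fun _ : ℕ => Cyl d N) 0) (measurableSet_singleton x)
      rw [lintegral_congr_ae (h2.mono fun ω hω => by simp only [hω] : (fun ω : ℕ → Cyl d N => ENNReal.ofReal (g (ω 0))) =ᵐ[Pl x] fun _ => ENNReal.ofReal (g x))]
      simp
    rw [Finset.sum_congr rfl h1, ← ENNReal.ofReal_sum_of_nonneg (fun x _ => hg x), smul_eq_mul, div_eq_inv_mul,
      ENNReal.ofReal_mul (by positivity), ENNReal.ofReal_inv_of_pos (by positivity)]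
    congr 2
    rw [ENNReal.ofReal_mul (by positivity), ENNReal.ofReal_pow (by positivity), ENNReal.ofReal_add (by positivity) (by norm_num),
      ENNReal.ofReal_mul (by norm_num)]
    simp
  · intro x hx
    rw [if_neg (fun h => hx ((mem_B0f x).2 h))]
    simp

end super

/-- state of the excursion machine -/
structure St (d N : ℕ) where
  k : ℕ
  inn : Prop
  H0 : Finset (Cyl d N)
  H : Finset (Cyl d N)

section machine
variable {d N : ℕ}

/-- one step of the machine -/
noncomputable def stp (j : ℤ) (K : ℕ) (A0 : Finset (Cyl d N)) (x y : Cyl d N) (s : St d N) : St d N :=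
  if s.inn then
    (if y ∈ Btl d N j then ⟨s.k, True, s.H0, s.H ∪ ({x} ∩ A0)⟩ else ⟨s.k + 1, False, s.H ∪ ({x} ∩ A0), s.H ∪ ({x} ∩ A0)⟩)
  else if s.k < K ∧ y ∈ Bblk d N j then ⟨s.k, True, s.H, s.H⟩ else s

/-- the machine along a path -/
noncomputable def stt (j : ℤ) (K : ℕ) (A0 : Finset (Cyl d N)) (ω : ℕ → Cyl d N) : ℕ → St d N
  | 0 => ⟨0, ω 0 ∈ Bblk d N j, ∅, ∅⟩
  | n + 1 => stp j K A0 (ω n) (ω (n + 1)) (stt j K A0 ω n)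

lemma B_sub_Bt [NeZero N] (j : ℤ) {x : Cyl d N} (h : x ∈ Bblk d N j) : x ∈ Btl d N j := by
  have : (1 : ℤ) ≤ N := by exact_mod_cast NeZero.pos N
  unfold Bblk at h
  unfold Btl
  simp only [Set.mem_setOf_eq] at *
  constructor <;> nlinarith [h.1, h.2]

/-- local invariant of the machine -/
structure Inv (j : ℤ) (K : ℕ) (A0 : Finset (Cyl d N)) (x : Cyl d N) (s : St d N) : Prop where
  kle : s.k ≤ K
  sub0 : s.H0 ⊆ s.H
  subA : s.H ⊆ A0
  inK : s.inn → s.k < K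
  inB : s.inn → x ∈ Btl d N j
  outB : ¬ s.inn → s.k < K → x ∉ Bblk d N j

lemma inv_step [NeZero N] {j : ℤ} {K : ℕ} {A0 : Finset (Cyl d N)} {x : Cyl d N} (y : Cyl d N) {s : St d N} (h : Inv j K A0 x s) :
    Inv j K A0 y (stp j K A0 x y s) := by
  have hH : s.H ∪ ({x} ∩ A0) ⊆ A0 := Finset.union_subset h.subA Finset.inter_subset_right
  unfold stp
  by_cases hi : s.inn
  · rw [if_pos hi]
    have := h.inK hi
    by_cases hy : y ∈ Btl d N j
    · rw [if_pos hy]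
      exact ⟨h.kle, h.sub0.trans Finset.subset_union_left, hH, fun _ => this, fun _ => hy, fun h => absurd trivial h⟩
    · rw [if_neg hy]
      exact ⟨this, subset_rfl, hH, fun h => h.elim, fun h => h.elim, fun _ _ hB => hy (B_sub_Bt j hB)⟩
  · rw [if_neg hi]
    by_cases hy : s.k < K ∧ y ∈ Bblk d N j
    · rw [if_pos hy]
      exact ⟨h.kle, subset_rfl, h.subA, fun _ => hy.1, fun _ => B_sub_Bt j hy.2, fun h => absurd trivial h⟩
    · rw [if_neg hy]
      exact ⟨h.kle, h.sub0, h.subA, h.inK, fun h => absurd h hi, fun _ hk hB => hy ⟨hk, hB⟩⟩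

lemma inv_stt [NeZero N] {j : ℤ} {K : ℕ} (hK : 1 ≤ K) (A0 : Finset (Cyl d N)) (ω : ℕ → Cyl d N) (n : ℕ) :
    Inv j K A0 (ω n) (stt j K A0 ω n) := by
  induction n with
  | zero => exact ⟨by simp [stt], by simp [stt], by simp [stt], fun _ => hK, fun h => B_sub_Bt j h, fun h _ => h⟩
  | succ n ih => exact inv_step _ ih

lemma stt_dep (j : ℤ) (K : ℕ) (A0 : Finset (Cyl d N)) (n : ℕ) : DepTo n (fun ω => stt j K A0 ω n) := by
  intro ω ω' h
  induction n with
  | zero => simp only [stt]; rw [h 0 le_rfl]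
  | succ n ih =>
    simp only [stt]
    have := ih (fun i hi => h i (by omega))
    simp only at this
    rw [this, h n (by omega), h (n + 1) le_rfl]

lemma H_mono (j : ℤ) (K : ℕ) (A0 : Finset (Cyl d N)) (ω : ℕ → Cyl d N) : Monotone fun n => (stt j K A0 ω n).H := by
  apply monotone_nat_of_le_succ
  intro n
  simp only [stt, stp]
  split_ifs <;> simp

/-- data for the master lemma -/
structure PotData (d N : ℕ) (j : ℤ) (K : ℕ) (A0 : Finset (Cyl d N)) (lam : ℝ) where
  u : Finset (Cyl d N) → Cyl d N → ℝ
  a : ℕ → Finset (Cyl d N) → ℝ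
  b : ℕ → Finset (Cyl d N) → ℝ
  Ψ : ℕ → Finset (Cyl d N) → ℝ
  α : Finset (Cyl d N) → Finset (Cyl d N)
  lam0 : 0 ≤ lam
  a0 : ∀ k H, 0 ≤ a k H
  b0 : ∀ k H, 0 ≤ b k H
  Ψ0 : ∀ k H, 0 ≤ Ψ k H
  αs : ∀ H ⊆ A0, α H ⊆ A0
  αd : ∀ H ⊆ A0, Disjoint H (α H)
  u1 : ∀ A ⊆ A0, ∀ x, 1 ≤ u A x
  us : ∀ A ⊆ A0, ∀ x ∈ Btl d N j, (if x ∈ A then Real.exp lam else 1) * Pop (u A) x ≤ u A x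
  hβ : ∀ k < K, ∀ H ⊆ A0, ∀ y : Cyl d N, (y.2 = (j - 1) * N ∨ y.2 = (j + 1) * N) → a k H + b k H * u (α H) y ≤ Ψ k H
  h2 : ∀ k < K, ∀ H0 H : Finset (Cyl d N), H0 ⊆ H → H ⊆ A0 → Ψ (k + 1) H ≤ a k H0 + b k H0 * Real.exp (lam * (H ∩ α H0).card)

variable {j : ℤ} {K : ℕ} {A0 : Finset (Cyl d N)} {lam : ℝ}

/-- potential -/
noncomputable def pot (Q : PotData d N j K A0 lam) (s : St d N) (x : Cyl d N) : ℝ :=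
  if s.inn then Q.a s.k s.H0 + Q.b s.k s.H0 * (Real.exp (lam * (s.H ∩ Q.α s.H0).card) * Q.u (Q.α s.H0) x) else Q.Ψ s.k s.H

lemma u0 (Q : PotData d N j K A0 lam) {A} (h : A ⊆ A0) (x) : 0 ≤ Q.u A x := zero_le_one.trans (Q.u1 A h x)

lemma pot_in_ge (Q : PotData d N j K A0 lam) {s : St d N} {x : Cyl d N} (h : Inv j K A0 x s) (y : Cyl d N) (hi : s.inn) :
    Q.Ψ (s.k + 1) s.H ≤ Q.a s.k s.H0 + Q.b s.k s.H0 * (Real.exp (lam * (s.H ∩ Q.α s.H0).card) * Q.u (Q.α s.H0) y) := by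
  refine (Q.h2 s.k (h.inK hi) s.H0 s.H h.sub0 h.subA).trans ?_
  have := Q.u1 (Q.α s.H0) (Q.αs _ (h.sub0.trans h.subA)) y
  have hb := Q.b0 s.k s.H0
  gcongr
  nlinarith [Real.exp_pos (lam * (s.H ∩ Q.α s.H0).card)]

lemma pot_step [NeZero N] (Q : PotData d N j K A0 lam) {s : St d N} {x : Cyl d N} (h : Inv j K A0 x s) :
    Pop (fun y => pot Q (stp j K A0 x y s) y) x ≤ pot Q s x := by
  by_cases hi : s.inn
  · have hsub : Q.α s.H0 ⊆ A0 := Q.αs _ (h.sub0.trans h.subA)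
    set H' := s.H ∪ ({x} ∩ A0) with hH'
    have hH'A : H' ⊆ A0 := Finset.union_subset h.subA Finset.inter_subset_right
    have h1 : ∀ y, pot Q (stp j K A0 x y s) y ≤ Q.a s.k s.H0 + Q.b s.k s.H0 * (Real.exp (lam * (H' ∩ Q.α s.H0).card) * Q.u (Q.α s.H0) y) := by
      intro y
      unfold stp
      rw [if_pos hi]
      by_cases hy : y ∈ Btl d N j
      · rw [if_pos hy]; simp only [pot, if_true]; exact le_rfl
      · rw [if_neg hy]
        simp only [pot, if_false]
        have h' : Inv j K A0 x ⟨s.k, True, s.H0, H'⟩ :=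
          ⟨h.kle, h.sub0.trans Finset.subset_union_left, hH'A, fun _ => h.inK hi, fun _ => h.inB hi, fun h => absurd trivial h⟩
        exact pot_in_ge Q h' y trivial
    refine (Pop_mono (g := fun y => Q.a s.k s.H0 + (Q.b s.k s.H0 * Real.exp (lam * (H' ∩ Q.α s.H0).card)) * Q.u (Q.α s.H0) y) fun e _ => by
      rw [mul_assoc]; exact h1 _).trans ?_
    rw [Pop_add, Pop_const, Pop_smul]
    unfold pot
    rw [if_pos hi]
    have hP0 : 0 ≤ Pop (Q.u (Q.α s.H0)) x := Pop_nonneg (u0 Q hsub) x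
    have hus := Q.us _ hsub x (h.inB hi)
    have hb := Q.b0 s.k s.H0
    rw [mul_assoc]
    refine add_le_add le_rfl (mul_le_mul_of_nonneg_left ?_ hb)
    by_cases hxα : x ∈ Q.α s.H0
    · rw [if_pos hxα] at hus
      have hc : (H' ∩ Q.α s.H0).card ≤ (s.H ∩ Q.α s.H0).card + 1 := by
        have : H' ∩ Q.α s.H0 ⊆ insert x (s.H ∩ Q.α s.H0) := by
          intro z hz
          simp only [hH', Finset.mem_inter, Finset.mem_union, Finset.mem_singleton, Finset.mem_insert] at hz ⊢
          tauto
        exact (Finset.card_le_card this).trans (Finset.card_insert_le _ _)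
      have hc' : ((H' ∩ Q.α s.H0).card : ℝ) ≤ (s.H ∩ Q.α s.H0).card + 1 := by exact_mod_cast hc
      have : Real.exp (lam * (H' ∩ Q.α s.H0).card) ≤ Real.exp (lam * (s.H ∩ Q.α s.H0).card) * Real.exp lam := by
        rw [← Real.exp_add]; apply Real.exp_le_exp.2; nlinarith [Q.lam0]
      calc _ ≤ Real.exp (lam * (s.H ∩ Q.α s.H0).card) * Real.exp lam * Pop (Q.u (Q.α s.H0)) x := by gcongr
        _ ≤ _ := by rw [mul_assoc]; gcongr
    · rw [if_neg hxα, one_mul] at hus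
      have : H' ∩ Q.α s.H0 = s.H ∩ Q.α s.H0 := by
        ext z
        simp only [hH', Finset.mem_inter, Finset.mem_union, Finset.mem_singleton]
        constructor
        · rintro ⟨h1 | h1, h2⟩
          · exact ⟨h1, h2⟩
          · rw [h1.1] at h2; exact absurd h2 hxα
        · rintro ⟨h1, h2⟩; exact ⟨Or.inl h1, h2⟩
      rw [this]
      gcongr
  · have h1 : ∀ e ∈ unitVecs d, pot Q (stp j K A0 x (x + projE d N e) s) (x + projE d N e) ≤ Q.Ψ s.k s.H := by
      intro e he
      have hsn := snd_unit x he
      set y := x + projE d N e with hy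
      unfold stp
      rw [if_neg hi]
      by_cases hc : s.k < K ∧ y ∈ Bblk d N j
      · rw [if_pos hc]
        simp only [pot, if_true]
        rw [(Finset.disjoint_iff_inter_eq_empty.1 (Q.αd s.H h.subA))]
        simp only [Finset.card_empty, Nat.cast_zero, mul_zero, Real.exp_zero, one_mul]
        apply Q.hβ s.k hc.1 s.H h.subA
        have hx := h.outB hi hc.1
        have hyB := hc.2
        unfold Bblk at hx hyB
        simp only [Set.mem_setOf_eq, not_and_or, not_le] at hx hyB
        rw [abs_le] at hsn
        rcases hx with hx | hx
        · left; linarith [hyB.1, hsn.2, hsn.1, Int.add_one_le_of_lt hx]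
        · right; linarith [hyB.2, hsn.1, Int.add_one_le_of_lt hx]
      · rw [if_neg hc]; simp only [pot, if_neg hi]; exact le_rfl
    refine (Pop_mono (g := fun _ => Q.Ψ s.k s.H) h1).trans ?_
    rw [Pop_const]
    simp only [pot, if_neg hi]; exact le_rfl

lemma pot_nonneg (Q : PotData d N j K A0 lam) {s : St d N} (h : s.H0 ⊆ A0) (x : Cyl d N) : 0 ≤ pot Q s x := by
  unfold pot
  split_ifs
  · have := Q.a0 s.k s.H0
    have := Q.b0 s.k s.H0
    have := u0 Q (Q.αs _ h) x
    positivity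
  · exact Q.Ψ0 _ _

theorem master [NeZero N] (hK : 1 ≤ K) (Q : PotData d N j K A0 lam) {a : Cyl d N → ℝ≥0∞} {μ : Measure (ℕ → Cyl d N)} (hμ : CylForm (stepProb d N) a μ)
    (G : Set (Finset (Cyl d N))) (hup : ∀ H H', H ⊆ H' → H ∈ G → H' ∈ G)
    (hG : ∀ k ≤ K, ∀ H ∈ G, 1 ≤ Q.Ψ k H) :
    μ {ω | ∃ n, (stt j K A0 ω n).H ∈ G} ≤ ∫⁻ ω, ENNReal.ofReal (pot Q ⟨0, ω 0 ∈ Bblk d N j, ∅, ∅⟩ (ω 0)) ∂μ := by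
  have hdep : ∀ n, DepTo n fun ω : ℕ → Cyl d N => ENNReal.ofReal (pot Q (stt j K A0 ω n) (ω n)) := by
    intro n ω ω' h
    have := stt_dep j K A0 n ω ω' h
    simp only at this ⊢
    rw [this, h n le_rfl]
  have hss := super_step hμ hdep (by
    intro n ω
    have hinv := inv_stt (j := j) hK A0 ω n
    have e : ∀ y, ENNReal.ofReal (pot Q (stt j K A0 (Function.update ω (n + 1) y) (n + 1)) (Function.update ω (n + 1) y (n + 1))) =
        ENNReal.ofReal (pot Q (stp j K A0 (ω n) y (stt j K A0 ω n)) y) := by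
      intro y
      have := stt_dep j K A0 n (Function.update ω (n + 1) y) ω (fun i hi => by rw [Function.update_of_ne (by omega)])
      simp only at this
      simp only [stt, Function.update_self]
      rw [this, Function.update_of_ne (by omega)]
    simp only [e]
    rw [cylsum]
    · exact ENNReal.ofReal_le_ofReal (pot_step Q hinv)
    · intro y
      have := inv_step y hinv
      exact pot_nonneg Q (this.sub0.trans this.subA) y)
  have hU : {ω : ℕ → Cyl d N | ∃ n, (stt j K A0 ω n).H ∈ G} = ⋃ n, {ω | (stt j K A0 ω n).H ∈ G} := by ext; simp
  rw [hU, Monotone.measure_iUnion]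
  · apply iSup_le
    intro n
    refine le_trans ?_ (hss n)
    have hm := mul_meas_ge_le_lintegral (μ := μ) (hdep n).measurable 1
    rw [one_mul] at hm
    refine le_trans (measure_mono ?_) hm
    intro ω hω
    simp only [Set.mem_setOf_eq] at hω ⊢
    have hinv := inv_stt (j := j) hK A0 ω n
    rw [ENNReal.one_le_ofReal]
    by_cases hi : (stt j K A0 ω n).inn
    · refine (hG _ (hinv.inK hi) _ hω).trans ?_
      refine (pot_in_ge Q hinv (ω n) hi).trans (le_of_eq ?_)
      unfold pot; rw [if_pos hi]
    · unfold pot; rw [if_neg hi]; exact hG _ hinv.kle _ hω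
  · intro n m hnm ω hω
    exact hup _ _ (H_mono j K A0 ω hnm) hω

/-! ### Relation with the departure times -/

lemma after_coe {X : Type*} (m : ℕ) (f : (ℕ → X) → ℕ∞) (ω : ℕ → X) : after (m : ℕ∞) f ω = m + f fun k => ω (k + m) := rfl

lemma entT_le {X : Type*} {U : Set X} {ω : ℕ → X} {n : ℕ} (h : ω n ∈ U) : entT U ω ≤ n := sInf_le ⟨n, h, rfl⟩

lemma DD_succ_le (ω : ℕ → Cyl d N) (k b c : ℕ) (h1 : DD d N j k ω ≤ b) (hbc : b ≤ c) (hb : ω b ∈ Bblk d N j) (hc : ω c ∉ Btl d N j) :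
    DD d N j (k + 1) ω ≤ c := by
  obtain ⟨m, hm⟩ := ENat.ne_top_iff_exists.1 (ne_top_of_le_ne_top (ENat.coe_ne_top b) h1)
  rw [← hm] at h1
  have hmb : m ≤ b := by exact_mod_cast h1
  simp only [DD]
  rw [← hm, after_coe]
  unfold oneExc
  have hR : entT (Bblk d N j) (fun k => ω (k + m)) ≤ ((b - m : ℕ) : ℕ∞) := entT_le (by
    rw [Nat.sub_add_cancel hmb]; exact hb)
  obtain ⟨r, hr⟩ := ENat.ne_top_iff_exists.1 (ne_top_of_le_ne_top (ENat.coe_ne_top _) hR)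
  rw [← hr] at hR ⊢
  have hrb : r ≤ b - m := by exact_mod_cast hR
  rw [after_coe]
  have hT : exitT (Btl d N j) (fun k => ω (k + r + m)) ≤ ((c - m - r : ℕ) : ℕ∞) := entT_le (by
    change ω _ ∉ _
    rw [show c - m - r + r + m = c by omega]; exact hc)
  calc (m : ℕ∞) + (r + exitT (Btl d N j) (fun k => ω (k + r + m))) ≤ (m : ℕ∞) + (r + ((c - m - r : ℕ) : ℕ∞)) := by gcongr
    _ = c := by norm_cast; omega

lemma stt_DD (hK : 1 ≤ K) (ω : ℕ → Cyl d N) (n : ℕ) :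
    ((stt j K A0 ω n).inn → ∃ b ≤ n, DD d N j (stt j K A0 ω n).k ω ≤ b ∧ ω b ∈ Bblk d N j) ∧
    (¬ (stt j K A0 ω n).inn → ∃ b ≤ n, DD d N j (stt j K A0 ω n).k ω ≤ b ∧ (1 ≤ (stt j K A0 ω n).k → ω b ∉ Btl d N j)) := by
  induction n with
  | zero =>
    simp only [stt]
    refine ⟨fun h => ⟨0, le_rfl, by simp [DD], h⟩, fun _ => ⟨0, le_rfl, by simp [DD], fun h => absurd h (by omega)⟩⟩
  | succ n ih =>
    simp only [stt]
    set s := stt j K A0 ω n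
    unfold stp
    by_cases hi : s.inn
    · rw [if_pos hi]
      obtain ⟨b, hb, h1, h2⟩ := ih.1 hi
      by_cases hy : ω (n + 1) ∈ Btl d N j
      · rw [if_pos hy]
        exact ⟨fun _ => ⟨b, by omega, h1, h2⟩, fun h => absurd trivial h⟩
      · rw [if_neg hy]
        refine ⟨fun h => h.elim, fun _ => ⟨n + 1, le_rfl, ?_, fun _ => hy⟩⟩
        exact DD_succ_le ω _ b (n + 1) h1 (by omega) h2 hy
    · rw [if_neg hi]
      obtain ⟨b, hb, h1, h2⟩ := ih.2 hi
      by_cases hy : s.k < K ∧ ω (n + 1) ∈ Bblk d N j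
      · rw [if_pos hy]
        exact ⟨fun _ => ⟨n + 1, le_rfl, h1.trans (by exact_mod_cast (by omega)), hy.2⟩, fun h => absurd trivial h⟩
      · rw [if_neg hy]
        exact ⟨fun h => absurd h hi, fun _ => ⟨b, by omega, h1, h2⟩⟩

lemma visit_mem [NeZero N] (hK : 1 ≤ K) (ω : ℕ → Cyl d N) (i : ℕ) (hi : (i : ℕ∞) ≤ DD d N j K ω) (hA : ω i ∈ A0) (hB : ω i ∈ Bblk d N j) :
    ω i ∈ (stt j K A0 ω (i + 1)).H := by
  have hinv := inv_stt (j := j) hK A0 ω i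
  have hdd := stt_DD (j := j) (A0 := A0) hK ω i
  by_cases h : (stt j K A0 ω i).inn
  · simp only [stt, stp]
    rw [if_pos h]
    split_ifs <;> simp [hA]
  · exfalso
    obtain ⟨b, hb, h1, h2⟩ := hdd.2 h
    by_cases hk : (stt j K A0 ω i).k < K
    · exact hinv.outB h hk hB
    · have hkK : (stt j K A0 ω i).k = K := le_antisymm hinv.kle (not_lt.1 hk)
      rw [hkK] at h1 h2
      have : i ≤ b := by exact_mod_cast hi.trans h1
      have : b = i := by omega
      subst this
      exact h2 hK (B_sub_Bt j hB)

lemma visited_sub [NeZero N] (hK : 1 ≤ K) (hA0 : ∀ x ∈ A0, x ∈ Bblk d N j) (ω : ℕ → Cyl d N) :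
    ∃ n, ∀ x ∈ A0, x ∈ ranE ω (DD d N j K ω) → x ∈ (stt j K A0 ω n).H := by
  have h : ∀ x : A0, ∃ n, (x : Cyl d N) ∈ ranE ω (DD d N j K ω) → (x : Cyl d N) ∈ (stt j K A0 ω n).H := by
    rintro ⟨x, hx⟩
    by_cases h : x ∈ ranE ω (DD d N j K ω)
    · obtain ⟨i, hi, rfl⟩ := h
      exact ⟨i + 1, fun _ => visit_mem hK ω i hi hx (hA0 _ hx)⟩
    · exact ⟨0, fun h' => absurd h' h⟩
  choose f hf using h
  refine ⟨Finset.univ.sup f, fun x hx h => ?_⟩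
  exact H_mono j K A0 ω (Finset.le_sup (f := f) (Finset.mem_univ ⟨x, hx⟩)) (hf ⟨x, hx⟩ h)

end machine

section covering
variable {d N : ℕ} [NeZero N]

/-- the heights of `A` are close to `jN` -/
def Near (j : ℤ) (A : Finset (Cyl d N)) : Prop := ∀ x ∈ A, |(x.2 : ℝ) - j * N| ≤ 7 / 8 * N

lemma Near.inB {j : ℤ} {A : Finset (Cyl d N)} (h : Near j A) : ∀ x ∈ A, x ∈ Bblk d N j := by
  intro x hx
  have hN : (0 : ℝ) < N := by exact_mod_cast NeZero.pos N
  have h1 := abs_le.1 (h x hx)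
  unfold Bblk
  constructor
  · have : (((j - 1) * (N : ℤ) : ℤ) : ℝ) ≤ x.2 := by push_cast; linarith [h1.1]
    exact_mod_cast this
  · have : (x.2 : ℝ) ≤ (((j + 1) * (N : ℤ) : ℤ) : ℝ) := by push_cast; linarith [h1.2]
    exact_mod_cast this

/-- the constant -/
noncomputable def cst (d : ℕ) (m : ℝ) : ℝ := m * (1 + Cfar d + Ctl d)

lemma cst_nonneg (d : ℕ) {m : ℝ} (hm : 0 ≤ m) : 0 ≤ cst d m := by
  have := Cfar_pos d; have := Ctl_pos d; unfold cst; positivity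

lemma uA_bdry (hd : 1 ≤ d) {j : ℤ} {m : ℝ} (hm : 0 ≤ m) {A : Finset (Cyl d N)} (h : Near j A) {y : Cyl d N}
    (hy : y.2 = (j - 1) * N ∨ y.2 = (j + 1) * N) : uA j m (A : Set (Cyl d N)) y ≤ 1 + cst d m * A.card / N ^ (d - 1) := by
  have hN : (0 : ℝ) < N := by exact_mod_cast NeZero.pos N
  have h1 : hA j (A : Set (Cyl d N)) y ≤ A.card * (Cfar d / N ^ (d - 1)) := by
    refine (hA_subadd j A y).trans ((Finset.sum_le_card_nsmul _ _ _ ?_).trans (le_of_eq (nsmul_eq_mul _ _)))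
    intro x hx
    apply hA_far hd
    have h1 := abs_le.1 (h x hx)
    rcases hy with hy | hy
    · rw [hy]; push_cast
      rw [abs_of_nonneg] <;> linarith [h1.1]
    · rw [hy]; push_cast
      rw [abs_of_nonpos] <;> linarith [h1.2]
  have := Cfar_pos d
  have := Ctl_pos d
  unfold uA cst
  have h2 : m * hA j (A : Set (Cyl d N)) y ≤ m * (A.card * (Cfar d / N ^ (d - 1))) := by gcongr
  have h3 : m * (A.card * (Cfar d / N ^ (d - 1))) = m * Cfar d * A.card / N ^ (d - 1) := by ring
  have h4 : m * Cfar d * A.card / N ^ (d - 1) ≤ m * (1 + Cfar d + Ctl d) * A.card / N ^ (d - 1) := by gcongr; linarith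
  linarith

lemma uA_avg (hd : 1 ≤ d) (j : ℤ) {m : ℝ} (hm : 0 ≤ m) (A : Finset (Cyl d N)) :
    (∑ x ∈ B0f d N, uA j m (A : Set (Cyl d N)) x) / (N ^ d * (2 * N + 1)) ≤ 1 + cst d m * A.card / N ^ (d - 1) := by
  have hN : (0 : ℝ) < N := by exact_mod_cast NeZero.pos N
  have hC1 := Cfar_pos d
  have hC2 := Ctl_pos d
  have hcard : ((B0f d N).card : ℝ) = N ^ d * (2 * N + 1) := by rw [card_B0f]; push_cast; ring
  rw [div_le_iff₀ (by positivity)]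
  unfold uA
  rw [Finset.sum_add_distrib, ← Finset.mul_sum]
  have h1 : ∑ x ∈ B0f d N, hA j (A : Set (Cyl d N)) x ≤ A.card * (N ^ 2 + (B0f d N).card * (Ctl d / N ^ (d - 1))) := by
    refine (Finset.sum_le_sum fun x _ => hA_subadd j A x).trans ?_
    rw [Finset.sum_comm]
    refine (Finset.sum_le_card_nsmul _ _ _ fun x _ => hA_sum hd j x _).trans (le_of_eq (nsmul_eq_mul _ _))
  have h2 : (N : ℝ) ^ 2 ≤ (B0f d N).card * (1 / N ^ (d - 1)) := by
    rw [hcard]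
    obtain ⟨e, rfl⟩ : ∃ e, d = e + 1 := ⟨d - 1, by omega⟩
    rw [Nat.add_sub_cancel]
    have : (N : ℝ) ^ (e + 1) * (2 * N + 1) * (1 / N ^ e) = N * (2 * N + 1) := by rw [pow_succ]; field_simp
    rw [this]; nlinarith
  rw [Finset.sum_const, nsmul_eq_mul, mul_one, ← hcard]
  set B : ℝ := ((B0f d N).card : ℝ)
  have hB0 : 0 ≤ B := by positivity
  have h3 : m * ∑ x ∈ B0f d N, hA j (A : Set (Cyl d N)) x ≤ m * (A.card * (B * (1 / N ^ (d - 1)) + B * (Ctl d / N ^ (d - 1)))) := by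
    have : (∑ x ∈ B0f d N, hA j (A : Set (Cyl d N)) x) ≤ A.card * (B * (1 / N ^ (d - 1)) + B * (Ctl d / N ^ (d - 1))) := by
      refine h1.trans ?_
      gcongr
    gcongr
  have h4 : m * (A.card * (B * (1 / N ^ (d - 1)) + B * (Ctl d / N ^ (d - 1)))) = (m * (1 + Ctl d) * A.card / N ^ (d - 1)) * B := by ring
  have h5 : (m * (1 + Ctl d) * A.card / N ^ (d - 1)) * B ≤ (cst d m * A.card / N ^ (d - 1)) * B := by
    unfold cst; gcongr; linarith
  linarith

/-- potential data for the covering estimate -/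
noncomputable def covData (hd : 1 ≤ d) (j : ℤ) (K : ℕ) (A : Finset (Cyl d N)) (hA : Near j A) {lam r m : ℝ} (hlam : 0 ≤ lam)
    (hr1 : Real.exp lam * r < 1) (hm : m = (Real.exp lam - 1) / (1 - Real.exp lam * r)) (hm0 : 0 ≤ m)
    (hr : ∀ A' ⊆ A, ∀ x ∈ A', Pop (DiscCyl.hA j (A' : Set (Cyl d N))) x ≤ r) : PotData d N j K A lam where
  u := fun A' => uA j m (A' : Set (Cyl d N))
  a := fun _ _ => 0
  b := fun k H => Real.exp (-(lam * A.card)) * (Real.exp (lam * H.card) * (1 + cst d m * A.card / N ^ (d - 1)) ^ (K - k - 1))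
  Ψ := fun k H => Real.exp (-(lam * A.card)) * (Real.exp (lam * H.card) * (1 + cst d m * A.card / N ^ (d - 1)) ^ (K - k))
  α := fun H => A \ H
  lam0 := hlam
  a0 := fun _ _ => le_rfl
  b0 := fun k H => by have := cst_nonneg d hm0; positivity
  Ψ0 := fun k H => by have := cst_nonneg d hm0; positivity
  αs := fun H _ => Finset.sdiff_subset
  αd := fun H _ => Finset.disjoint_sdiff
  u1 := fun A' _ x => one_le_uA j hm0 _ x
  us := fun A' hA' x hx => by
    have := uA_super j (Real.one_le_exp hlam) hr1 hm (A := (A' : Set (Cyl d N))) (fun x hx => hr A' hA' x hx) hx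
    simpa using this
  hβ := fun k hk H hH y hy => by
    have hc := cst_nonneg d hm0
    have hN : (0 : ℝ) < N := by exact_mod_cast NeZero.pos N
    have h1 := uA_bdry hd hm0 (A := A \ H) (fun x hx => hA x (Finset.sdiff_subset hx)) hy
    have h2 : 1 + cst d m * (A \ H).card / N ^ (d - 1) ≤ 1 + cst d m * A.card / N ^ (d - 1) := by
      have : ((A \ H).card : ℝ) ≤ A.card := by exact_mod_cast Finset.card_le_card Finset.sdiff_subset
      gcongr
    have h3 := h1.trans h2
    have e : K - k = (K - k - 1) + 1 := by omega
    rw [zero_add]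
    conv_rhs => rw [e, pow_succ]
    rw [mul_assoc, mul_assoc]
    gcongr
  h2 := fun k hk H0 H h0 hH => by
    have e : H ∩ (A \ H0) = H \ H0 := by
      ext z; simp only [Finset.mem_inter, Finset.mem_sdiff]; constructor
      · tauto
      · rintro ⟨h1, h2⟩; exact ⟨h1, hH h1, h2⟩
    have e2 : ((H \ H0).card : ℝ) = H.card - H0.card := by
      have := Finset.card_sdiff_add_card_eq_card h0
      rw [← this]; push_cast; ring
    have e3 : Real.exp (lam * H.card) = Real.exp (lam * H0.card) * Real.exp (lam * (H \ H0).card) := by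
      rw [← Real.exp_add, e2]; ring_nf
    have e4 : K - (k + 1) = K - k - 1 := by omega
    rw [e, e3, e4, zero_add]
    apply le_of_eq; ring

theorem covering (hd : 1 ≤ d) {Pl : Cyl d N → Measure (ℕ → Cyl d N)} (hPl : IsCylRW d N Pl)
    (j : ℤ) (K : ℕ) (hK : 1 ≤ K) (A : Finset (Cyl d N)) (hA : Near j A) {lam r m : ℝ} (hlam : 0 ≤ lam)
    (hr1 : Real.exp lam * r < 1) (hm : m = (Real.exp lam - 1) / (1 - Real.exp lam * r)) (hm0 : 0 ≤ m)
    (hr : ∀ A' ⊆ A, ∀ x ∈ A', Pop (DiscCyl.hA j (A' : Set (Cyl d N))) x ≤ r) :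
    lawP d N Pl {ω | ∀ x ∈ A, x ∈ ranE ω (DD d N j K ω)} ≤
      ENNReal.ofReal (Real.exp (-(lam * A.card)) * (1 + cst d m * A.card / N ^ (d - 1)) ^ (K + 1)) := by
  have hc := cst_nonneg d hm0
  have hN : (0 : ℝ) < N := by exact_mod_cast NeZero.pos N
  set Q := covData hd j K A hA hlam hr1 hm hm0 hr with hQ
  set β : ℝ := 1 + cst d m * A.card / N ^ (d - 1) with hβ
  have hβ1 : 1 ≤ β := by have : 0 ≤ cst d m * A.card / N ^ (d - 1) := by positivity
                         linarith
  have hM := master hK Q (law_form hPl) {H | A ⊆ H} (fun H H' h h' => h'.trans h) (by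
    intro k _ H hH
    have h1 : A.card ≤ H.card := Finset.card_le_card hH
    have h1' : (A.card : ℝ) ≤ H.card := by exact_mod_cast h1
    change 1 ≤ Real.exp (-(lam * A.card)) * (Real.exp (lam * H.card) * β ^ (K - k))
    rw [← mul_assoc, ← Real.exp_add]
    have h2 : 1 ≤ Real.exp (-(lam * A.card) + lam * H.card) := Real.one_le_exp (by nlinarith)
    exact one_le_mul_of_one_le_of_one_le h2 (one_le_pow₀ hβ1))
  refine (measure_mono ?_).trans (hM.trans ?_)
  · intro ω hω
    obtain ⟨n, hn⟩ := visited_sub hK hA.inB ω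
    exact ⟨n, fun x hx => hn x hx (hω x hx)⟩
  · have h1 : ∀ x : Cyl d N, pot Q ⟨0, x ∈ Bblk d N j, ∅, ∅⟩ x ≤ Real.exp (-(lam * A.card)) * β ^ K * uA j m (A : Set (Cyl d N)) x := by
      intro x
      have hu := one_le_uA j hm0 (A : Set (Cyl d N)) x
      unfold pot
      simp only
      split_ifs
      · change 0 + Real.exp (-(lam * A.card)) * (Real.exp (lam * (∅ : Finset (Cyl d N)).card) * β ^ (K - 0 - 1)) *
          (Real.exp (lam * (∅ ∩ (A \ ∅)).card) * uA j m ((A \ ∅ : Finset (Cyl d N)) : Set (Cyl d N)) x) ≤ _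
        simp only [Finset.empty_inter, Finset.card_empty, Nat.cast_zero, mul_zero, Real.exp_zero, one_mul, zero_add, Finset.sdiff_empty]
        have : β ^ (K - 0 - 1) ≤ β ^ K := pow_le_pow_right₀ hβ1 (by omega)
        gcongr
      · change Real.exp (-(lam * A.card)) * (Real.exp (lam * (∅ : Finset (Cyl d N)).card) * β ^ (K - 0)) ≤ _
        simp only [Finset.card_empty, Nat.cast_zero, mul_zero, Real.exp_zero, one_mul, Nat.sub_zero]
        exact le_mul_of_one_le_right (by positivity) hu
    refine (lintegral_mono (fun (ω : ℕ → Cyl d N) => ENNReal.ofReal_le_ofReal (h1 (ω 0)))).trans ?_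
    rw [law_init hPl (fun x => Real.exp (-(lam * A.card)) * β ^ K * uA j m (A : Set (Cyl d N)) x)
      (fun x => by have := one_le_uA j hm0 (A : Set (Cyl d N)) x; positivity)]
    apply ENNReal.ofReal_le_ofReal
    rw [← Finset.mul_sum, mul_div_assoc, pow_succ, ← mul_assoc]
    have := uA_avg hd j hm0 A
    gcongr

end covering

section blocks
variable {d N : ℕ}

/-- blocks not met by `H` -/
noncomputable def unhit (S : ℕ → Finset (Cyl d N)) (M : ℕ) (H : Finset (Cyl d N)) : Finset ℕ :=
  (Finset.range M).filter fun i => Disjoint (S i) H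

/-- union of the blocks not met by `H` -/
noncomputable def unhitU (S : ℕ → Finset (Cyl d N)) (M : ℕ) (H : Finset (Cyl d N)) : Finset (Cyl d N) :=
  (unhit S M H).biUnion S

lemma unhit_step (S : ℕ → Finset (Cyl d N)) (M : ℕ) (hS : ∀ i i', i ≠ i' → i < M → i' < M → Disjoint (S i) (S i'))
    (H0 H : Finset (Cyl d N)) :
    (unhit S M H0).card ≤ (unhit S M H).card + (H ∩ unhitU S M H0).card := by
  have h1 : (unhit S M H0 \ unhit S M H).card ≤ (H ∩ unhitU S M H0).card := by
    have h : ∀ i : ℕ, ∃ x, i ∈ unhit S M H0 \ unhit S M H → x ∈ S i ∧ x ∈ H := by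
      intro i
      by_cases hi : i ∈ unhit S M H0 \ unhit S M H
      · simp only [unhit, Finset.mem_sdiff, Finset.mem_filter, not_and] at hi
        have := hi.2 hi.1.1
        rw [Finset.not_disjoint_iff] at this
        obtain ⟨x, h1, h2⟩ := this
        exact ⟨x, fun _ => ⟨h1, h2⟩⟩
      · by_cases hn : Nonempty (Cyl d N)
        · exact ⟨hn.some, fun h => absurd h hi⟩
        · exact (hn ⟨(0 : Cyl d N)⟩).elim
    choose f hf using h
    apply Finset.card_le_card_of_injOn f
    · intro i hi
      have := hf i hi
      simp only [Finset.coe_inter, Set.mem_inter_iff, Finset.mem_coe]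
      refine ⟨this.2, ?_⟩
      unfold unhitU
      rw [Finset.mem_biUnion]
      exact ⟨i, (Finset.mem_sdiff.1 hi).1, this.1⟩
    · intro i hi i' hi' he
      by_contra hne
      have m1 : i < M := by
        have := (Finset.mem_sdiff.1 hi).1; simp only [unhit, Finset.mem_filter, Finset.mem_range] at this; exact this.1
      have m2 : i' < M := by
        have := (Finset.mem_sdiff.1 hi').1; simp only [unhit, Finset.mem_filter, Finset.mem_range] at this; exact this.1
      have h3 := (hf i' hi').1
      rw [← he] at h3
      exact Finset.disjoint_left.1 (hS i i' hne m1 m2) (hf i hi).1 h3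
  have h2 : (unhit S M H0).card ≤ (unhit S M H).card + (unhit S M H0 \ unhit S M H).card := by
    rw [← Finset.card_union_of_disjoint Finset.disjoint_sdiff]
    apply Finset.card_le_card
    intro i hi
    by_cases h : i ∈ unhit S M H <;> simp [h, hi]
  omega

lemma exp_conv {s lam : ℝ} (hlam : 0 < lam) (hs : 0 ≤ s) (hsl : s ≤ lam) (J : ℝ) :
    Real.exp (s * J) ≤ (1 - s / lam) + s / lam * Real.exp (lam * J) := by
  have ha : 0 ≤ 1 - s / lam := by rw [sub_nonneg, div_le_one hlam]; exact hsl
  have hb : 0 ≤ s / lam := by positivity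
  have h := convexOn_exp.2 (Set.mem_univ (0 : ℝ)) (Set.mem_univ (lam * J)) ha hb (by ring)
  simp only [smul_eq_mul, mul_zero, zero_add, Real.exp_zero, mul_one] at h
  have e : s / lam * (lam * J) = s * J := by field_simp
  rwa [e] at h

variable [NeZero N]

/-- rates -/
noncomputable def rate (lam κ : ℝ) (K k : ℕ) : ℝ := lam * (1 - κ) ^ (K - k)

lemma rate_nonneg {lam κ : ℝ} (hlam : 0 < lam) (hκ1 : κ ≤ 1) (K k : ℕ) : 0 ≤ rate lam κ K k := by
  have : 0 ≤ 1 - κ := by linarith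
  unfold rate; positivity

lemma rate_le {lam κ : ℝ} (hlam : 0 < lam) (hκ : 0 ≤ κ) (hκ1 : κ ≤ 1) (K k : ℕ) : rate lam κ K k ≤ lam := by
  unfold rate
  exact mul_le_of_le_one_right hlam.le (pow_le_one₀ (by linarith) (by linarith))

/-- potential data for blocks -/
noncomputable def blkData (hd : 1 ≤ d) (j : ℤ) (K : ℕ) (S : ℕ → Finset (Cyl d N)) (M ℓ : ℕ)
    (hS : ∀ i i', i ≠ i' → i < M → i' < M → Disjoint (S i) (S i')) (hSc : ∀ i < M, (S i).card ≤ ℓ)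
    (hA : Near j ((Finset.range M).biUnion S)) {lam r m κ : ℝ} (hlam : 0 < lam)
    (hr1 : Real.exp lam * r < 1) (hm : m = (Real.exp lam - 1) / (1 - Real.exp lam * r)) (hm0 : 0 ≤ m)
    (hκ : κ = cst d m * ℓ / N ^ (d - 1) / lam) (hκ1 : κ ≤ 1)
    (hr : ∀ A' ⊆ (Finset.range M).biUnion S, ∀ x ∈ A', Pop (DiscCyl.hA j (A' : Set (Cyl d N))) x ≤ r) :
    PotData d N j K ((Finset.range M).biUnion S) lam where
  u := fun A' => uA j m (A' : Set (Cyl d N))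
  a := fun k H => Real.exp (-(rate lam κ K (k + 1) * (unhit S M H).card)) * (1 - rate lam κ K (k + 1) / lam)
  b := fun k H => Real.exp (-(rate lam κ K (k + 1) * (unhit S M H).card)) * (rate lam κ K (k + 1) / lam)
  Ψ := fun k H => Real.exp (-(rate lam κ K k * (unhit S M H).card))
  α := fun H => unhitU S M H
  lam0 := hlam.le
  a0 := fun k H => by
    have hκ0 : 0 ≤ κ := by have := cst_nonneg d hm0; rw [hκ]; positivity
    have : 0 ≤ 1 - rate lam κ K (k + 1) / lam := by
      rw [sub_nonneg, div_le_one hlam]; exact rate_le hlam hκ0 hκ1 _ _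
    positivity
  b0 := fun k H => by
    have := rate_nonneg hlam hκ1 K (k + 1)
    positivity
  Ψ0 := fun k H => by positivity
  αs := fun H _ => Finset.biUnion_subset_biUnion_of_subset_left _ (Finset.filter_subset _ _)
  αd := fun H _ => by
    unfold unhitU
    rw [Finset.disjoint_biUnion_right]
    intro i hi
    simp only [unhit, Finset.mem_filter] at hi
    exact hi.2.symm
  u1 := fun A' _ x => one_le_uA j hm0 _ x
  us := fun A' hA' x hx => by
    have := uA_super j (Real.one_le_exp hlam.le) hr1 hm (A := (A' : Set (Cyl d N))) (fun x hx => hr A' hA' x hx) hx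
    simpa using this
  hβ := fun k hk H hH y hy => by
    have hc := cst_nonneg d hm0
    have hN : (0 : ℝ) < N := by exact_mod_cast NeZero.pos N
    set s := rate lam κ K (k + 1) with hs
    have hs0 : 0 ≤ s := rate_nonneg hlam hκ1 _ _
    set Z : ℝ := ((unhit S M H).card : ℝ) with hZ
    have h1 := uA_bdry hd hm0 (A := unhitU S M H) (fun x hx => hA x
      (Finset.biUnion_subset_biUnion_of_subset_left _ (Finset.filter_subset _ _) hx)) hy
    have hcard : ((unhitU S M H).card : ℝ) ≤ Z * ℓ := by
      have : (unhitU S M H).card ≤ (unhit S M H).card * ℓ := by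
        apply Finset.card_biUnion_le_card_mul
        intro i hi
        simp only [unhit, Finset.mem_filter, Finset.mem_range] at hi
        exact hSc i hi.1
      rw [hZ]; exact_mod_cast this
    have h2 : cst d m * (unhitU S M H).card / N ^ (d - 1) ≤ lam * κ * Z := by
      have : lam * κ * Z = cst d m * (Z * ℓ) / N ^ (d - 1) := by rw [hκ]; field_simp
      rw [this]; gcongr
    have h3 : uA j m ((unhitU S M H : Finset (Cyl d N)) : Set (Cyl d N)) y ≤ 1 + lam * κ * Z := by linarith
    have e : rate lam κ K k = s * (1 - κ) := by
      rw [hs]; unfold rate; rw [show K - k = (K - (k + 1)) + 1 by omega, pow_succ]; ring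
    calc Real.exp (-(s * Z)) * (1 - s / lam) + Real.exp (-(s * Z)) * (s / lam) * uA j m ((unhitU S M H : Finset (Cyl d N)) : Set (Cyl d N)) y
        ≤ Real.exp (-(s * Z)) * (1 - s / lam) + Real.exp (-(s * Z)) * (s / lam) * (1 + lam * κ * Z) := by gcongr
      _ = Real.exp (-(s * Z)) * (s * κ * Z + 1) := by field_simp; ring
      _ ≤ Real.exp (-(s * Z)) * Real.exp (s * κ * Z) := by gcongr; exact Real.add_one_le_exp _
      _ = Real.exp (-(rate lam κ K k * Z)) := by rw [← Real.exp_add, e]; congr 1; ring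
  h2 := fun k hk H0 H h0 hH => by
    have hκ0 : 0 ≤ κ := by have := cst_nonneg d hm0; rw [hκ]; positivity
    set s := rate lam κ K (k + 1) with hs
    have hs0 : 0 ≤ s := rate_nonneg hlam hκ1 _ _
    have hsl : s ≤ lam := rate_le hlam hκ0 hκ1 _ _
    have h1 := unhit_step S M hS H0 H
    have h1' : ((unhit S M H0).card : ℝ) ≤ (unhit S M H).card + (H ∩ unhitU S M H0).card := by exact_mod_cast h1
    have h2 := exp_conv hlam hs0 hsl ((H ∩ unhitU S M H0).card : ℝ)
    calc Real.exp (-(s * (unhit S M H).card)) ≤ Real.exp (-(s * (unhit S M H0).card)) * Real.exp (s * (H ∩ unhitU S M H0).card) := by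
          rw [← Real.exp_add]; apply Real.exp_le_exp.2; nlinarith
      _ ≤ Real.exp (-(s * (unhit S M H0).card)) * ((1 - s / lam) + s / lam * Real.exp (lam * (H ∩ unhitU S M H0).card)) := by gcongr
      _ = _ := by ring

theorem blocks_bound (hd : 1 ≤ d) {Pl : Cyl d N → Measure (ℕ → Cyl d N)} (hPl : IsCylRW d N Pl)
    (j : ℤ) (K : ℕ) (hK : 1 ≤ K) (S : ℕ → Finset (Cyl d N)) (M ℓ : ℕ)
    (hS : ∀ i i', i ≠ i' → i < M → i' < M → Disjoint (S i) (S i')) (hSc : ∀ i < M, (S i).card ≤ ℓ)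
    (hA : Near j ((Finset.range M).biUnion S)) {lam r m κ : ℝ} (hlam : 0 < lam)
    (hr1 : Real.exp lam * r < 1) (hm : m = (Real.exp lam - 1) / (1 - Real.exp lam * r)) (hm0 : 0 ≤ m)
    (hκ : κ = cst d m * ℓ / N ^ (d - 1) / lam) (hκ1 : κ ≤ 1)
    (hr : ∀ A' ⊆ (Finset.range M).biUnion S, ∀ x ∈ A', Pop (DiscCyl.hA j (A' : Set (Cyl d N))) x ≤ r) :
    lawP d N Pl {ω | ∀ i < M, ∃ x ∈ S i, x ∈ ranE ω (DD d N j K ω)} ≤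
      ENNReal.ofReal ((1 + m) * Real.exp (-(lam * (1 - κ) ^ K * M))) := by
  have hc := cst_nonneg d hm0
  have hN : (0 : ℝ) < N := by exact_mod_cast NeZero.pos N
  have hκ0 : 0 ≤ κ := by rw [hκ]; positivity
  set Q := blkData hd j K S M ℓ hS hSc hA hlam hr1 hm hm0 hκ hκ1 hr with hQ
  have hM := master hK Q (law_form hPl) {H | unhit S M H = ∅} (by
      intro H H' h h'
      simp only [Set.mem_setOf_eq, unhit, Finset.filter_eq_empty_iff] at h' ⊢
      intro i hi hdis
      exact h' hi (Finset.disjoint_of_subset_right h hdis)) (by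
    intro k _ H hH
    simp only [Set.mem_setOf_eq] at hH
    change 1 ≤ Real.exp (-(rate lam κ K k * (unhit S M H).card))
    rw [hH]; simp)
  refine (measure_mono ?_).trans (hM.trans ?_)
  · intro ω hω
    obtain ⟨n, hn⟩ := visited_sub hK hA.inB ω
    refine ⟨n, ?_⟩
    simp only [Set.mem_setOf_eq, unhit, Finset.filter_eq_empty_iff]
    intro i hi hdis
    obtain ⟨x, hx, hxr⟩ := hω i (Finset.mem_range.1 hi)
    exact Finset.disjoint_left.1 hdis hx (hn x (Finset.mem_biUnion.2 ⟨i, hi, hx⟩) hxr)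
  · have hun : unhit S M ∅ = Finset.range M := by simp [unhit]
    have hs1 : rate lam κ K 0 ≤ rate lam κ K 1 := by
      unfold rate
      exact mul_le_mul_of_nonneg_left (pow_le_pow_of_le_one (by linarith) (by linarith) (by omega)) hlam.le
    have h1 : ∀ x : Cyl d N, pot Q ⟨0, x ∈ Bblk d N j, ∅, ∅⟩ x ≤ (1 + m) * Real.exp (-(rate lam κ K 0 * M)) := by
      intro x
      unfold pot
      simp only
      split_ifs
      · change Real.exp (-(rate lam κ K 1 * (unhit S M ∅).card)) * (1 - rate lam κ K 1 / lam) +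
          Real.exp (-(rate lam κ K 1 * (unhit S M ∅).card)) * (rate lam κ K 1 / lam) *
          (Real.exp (lam * (∅ ∩ (unhitU S M ∅)).card) * uA j m ((unhitU S M ∅ : Finset (Cyl d N)) : Set (Cyl d N)) x) ≤ _
        rw [hun]
        simp only [Finset.empty_inter, Finset.card_empty, Nat.cast_zero, mul_zero, Real.exp_zero, one_mul, Finset.card_range]
        have hu := uA_le j hm0 ((unhitU S M ∅ : Finset (Cyl d N)) : Set (Cyl d N)) x
        have hs0 := rate_nonneg hlam hκ1 K 1
        have hsl : rate lam κ K 1 / lam ≤ 1 := by rw [div_le_one hlam]; exact rate_le hlam hκ0 hκ1 _ _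
        set s := rate lam κ K 1
        calc _ ≤ Real.exp (-(s * M)) * (1 - s / lam) + Real.exp (-(s * M)) * (s / lam) * (1 + m) := by gcongr
          _ = Real.exp (-(s * M)) * (1 + (s / lam) * m) := by ring
          _ ≤ Real.exp (-(s * M)) * (1 + 1 * m) := by gcongr
          _ ≤ Real.exp (-(rate lam κ K 0 * M)) * (1 + 1 * m) := by gcongr
          _ = _ := by ring
      · change Real.exp (-(rate lam κ K 0 * (unhit S M ∅).card)) ≤ _
        rw [hun, Finset.card_range]
        exact le_mul_of_one_le_left (by positivity) (by linarith)
    refine (lintegral_mono (fun (ω : ℕ → Cyl d N) => ENNReal.ofReal_le_ofReal (h1 (ω 0)))).trans ?_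
    rw [law_init hPl (fun x => (1 + m) * Real.exp (-(rate lam κ K 0 * M))) (fun x => by positivity)]
    apply ENNReal.ofReal_le_ofReal
    rw [Finset.sum_const, card_B0f, nsmul_eq_mul]
    push_cast
    rw [mul_div_assoc, mul_comm, div_mul_cancel₀ _ (by positivity)]
    unfold rate; simp

end blocks

section vbound
variable {d N : ℕ}

lemma projE_surj [NeZero N] (x : Cyl d N) : ∃ v : Lat d, projE d N v = x := by
  refine ⟨Fin.lastCases x.2 (fun k => ((x.1 k).val : ℤ)), ?_⟩
  unfold projE
  ext <;> simp

lemma mem_unitVecs {e : Lat d} (he : e ∈ unitVecs d) : ∃ i, ∃ s : ℤ, (s = 1 ∨ s = -1) ∧ e = Pi.single i s := by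
  unfold unitVecs at he
  simp only [Finset.mem_image, Finset.mem_univ, true_and] at he
  obtain ⟨⟨i, b⟩, rfl⟩ := he
  cases b
  · exact ⟨i, -1, Or.inr rfl, by simp⟩
  · exact ⟨i, 1, Or.inl rfl, by simp⟩

lemma line_inj [NeZero N] (x : Cyl d N) {e : Lat d} (he : e ∈ unitVecs d) {l l' : ℕ} (hl : l < N) (hl' : l' < N)
    (h : x + projE d N ((l : ℤ) • e) = x + projE d N ((l' : ℤ) • e)) : l = l' := by
  obtain ⟨i, s, hs, rfl⟩ := mem_unitVecs he
  have h1 := congrArg (cc i) h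
  rw [cc_add, cc_add] at h1
  simp only [Pi.smul_apply, Pi.single_eq_same, smul_eq_mul] at h1
  have h2 : (l : ZMod N) = l' := by
    rcases hs with rfl | rfl
    · simpa using h1
    · simpa using h1
  rw [ZMod.natCast_eq_natCast_iff'] at h2
  rwa [Nat.mod_eq_of_lt hl, Nat.mod_eq_of_lt hl'] at h2

lemma line_plane [NeZero N] (hd : 1 ≤ d) (x : Cyl d N) {e : Lat d} (he : e ∈ unitVecs d) :
    ∃ F ∈ Lcoll d N 2, ∀ l : ℕ, x + projE d N ((l : ℤ) • e) ∈ F := by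
  obtain ⟨i, s, hs, rfl⟩ := mem_unitVecs he
  obtain ⟨y, rfl⟩ := projE_surj x
  haveI : Nontrivial (Fin (d + 1)) := Fin.nontrivial_iff_two_le.2 (by omega)
  obtain ⟨i', hi'⟩ := exists_ne i
  refine ⟨_, ⟨{i, i'}, Finset.card_pair hi'.symm, y, rfl⟩, fun l => ?_⟩
  refine ⟨(l : ℤ) • Pi.single i s, ?_, by simp only; rw [projE_add]⟩
  intro k hk
  simp only [Finset.mem_insert, Finset.mem_singleton, not_or] at hk
  simp [Pi.single_eq_of_ne hk.1]

lemma line_height (x : Cyl d N) {e : Lat d} (he : e ∈ unitVecs d) (l : ℕ) :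
    |(((x + projE d N ((l : ℤ) • e)).2 : ℤ) : ℝ) - x.2| ≤ l := by
  obtain ⟨i, s, hs, rfl⟩ := mem_unitVecs he
  simp only [Prod.snd_add, projE_snd, Pi.smul_apply, smul_eq_mul]
  by_cases h : i = Fin.last d
  · subst h
    rw [Pi.single_eq_same]
    rcases hs with rfl | rfl <;> simp
  · rw [Pi.single_eq_of_ne (Ne.symm h)]
    simp

/-- finite superset of `C_j` -/
noncomputable def Cjf (d N : ℕ) [NeZero N] (j : ℤ) : Finset (Cyl d N) :=
  (Finset.univ ×ˢ Finset.Icc ((j - 1) * (N : ℤ)) ((j + 1) * N)).filter fun x => x ∈ Cblk d N j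

lemma mem_Cjf [NeZero N] (j : ℤ) (x : Cyl d N) : x ∈ Cjf d N j ↔ x ∈ Cblk d N j := by
  unfold Cjf
  rw [Finset.mem_filter]
  refine ⟨fun h => h.2, fun h => ⟨?_, h⟩⟩
  have hN : (0 : ℝ) < N := by exact_mod_cast NeZero.pos N
  rw [Finset.mem_product]
  refine ⟨Finset.mem_univ _, ?_⟩
  rw [Finset.mem_Icc]
  unfold Cblk at h
  constructor
  · have : (((j - 1) * (N : ℤ) : ℤ) : ℝ) ≤ x.2 := by push_cast; nlinarith [h.1]
    exact_mod_cast this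
  · have : (x.2 : ℝ) ≤ (((j + 1) * (N : ℤ) : ℤ) : ℝ) := by push_cast; nlinarith [h.2]
    exact_mod_cast this

lemma card_Cjf [NeZero N] (j : ℤ) : (Cjf d N j).card ≤ 3 * N ^ (d + 1) := by
  have hN := NeZero.pos N
  refine (Finset.card_filter_le _ _).trans ?_
  rw [Finset.card_product]
  simp only [Finset.card_univ, Fintype.card_pi, ZMod.card, Finset.prod_const, Fintype.card_fin, Int.card_Icc]
  have : ((j + 1) * (N : ℤ) + 1 - (j - 1) * N).toNat = 2 * N + 1 := by
    have : (j + 1) * (N : ℤ) + 1 - (j - 1) * N = 2 * N + 1 := by ring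
    rw [this]; omega
  rw [this, pow_succ]
  nlinarith [Nat.pow_pos hN (n := d)]

lemma Cblk_abs {j : ℤ} {x : Cyl d N} (h : x ∈ Cblk d N j) : |(x.2 : ℝ) - j * N| ≤ 3 / 4 * N := by
  unfold Cblk at h
  rw [abs_le]; constructor <;> nlinarith [h.1, h.2]

theorem V_bound [NeZero N] (hd : 1 ≤ d) (hN64 : 64 ≤ N) {Pl : Cyl d N → Measure (ℕ → Cyl d N)} (hPl : IsCylRW d N Pl)
    (j : ℤ) (K : ℕ) (hK : 1 ≤ K) (c0 : ℝ) (M L : ℕ) (hL : L = ⌊c0 * Real.log N⌋₊) (hML : ((M * (L + 1) : ℕ) : ℝ) ≤ Real.sqrt N)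
    {lam r m κ : ℝ} (hlam : 0 < lam)
    (hr1 : Real.exp lam * r < 1) (hm : m = (Real.exp lam - 1) / (1 - Real.exp lam * r)) (hm0 : 0 ≤ m)
    (hκ : κ = cst d m * (L + 1 : ℕ) / N ^ (d - 1) / lam) (hκ1 : κ ≤ 1)
    (hr : ∀ F ∈ Lcoll d N 2, ∀ x ∈ F, Pop (hA j F) x ≤ r) :
    lawP d N Pl (Vev d N c0 j K)ᶜ ≤
      ENNReal.ofReal (3 * N ^ (d + 1) * (2 * (d + 1)) * ((1 + m) * Real.exp (-(lam * (1 - κ) ^ K * M)))) := by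
  have hNr : (64 : ℝ) ≤ N := by exact_mod_cast hN64
  have hsq : Real.sqrt N ≤ N / 8 := by
    rw [Real.sqrt_le_left (by linarith)]; nlinarith
  have hMLN : M * (L + 1) ≤ N := by
    have : ((M * (L + 1) : ℕ) : ℝ) ≤ N := by linarith
    exact_mod_cast this
  set S : Cyl d N → Lat d → ℕ → Finset (Cyl d N) := fun x e i =>
    (Finset.range (L + 1)).image fun t => x + projE d N (((i * (L + 1) + t : ℕ) : ℤ) • e) with hS
  have hlt : ∀ i t, i < M → t < L + 1 → i * (L + 1) + t < M * (L + 1) := by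
    intro i t hi ht
    nlinarith
  have hsub : (Vev d N c0 j K)ᶜ ⊆ ⋃ x ∈ Cjf d N j, ⋃ e ∈ unitVecs d,
      {ω | ∀ i < M, ∃ y ∈ S x e i, y ∈ ranE ω (DD d N j K ω)} := by
    intro ω hω
    simp only [Vev, Set.mem_compl_iff, Set.mem_setOf_eq, not_forall] at hω
    obtain ⟨x, hx, e, he, h⟩ := hω
    simp only [Set.mem_iUnion]
    refine ⟨x, (mem_Cjf j x).2 hx, e, he, ?_⟩
    intro i hi
    push Not at h
    have hi' : ((i * (L + 1) : ℕ) : ℝ) < Real.sqrt N := by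
      refine lt_of_lt_of_le ?_ hML
      exact_mod_cast (by simpa using hlt i 0 hi (by omega))
    obtain ⟨l, h1, h2, h3⟩ := h _ hi'
    refine ⟨_, ?_, h3⟩
    rw [hS]
    simp only [Finset.mem_image, Finset.mem_range]
    rw [← hL] at h2
    exact ⟨l - i * (L + 1), by omega, by rw [Nat.add_sub_cancel' h1]⟩
  refine (measure_mono hsub).trans ?_
  refine (measure_biUnion_finset_le _ _).trans ?_
  have hpt : ∀ x ∈ Cjf d N j, ∀ e ∈ unitVecs d, lawP d N Pl {ω | ∀ i < M, ∃ y ∈ S x e i, y ∈ ranE ω (DD d N j K ω)} ≤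
      ENNReal.ofReal ((1 + m) * Real.exp (-(lam * (1 - κ) ^ K * M))) := by
    intro x hx e he
    have hxC := (mem_Cjf j x).1 hx
    have hmem : ∀ z ∈ (Finset.range M).biUnion (S x e), ∃ l < M * (L + 1), z = x + projE d N ((l : ℤ) • e) := by
      intro z hz
      simp only [hS, Finset.mem_biUnion, Finset.mem_image, Finset.mem_range] at hz
      obtain ⟨i, hi, t, ht, rfl⟩ := hz
      exact ⟨_, hlt i t hi ht, rfl⟩
    refine blocks_bound hd hPl j K hK (S x e) M (L + 1) ?_ ?_ ?_ hlam hr1 hm hm0 hκ hκ1 ?_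
    · intro i i' hne hi hi'
      rw [Finset.disjoint_left]
      intro z hz hz'
      simp only [hS, Finset.mem_image, Finset.mem_range] at hz hz'
      obtain ⟨t, ht, rfl⟩ := hz
      obtain ⟨t', ht', h⟩ := hz'
      have h1 := line_inj x he ((hlt i' t' hi' ht').trans_le hMLN) ((hlt i t hi ht).trans_le hMLN) h
      rcases lt_or_gt_of_ne hne with hh | hh <;> nlinarith
    · intro i _
      exact Finset.card_image_le.trans (by simp)
    · intro z hz
      obtain ⟨l, hl, rfl⟩ := hmem z hz
      have h1 := line_height x he l
      have h2 := Cblk_abs hxC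
      have h3 : (l : ℝ) ≤ N / 8 := by
        have : (l : ℝ) ≤ ((M * (L + 1) : ℕ) : ℝ) := by exact_mod_cast hl.le
        linarith
      calc _ ≤ |(((x + projE d N ((l : ℤ) • e)).2 : ℤ) : ℝ) - x.2| + |(x.2 : ℝ) - j * N| := abs_sub_le _ _ _
        _ ≤ _ := by linarith
    · intro A' hA' z hz
      obtain ⟨F, hF, hFl⟩ := line_plane hd x he
      have hAF : (A' : Set (Cyl d N)) ⊆ F := by
        intro w hw
        obtain ⟨l, _, rfl⟩ := hmem w (hA' hw)
        exact hFl l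
      exact (Pop_mono fun e _ => hA_mono j hAF _).trans (hr F hF z (hAF hz))
  have hT0 : 0 ≤ (1 + m) * Real.exp (-(lam * (1 - κ) ^ K * M)) := by positivity
  generalize (1 + m) * Real.exp (-(lam * (1 - κ) ^ K * M)) = T at hpt hT0 ⊢
  refine (Finset.sum_le_card_nsmul _ _ (2 * (d + 1) * ENNReal.ofReal T) ?_).trans ?_
  · intro x hx
    refine (measure_biUnion_finset_le _ _).trans ((Finset.sum_le_card_nsmul _ _ _ (hpt x hx)).trans ?_)
    rw [card_unitVecs, nsmul_eq_mul]; push_cast; exact le_rfl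
  · have h1 : (2 * ((d : ℝ≥0∞) + 1)) = ENNReal.ofReal (2 * ((d : ℝ) + 1)) := by
      rw [ENNReal.ofReal_mul (by norm_num), ENNReal.ofReal_add (by positivity) (by norm_num)]; simp
    have h2 : (((Cjf d N j).card : ℕ) : ℝ) ≤ 3 * (N : ℝ) ^ (d + 1) := by exact_mod_cast card_Cjf j
    rw [nsmul_eq_mul, h1, ← ENNReal.ofReal_natCast, ← ENNReal.ofReal_mul (by positivity),
      ← ENNReal.ofReal_mul (by positivity)]
    apply ENNReal.ofReal_le_ofReal
    calc _ ≤ 3 * (N : ℝ) ^ (d + 1) * (2 * (d + 1) * T) := by gcongr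
      _ = _ := by ring

end vbound

section topo

/-- nearest neighbours in the plane -/
def nn2 (a b : ℤ × ℤ) : Prop :=
  b = (a.1 + 1, a.2) ∨ b = (a.1 - 1, a.2) ∨ b = (a.1, a.2 + 1) ∨ b = (a.1, a.2 - 1)

lemma nn2_symm {a b : ℤ × ℤ} (h : nn2 a b) : nn2 b a := by
  obtain ⟨a1, a2⟩ := a
  obtain ⟨b1, b2⟩ := b
  simp only [nn2, Prod.mk.injEq] at h ⊢
  omega

/-- star-step inside `V` -/
def sstep (V : Set (ℤ × ℤ)) (a b : ℤ × ℤ) : Prop := a ∈ V ∧ b ∈ V ∧ starAdj a b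

lemma sstep_symm {V : Set (ℤ × ℤ)} {a b : ℤ × ℤ} (h : sstep V a b) : sstep V b a := by
  obtain ⟨h1, h2, h3, h4, h5⟩ := h
  refine ⟨h2, h1, h3.symm, ?_, ?_⟩ <;> omega

def scomp (V : Set (ℤ × ℤ)) (v : ℤ × ℤ) : Set (ℤ × ℤ) := {w | Relation.ReflTransGen (sstep V) v w}

lemma sconn_symm {V : Set (ℤ × ℤ)} {a b : ℤ × ℤ} (h : Relation.ReflTransGen (sstep V) a b) :
    Relation.ReflTransGen (sstep V) b a := by
  induction h with
  | refl => exact .refl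
  | tail _ h ih => exact Relation.ReflTransGen.head (sstep_symm h) ih

lemma scomp_sub {V : Set (ℤ × ℤ)} {v w : ℤ × ℤ} (hv : v ∈ V) (h : w ∈ scomp V v) : w ∈ V := by
  induction h with
  | refl => exact hv
  | tail _ h _ => exact h.2.1

lemma scomp_eq {V : Set (ℤ × ℤ)} {v w : ℤ × ℤ} (h : w ∈ scomp V v) : scomp V w = scomp V v := by
  ext z
  exact ⟨fun hz => Relation.ReflTransGen.trans h hz, fun hz => Relation.ReflTransGen.trans (sconn_symm h) hz⟩

/-- indicator in `ZMod 2` -/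
noncomputable def ind2 (A : Set (ℤ × ℤ)) (z : ℤ × ℤ) : ZMod 2 := if z ∈ A then 1 else 0

noncomputable def cut (S κ : Set (ℤ × ℤ)) (a b : ℤ × ℤ) : ZMod 2 :=
  ind2 S a * ind2 κ b + ind2 S b * ind2 κ a

lemma cut_symm (S κ : Set (ℤ × ℤ)) (a b : ℤ × ℤ) : cut S κ a b = cut S κ b a := by
  unfold cut; ring

lemma cut_zero {S κ : Set (ℤ × ℤ)} {a b : ℤ × ℤ} (ha : a ∉ κ) (hb : b ∉ κ) : cut S κ a b = 0 := by
  simp [cut, ind2, ha, hb]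

lemma square_alg : ∀ sa sb sc sd ka kb kc kd : ZMod 2,
    (ka = 1 → sa = 0) → (kb = 1 → sb = 0) → (kc = 1 → sc = 0) → (kd = 1 → sd = 0) →
    (ka = 0 → kb = 0 → sa = sb) → (kb = 0 → kc = 0 → sb = sc) → (kc = 0 → kd = 0 → sc = sd) →
    (kd = 0 → ka = 0 → sd = sa) →
    sa * kb + sb * ka + (sb * kc + sc * kb) + (sc * kd + sd * kc) + (sd * ka + sa * kd) = 0 := by
  have h01 : ∀ a : ZMod 2, a = 0 ∨ a = 1 := by decide
  have h2 : ∀ a : ZMod 2, a + a = 0 := by decide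
  intro sa sb sc sd ka kb kc kd
  rcases h01 ka with rfl | rfl <;> rcases h01 kb with rfl | rfl <;> rcases h01 kc with rfl | rfl <;>
    rcases h01 kd with rfl | rfl <;> simp only [true_implies, one_ne_zero, zero_ne_one, false_implies] <;> intros <;>
    subst_vars <;> simp [h2]
  linear_combination h2 sa + h2 sc

/-- structure collecting the hypotheses -/
structure TopoData (T : Set ℤ) (L : ℕ) (V S : Set (ℤ × ℤ)) : Prop where
  ord : T.OrdConnected
  rows : ∀ y0 : ℤ, ∃ t ∈ T, t < y0 ∨ y0 + L ≤ t
  disj : ∀ z ∈ S, z ∉ V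
  clos : ∀ a ∈ S, ∀ b, nn2 a b → b.2 ∈ T → b ∉ V → b ∈ S
  inT : ∀ z ∈ S, z.2 ∈ T
  diam : ∀ a ∈ V, ∀ b ∈ scomp V a, |a.1 - b.1| < L ∧ |a.2 - b.2| < L

variable {T : Set ℤ} {L : ℕ} {V S : Set (ℤ × ℤ)}

lemma TopoData.S_iff (D : TopoData T L V S) {a b : ℤ × ℤ} (h : nn2 a b) (ha : a.2 ∈ T) (hb : b.2 ∈ T)
    (ha' : a ∉ V) (hb' : b ∉ V) : a ∈ S ↔ b ∈ S :=
  ⟨fun hs => D.clos a hs b h hb hb', fun hs => D.clos b hs a (nn2_symm h) ha ha'⟩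

lemma TopoData.square (D : TopoData T L V S) {v : ℤ × ℤ} (hv : v ∈ V) (x y : ℤ) (hy : y ∈ T) (hy' : y + 1 ∈ T) :
    cut S (scomp V v) (x, y) (x + 1, y) + cut S (scomp V v) (x + 1, y) (x + 1, y + 1)
      + cut S (scomp V v) (x + 1, y + 1) (x, y + 1) + cut S (scomp V v) (x, y + 1) (x, y) = 0 := by
  by_cases hn : (x, y) ∉ scomp V v ∧ (x + 1, y) ∉ scomp V v ∧ (x + 1, y + 1) ∉ scomp V v ∧ (x, y + 1) ∉ scomp V v
  · obtain ⟨h1, h2, h3, h4⟩ := hn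
    simp [cut_zero, h1, h2, h3, h4]
  have hall : ∀ z : ℤ × ℤ, (x ≤ z.1 ∧ z.1 ≤ x + 1) → (y ≤ z.2 ∧ z.2 ≤ y + 1) → (z ∈ scomp V v ↔ z ∈ V) := by
    have : ∃ w ∈ scomp V v, (x ≤ w.1 ∧ w.1 ≤ x + 1) ∧ (y ≤ w.2 ∧ w.2 ≤ y + 1) := by
      by_contra hh
      push Not at hh
      apply hn
      refine ⟨fun h => ?_, fun h => ?_, fun h => ?_, fun h => ?_⟩ <;>
        (have := hh _ h (by simp) ; simp at this)
    obtain ⟨w, hw, hw1, hw2⟩ := this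
    intro z hz1 hz2
    refine ⟨scomp_sub hv, fun hz => ?_⟩
    by_cases hzw : w = z
    · rwa [← hzw]
    · refine Relation.ReflTransGen.tail hw ⟨scomp_sub hv hw, hz, hzw, ?_, ?_⟩ <;> omega
  have k1 := hall (x, y) (by simp) (by simp)
  have k2 := hall (x + 1, y) (by simp) (by simp)
  have k3 := hall (x + 1, y + 1) (by simp) (by simp)
  have k4 := hall (x, y + 1) (by simp) (by simp)
  have e1 : nn2 (x, y) (x + 1, y) := by simp [nn2]
  have e2 : nn2 (x + 1, y) (x + 1, y + 1) := by simp [nn2]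
  have e3 : nn2 (x + 1, y + 1) (x, y + 1) := by simp [nn2]
  have e4 : nn2 (x, y + 1) (x, y) := by simp [nn2]
  have f1 := D.S_iff e1 hy hy
  have f2 := D.S_iff e2 hy hy'
  have f3 := D.S_iff e3 hy' hy'
  have f4 := D.S_iff e4 hy' hy
  have hd : ∀ z, (z ∈ scomp V v ↔ z ∈ V) → ind2 (scomp V v) z = 1 → ind2 S z = 0 := by
    intro z hz h
    simp only [ind2] at h ⊢
    split_ifs at h with h'
    · rw [if_neg (fun hs => D.disj z hs (hz.1 h'))]
    · exact absurd h (by decide)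
  have he : ∀ z w, (z ∈ scomp V v ↔ z ∈ V) → (w ∈ scomp V v ↔ w ∈ V) → (z ∉ V → w ∉ V → (z ∈ S ↔ w ∈ S)) →
      ind2 (scomp V v) z = 0 → ind2 (scomp V v) w = 0 → ind2 S z = ind2 S w := by
    intro z w hz hw h h1 h2
    have hz' : z ∉ V := by
      rw [← hz]; intro hc; simp [ind2, hc] at h1
    have hw' : w ∉ V := by
      rw [← hw]; intro hc; simp [ind2, hc] at h2
    simp only [ind2, h hz' hw']
  exact square_alg _ _ _ _ _ _ _ _ (hd _ k1) (hd _ k2) (hd _ k3) (hd _ k4) (he _ _ k1 k2 f1) (he _ _ k2 k3 f2)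
    (he _ _ k3 k4 f3) (he _ _ k4 k1 f4)

/-- winding function of a component -/
noncomputable def gk (S κ : Set (ℤ × ℤ)) (x0 x y : ℤ) : ZMod 2 :=
  ∑ x' ∈ Finset.Ioc (x0 - 1) x, cut S κ (x' - 1, y) (x', y)

lemma gk_lt {κ : Set (ℤ × ℤ)} {x0 x y : ℤ} (h : x < x0) : gk S κ x0 x y = 0 := by
  unfold gk; rw [Finset.Ioc_eq_empty (by omega)]; simp

lemma gk_succ {κ : Set (ℤ × ℤ)} {x0 : ℤ} (hx0 : ∀ z ∈ κ, x0 ≤ z.1) (x y : ℤ) :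
    gk S κ x0 (x + 1) y = gk S κ x0 x y + cut S κ (x, y) (x + 1, y) := by
  by_cases h : x0 - 1 ≤ x
  · have : Finset.Ioc (x0 - 1) (x + 1) = insert (x + 1) (Finset.Ioc (x0 - 1) x) := by
      ext z; simp; omega
    unfold gk
    rw [this, Finset.sum_insert (by simp)]
    simp [add_comm]
  · rw [gk_lt (by omega), gk_lt (by omega), cut_zero]
    · simp
    · intro hh; have := hx0 _ hh; simp at this; omega
    · intro hh; have := hx0 _ hh; simp at this; omega

lemma zmod2_self (a : ZMod 2) : a + a = 0 := by revert a; decide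

lemma TopoData.gk_vert (D : TopoData T L V S) {v : ℤ × ℤ} (hv : v ∈ V) {x0 : ℤ} (hx0 : ∀ z ∈ scomp V v, x0 ≤ z.1)
    (x y : ℤ) (hy : y ∈ T) (hy' : y + 1 ∈ T) :
    gk S (scomp V v) x0 x (y + 1) = gk S (scomp V v) x0 x y + cut S (scomp V v) (x, y) (x, y + 1) := by
  by_cases h : x0 - 1 ≤ x
  · induction x, h using Int.le_induction with
    | base =>
      rw [gk_lt (by omega), gk_lt (by omega), cut_zero]
      · simp
      · intro hh; have := hx0 _ hh; simp at this
      · intro hh; have := hx0 _ hh; simp at this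
    | succ x hx ih =>
      rw [gk_succ hx0, gk_succ hx0, ih]
      have h := D.square hv x y hy hy'
      rw [cut_symm S _ (x + 1, y + 1) (x, y + 1), cut_symm S _ (x, y + 1) (x, y)] at h
      generalize cut S (scomp V v) (x, y) (x + 1, y) = a at *
      generalize cut S (scomp V v) (x + 1, y) (x + 1, y + 1) = b at *
      generalize cut S (scomp V v) (x, y + 1) (x + 1, y + 1) = c at *
      generalize cut S (scomp V v) (x, y) (x, y + 1) = d at *
      generalize gk S (scomp V v) x0 x y = g at *
      clear ih
      revert a b c d g
      decide
  · rw [gk_lt (by omega), gk_lt (by omega), cut_zero]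
    · simp
    · intro hh; have := hx0 _ hh; simp at this; omega
    · intro hh; have := hx0 _ hh; simp at this; omega

lemma TopoData.gk_nn (D : TopoData T L V S) {v : ℤ × ℤ} (hv : v ∈ V) {x0 : ℤ} (hx0 : ∀ z ∈ scomp V v, x0 ≤ z.1)
    {a b : ℤ × ℤ} (h : nn2 a b) (ha : a.2 ∈ T) (hb : b.2 ∈ T) :
    gk S (scomp V v) x0 b.1 b.2 = gk S (scomp V v) x0 a.1 a.2 + cut S (scomp V v) a b := by
  obtain ⟨a1, a2⟩ := a
  rcases h with rfl | rfl | rfl | rfl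
  · exact gk_succ hx0 a1 a2
  · have := gk_succ (S := S) hx0 (a1 - 1) a2
    simp only [sub_add_cancel] at this
    simp only
    rw [this, cut_symm, add_assoc, zmod2_self, add_zero]
  · exact D.gk_vert hv hx0 a1 a2 ha hb
  · have := D.gk_vert hv hx0 a1 (a2 - 1) hb (by simpa using ha)
    simp only [sub_add_cancel] at this
    simp only
    rw [this, cut_symm, add_assoc, zmod2_self, add_zero]

lemma TopoData.box (D : TopoData T L V S) {v : ℤ × ℤ} (hv : v ∈ V) :
    ∃ x0 y0 : ℤ, ∀ z ∈ scomp V v, x0 ≤ z.1 ∧ z.1 < x0 + L ∧ y0 ≤ z.2 ∧ z.2 < y0 + L := by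
  have hdm : ∀ a ∈ scomp V v, ∀ b ∈ scomp V v, |a.1 - b.1| < L ∧ |a.2 - b.2| < L := by
    intro a ha b hb
    exact D.diam a (scomp_sub hv ha) b (by rwa [scomp_eq ha])
  have hvv : v ∈ scomp V v := Relation.ReflTransGen.refl
  obtain ⟨x0, ⟨a, ha, rfl⟩, hx0⟩ := Int.exists_least_of_bdd (P := fun x => ∃ a ∈ scomp V v, a.1 = x)
    ⟨v.1 - L, by
      rintro z ⟨a, ha, rfl⟩
      have := (hdm a ha v hvv).1
      rw [abs_lt] at this; omega⟩ ⟨_, v, hvv, rfl⟩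
  obtain ⟨y0, ⟨b, hb, rfl⟩, hy0⟩ := Int.exists_least_of_bdd (P := fun x => ∃ a ∈ scomp V v, a.2 = x)
    ⟨v.2 - L, by
      rintro z ⟨a, ha, rfl⟩
      have := (hdm a ha v hvv).2
      rw [abs_lt] at this; omega⟩ ⟨_, v, hvv, rfl⟩
  refine ⟨_, _, fun z hz => ⟨hx0 _ ⟨z, hz, rfl⟩, ?_, hy0 _ ⟨z, hz, rfl⟩, ?_⟩⟩
  · have := (hdm z hz a ha).1
    rw [abs_lt] at this; omega
  · have := (hdm z hz b hb).2
    rw [abs_lt] at this; omega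

/-- vertical paths: invariance of a function along a column -/
lemma column_const (hT : T.OrdConnected) (f : ℤ → ZMod 2) (hf : ∀ y, y ∈ T → y + 1 ∈ T → f (y + 1) = f y)
    {a b : ℤ} (ha : a ∈ T) (hb : b ∈ T) (hab : a ≤ b) : f b = f a := by
  induction b, hab using Int.le_induction with
  | base => rfl
  | succ n hn ih =>
    have h1 : n ∈ T := hT.out ha hb ⟨hn, by omega⟩
    rw [hf n h1 hb, ih h1]

lemma column_const' (hT : T.OrdConnected) (f : ℤ → ZMod 2) (hf : ∀ y, y ∈ T → y + 1 ∈ T → f (y + 1) = f y)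
    {a b : ℤ} (ha : a ∈ T) (hb : b ∈ T) : f b = f a := by
  rcases le_total a b with h | h
  · exact column_const hT f hf ha hb h
  · exact (column_const hT f hf hb ha h).symm

lemma TopoData.gk_out (D : TopoData T L V S) {v : ℤ × ℤ} (hv : v ∈ V) {x0 y0 : ℤ}
    (hb : ∀ z ∈ scomp V v, x0 ≤ z.1 ∧ z.1 < x0 + L ∧ y0 ≤ z.2 ∧ z.2 < y0 + L)
    {x y : ℤ} (hy : y ∈ T) (h : ¬ (x0 ≤ x ∧ x < x0 + L ∧ y0 ≤ y ∧ y < y0 + L)) : gk S (scomp V v) x0 x y = 0 := by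
  have hrow : ∀ x y, ¬ (y0 ≤ y ∧ y < y0 + L) → gk S (scomp V v) x0 x y = 0 := by
    intro x y hy
    unfold gk
    refine Finset.sum_eq_zero fun x' _ => cut_zero ?_ ?_
    · intro hh; exact hy (hb _ hh).2.2
    · intro hh; exact hy (hb _ hh).2.2
  by_cases hx : x < x0
  · exact gk_lt hx
  by_cases hyy : y0 ≤ y ∧ y < y0 + L
  · have hx' : x0 + L ≤ x := by omega
    obtain ⟨t, ht, ht'⟩ := D.rows y0
    have h1 : gk S (scomp V v) x0 x y = gk S (scomp V v) x0 x t := by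
      refine column_const' D.ord (fun y => gk S (scomp V v) x0 x y) ?_ ht hy
      intro y hy hy'
      rw [D.gk_vert hv (fun z hz => (hb z hz).1) x y hy hy', cut_zero, add_zero]
      · intro hh; have := (hb _ hh).2.1; simp at this; omega
      · intro hh; have := (hb _ hh).2.1; simp at this; omega
    rw [h1]
    exact hrow _ _ (by omega)
  · exact hrow _ _ hyy

/-- nearest-neighbour step in the complement of `V` -/
def wstep (T : Set ℤ) (V : Set (ℤ × ℤ)) (a b : ℤ × ℤ) : Prop :=
  (a.2 ∈ T ∧ a ∉ V) ∧ (b.2 ∈ T ∧ b ∉ V) ∧ nn2 a b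

lemma TopoData.gk_path (D : TopoData T L V S) {v : ℤ × ℤ} (hv : v ∈ V) {x0 : ℤ} (hx0 : ∀ z ∈ scomp V v, x0 ≤ z.1)
    {a b : ℤ × ℤ} (h : Relation.ReflTransGen (wstep T V) a b) :
    gk S (scomp V v) x0 b.1 b.2 = gk S (scomp V v) x0 a.1 a.2 := by
  induction h with
  | refl => rfl
  | tail _ h ih =>
    obtain ⟨⟨h1, h2⟩, ⟨h3, h4⟩, h5⟩ := h
    rw [D.gk_nn hv hx0 h5 h1 h3, cut_zero (fun h => h2 (scomp_sub hv h)) (fun h => h4 (scomp_sub hv h)), add_zero, ih]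

/-- `p` is joined in the complement of `V` to two far away points -/
def bigFrom (T : Set ℤ) (L : ℕ) (V : Set (ℤ × ℤ)) (p : ℤ × ℤ) : Prop :=
  ∃ a b, Relation.ReflTransGen (wstep T V) p a ∧ Relation.ReflTransGen (wstep T V) p b ∧
    ((L : ℤ) ≤ |a.1 - b.1| ∨ (L : ℤ) ≤ |a.2 - b.2|)

lemma wpath_T {a b : ℤ × ℤ} (ha : a.2 ∈ T) (h : Relation.ReflTransGen (wstep T V) a b) : b.2 ∈ T := by
  induction h with
  | refl => exact ha
  | tail _ h _ => exact h.2.1.1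

lemma TopoData.gk_big (D : TopoData T L V S) {v : ℤ × ℤ} (hv : v ∈ V) {x0 y0 : ℤ}
    (hb : ∀ z ∈ scomp V v, x0 ≤ z.1 ∧ z.1 < x0 + L ∧ y0 ≤ z.2 ∧ z.2 < y0 + L)
    {p : ℤ × ℤ} (hp : p.2 ∈ T) (h : bigFrom T L V p) : gk S (scomp V v) x0 p.1 p.2 = 0 := by
  obtain ⟨a, b, ha, hbb, hab⟩ := h
  have hx0 : ∀ z ∈ scomp V v, x0 ≤ z.1 := fun z hz => (hb z hz).1
  by_cases hin : (x0 ≤ a.1 ∧ a.1 < x0 + L ∧ y0 ≤ a.2 ∧ a.2 < y0 + L)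
  · rw [← D.gk_path hv hx0 hbb]
    refine D.gk_out hv hb (wpath_T hp hbb) ?_
    intro hin'
    rcases hab with hab | hab
    · have : |a.1 - b.1| < L := by rw [abs_lt]; omega
      omega
    · have : |a.2 - b.2| < L := by rw [abs_lt]; omega
      omega
  · rw [← D.gk_path hv hx0 ha]
    exact D.gk_out hv hb (wpath_T hp ha) hin

/-- choice of the left end of a component -/
noncomputable def lft (κ : Set (ℤ × ℤ)) : ℤ := if h : ∃ x0, ∀ z ∈ κ, x0 ≤ z.1 then h.choose else 0

theorem TopoData.contra (D : TopoData T L V S) {p q : ℤ × ℤ} (hp : p ∈ S) (hq : q ∉ S) (hqT : q.2 ∈ T)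
    (hbp : bigFrom T L V p) (hbq : bigFrom T L V q) : False := by
  choose! x0 y0 hbox using fun v => D.box (v := v)
  -- component boxes depending only on the component
  have hbox' : ∀ κ : Set (ℤ × ℤ), (∃ v ∈ V, κ = scomp V v) → ∃ x0 y0 : ℤ, ∀ z ∈ κ, x0 ≤ z.1 ∧ z.1 < x0 + L ∧ y0 ≤ z.2 ∧ z.2 < y0 + L := by
    rintro κ ⟨v, hv, rfl⟩; exact D.box hv
  choose! X0 Y0 hB using hbox'
  have hpT := D.inT p hp
  let R : Finset (ℤ × ℤ) := Finset.Icc (min p.1 q.1) (max p.1 q.1) ×ˢ Finset.Icc (min p.2 q.2) (max p.2 q.2)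
  let Λ : Finset (Set (ℤ × ℤ)) := (R.filter (· ∈ V)).image (scomp V)
  have hΛ : ∀ κ ∈ Λ, ∃ v ∈ V, κ = scomp V v := by
    intro κ hκ
    simp only [Λ, Finset.mem_image, Finset.mem_filter] at hκ
    obtain ⟨v, ⟨_, hv⟩, rfl⟩ := hκ
    exact ⟨v, hv, rfl⟩
  let H : ℤ × ℤ → ZMod 2 := fun z => ind2 S z + ∑ κ ∈ Λ, gk S κ (X0 κ) z.1 z.2
  have hsum : ∀ b ∈ R, b ∈ V → ∑ κ ∈ Λ, ind2 κ b = 1 := by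
    intro b hb hbV
    rw [Finset.sum_eq_single (scomp V b)]
    · simp [ind2, show b ∈ scomp V b from Relation.ReflTransGen.refl]
    · intro κ hκ hne
      obtain ⟨v, hv, rfl⟩ := hΛ κ hκ
      simp only [ind2]
      rw [if_neg]
      intro hh
      exact hne (scomp_eq hh).symm
    · intro hh
      exact absurd (Finset.mem_image_of_mem _ (Finset.mem_filter.2 ⟨hb, hbV⟩)) hh
  have hsum0 : ∀ b, b ∉ V → ∑ κ ∈ Λ, ind2 κ b = 0 := by
    intro b hbV
    refine Finset.sum_eq_zero fun κ hκ => ?_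
    obtain ⟨v, hv, rfl⟩ := hΛ κ hκ
    simp only [ind2]
    rw [if_neg]
    intro hh
    exact hbV (scomp_sub hv hh)
  have hH : ∀ a b, a ∈ R → b ∈ R → a.2 ∈ T → b.2 ∈ T → nn2 a b → H b = H a := by
    intro a b haR hbR ha hb hab
    have h1 : ∑ κ ∈ Λ, gk S κ (X0 κ) b.1 b.2 = ∑ κ ∈ Λ, gk S κ (X0 κ) a.1 a.2 + ∑ κ ∈ Λ, cut S κ a b := by
      rw [← Finset.sum_add_distrib]
      refine Finset.sum_congr rfl fun κ hκ => ?_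
      have h2 := hB κ (hΛ κ hκ)
      obtain ⟨v, hv, rfl⟩ := hΛ κ hκ
      exact D.gk_nn hv (fun z hz => (h2 z hz).1) hab ha hb
    have h2 : ∑ κ ∈ Λ, cut S κ a b = ind2 S a + ind2 S b := by
      unfold cut
      rw [Finset.sum_add_distrib, ← Finset.mul_sum, ← Finset.mul_sum]
      by_cases haV : a ∈ V <;> by_cases hbV : b ∈ V
      · have := fun h => D.disj a h haV
        have := fun h => D.disj b h hbV
        simp_all [ind2]
      · have := fun h => D.disj a h haV
        rw [hsum a haR haV, hsum0 b hbV]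
        simp_all [ind2]
      · have := fun h => D.disj b h hbV
        rw [hsum b hbR hbV, hsum0 a haV]
        simp_all [ind2]
      · rw [hsum0 b hbV, hsum0 a haV]
        have := D.S_iff hab ha hb haV hbV
        simp only [ind2, this]
        rw [mul_zero, zmod2_self, zmod2_self]
    simp only [H]
    rw [h1, h2]
    generalize ind2 S a = s
    generalize ind2 S b = s'
    generalize ∑ κ ∈ Λ, gk S κ (X0 κ) a.1 a.2 = g
    revert s s' g
    decide
  have hHp : H p = 1 := by
    simp only [H]
    rw [Finset.sum_eq_zero]
    · simp [ind2, hp]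
    · intro κ hκ
      have h2 := hB κ (hΛ κ hκ)
      obtain ⟨v, hv, rfl⟩ := hΛ κ hκ
      exact D.gk_big hv h2 hpT hbp
  have hHq : H q = 0 := by
    simp only [H]
    rw [Finset.sum_eq_zero]
    · simp [ind2, hq]
    · intro κ hκ
      have h2 := hB κ (hΛ κ hκ)
      obtain ⟨v, hv, rfl⟩ := hΛ κ hκ
      exact D.gk_big hv h2 hqT hbq
  have hv : H (p.1, q.2) = H (p.1, p.2) := by
    have := column_const' (T := T ∩ Set.Icc (min p.2 q.2) (max p.2 q.2)) (D.ord.inter Set.ordConnected_Icc) (fun y => H (p.1, y))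
      ?_ (a := p.2) (b := q.2) ⟨hpT, by simp⟩ ⟨hqT, by simp⟩
    · exact this
    · intro y hy hy'
      refine hH (p.1, y) (p.1, y + 1) ?_ ?_ hy.1 hy'.1 (by simp [nn2])
      · simp only [R, Finset.mem_product, Finset.mem_Icc]
        exact ⟨by simp, hy.2⟩
      · simp only [R, Finset.mem_product, Finset.mem_Icc]
        exact ⟨by simp, hy'.2⟩
  have hh : H (q.1, q.2) = H (p.1, q.2) := by
    have := column_const' (T := Set.Icc (min p.1 q.1) (max p.1 q.1)) (Set.ordConnected_Icc) (fun x => H (x, q.2))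
      ?_ (a := p.1) (b := q.1) (by simp) (by simp)
    · exact this
    · intro y hy hy'
      refine hH (y, q.2) (y + 1, q.2) ?_ ?_ hqT hqT (by simp [nn2])
      · simp only [R, Finset.mem_product, Finset.mem_Icc]
        exact ⟨hy, by simp⟩
      · simp only [R, Finset.mem_product, Finset.mem_Icc]
        exact ⟨hy', by simp⟩
  have : H q = H p := hh.trans hv
  rw [hHp, hHq] at this
  exact absurd this (by decide)

end topo

section paths

/-- the eight star steps -/
noncomputable def steps8 : Finset (ℤ × ℤ) := (Finset.Icc (-1) 1 ×ˢ Finset.Icc (-1) 1).erase 0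

lemma card_steps8 : steps8.card = 8 := by
  unfold steps8
  rw [Finset.card_erase_of_mem (by simp)]
  simp

/-- non-backtracking step lists (last step first) -/
noncomputable def NB : ℕ → Finset (List (ℤ × ℤ))
  | 0 => {[]}
  | n + 1 => (NB n).biUnion fun l => (steps8.filter fun s => l.head? ≠ some (-s)).image fun s => s :: l

/-- points visited -/
noncomputable def pts : List (ℤ × ℤ) → Finset (ℤ × ℤ)
  | [] => {0}
  | s :: l => insert (s + l.sum) (pts l)

lemma NB_head {n : ℕ} {l : List (ℤ × ℤ)} (h : l ∈ NB (n + 1)) : ∃ s ∈ steps8, l.head? = some s := by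
  simp only [NB, Finset.mem_biUnion, Finset.mem_image, Finset.mem_filter] at h
  obtain ⟨l', _, s, ⟨hs, _⟩, rfl⟩ := h
  exact ⟨s, hs, rfl⟩

lemma card_NB (n : ℕ) : (NB (n + 1)).card ≤ 8 * 7 ^ n := by
  induction n with
  | zero =>
    simp only [NB, Finset.singleton_biUnion]
    refine Finset.card_image_le.trans ((Finset.card_filter_le _ _).trans ?_)
    simp [card_steps8]
  | succ n ih =>
    rw [NB]
    refine (Finset.card_biUnion_le_card_mul _ _ 7 ?_).trans ?_
    · intro l hl
      obtain ⟨s, hs, hl⟩ := NB_head hl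
      refine Finset.card_image_le.trans ?_
      have : (steps8.filter fun s => l.head? ≠ some (-s)) ⊆ steps8.erase (-s) := by
        intro t ht
        simp only [Finset.mem_filter] at ht
        refine Finset.mem_erase.2 ⟨?_, ht.1⟩
        rintro rfl
        apply ht.2
        rw [hl]; simp
      refine (Finset.card_le_card this).trans ?_
      rw [Finset.card_erase_of_mem, card_steps8]
      unfold steps8 at hs ⊢
      simp only [Finset.mem_erase, Finset.mem_product, Finset.mem_Icc] at hs ⊢
      refine ⟨neg_ne_zero.2 hs.1, ?_⟩
      simp; omega
    · rw [pow_succ]; nlinarith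

lemma exists_NB (f : ℕ → ℤ × ℤ) (L : ℕ) (hst : ∀ i < L, starAdj (f i) (f (i + 1))) (hinj : Set.InjOn f (Set.Iic L)) :
    ∀ n ≤ L, ∃ l ∈ NB n, l.sum = f n - f 0 ∧ (∀ k, n = k + 1 → l.head? = some (f (k + 1) - f k)) ∧ (n = 0 → l = []) ∧
      pts l = (Finset.range (n + 1)).image fun i => f i - f 0 := by
  intro n
  induction n with
  | zero =>
    intro _
    refine ⟨[], by simp [NB], by simp, by simp, by simp, ?_⟩
    simp [pts]
  | succ n ih =>
    intro hn
    obtain ⟨l, hl, hsum, hhead, hnil, hpts⟩ := ih (by omega)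
    refine ⟨(f (n + 1) - f n) :: l, ?_, ?_, ?_, by simp, ?_⟩
    · rw [NB]
      simp only [Finset.mem_biUnion, Finset.mem_image, Finset.mem_filter]
      refine ⟨l, hl, _, ⟨?_, ?_⟩, rfl⟩
      · obtain ⟨h1, h2, h3⟩ := hst n (by omega)
        unfold steps8
        simp only [Finset.mem_erase, Finset.mem_product, Finset.mem_Icc, ne_eq, sub_eq_zero]
        refine ⟨fun h => h1 h.symm, ?_⟩
        simp only [Prod.fst_sub, Prod.snd_sub]
        omega
      · rcases n with _ | k
        · rw [hnil rfl]; simp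
        · rw [hhead k rfl]
          simp only [neg_sub, ne_eq, Option.some.injEq]
          intro h
          have h1 : f k = f (k + 2) := by
            have : f (k + 1) - f k = f (k + 1) - f (k + 2) := h
            exact sub_right_injective this
          have := hinj (by simp; omega) (by simp; omega) h1
          omega
    · simp [hsum]
    · intro k hk
      have : n = k := by omega
      subst this; rfl
    · rw [pts, hsum, hpts, Finset.range_add_one (n := n + 1), Finset.image_insert]
      congr 1
      abel

lemma exists_path {V : Set (ℤ × ℤ)} {a b : ℤ × ℤ} {L : ℕ} (hL : 1 ≤ L) (hab : b ∈ scomp V a)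
    (hd : (L : ℤ) ≤ |a.1 - b.1| ∨ (L : ℤ) ≤ |a.2 - b.2|) :
    ∃ f : ℕ → ℤ × ℤ, (∀ i ≤ L, f i ∈ V) ∧ (∀ i < L, starAdj (f i) (f (i + 1))) ∧ Set.InjOn f (Set.Iic L) := by
  let G : SimpleGraph (ℤ × ℤ) :=
    { Adj := sstep V
      symm := ⟨fun _ _ h => sstep_symm h⟩
      loopless := ⟨fun a h => h.2.2.1 rfl⟩ }
  have hr : G.Reachable a b := (SimpleGraph.reachable_iff_reflTransGen a b).2 hab
  obtain ⟨p, hp⟩ := hr.exists_isPath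
  have hadj : ∀ i < p.length, sstep V (p.getVert i) (p.getVert (i + 1)) := fun i hi => p.adj_getVert_succ hi
  have hdist : ∀ i ≤ p.length, |a.1 - (p.getVert i).1| ≤ i ∧ |a.2 - (p.getVert i).2| ≤ i := by
    intro i
    induction i with
    | zero => simp
    | succ i ih =>
      intro hi
      have h1 := ih (by omega)
      obtain ⟨_, _, _, h2, h3⟩ := hadj i (by omega)
      simp only [abs_le] at h1 ⊢
      push_cast
      omega
  have hlen : L ≤ p.length := by
    have := hdist p.length le_rfl
    rw [p.getVert_length] at this
    omega
  refine ⟨p.getVert, ?_, fun i hi => (hadj i (by omega)).2.2, hp.getVert_injOn.mono (by intro i hi; simp at hi ⊢; omega)⟩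
  intro i hi
  rcases i with _ | i
  · exact (hadj 0 (by omega)).1
  · exact (hadj i (by omega)).2.1

/-- good step lists -/
noncomputable def goodNB (L : ℕ) : Finset (List (ℤ × ℤ)) :=
  (NB L).filter fun l => (pts l).card = L + 1 ∧ ∀ z ∈ pts l, ∀ w ∈ pts l, |z.1 - w.1| ≤ L ∧ |z.2 - w.2| ≤ L

lemma card_goodNB (n : ℕ) : (goodNB (n + 1)).card ≤ 8 * 7 ^ n := (Finset.card_filter_le _ _).trans (card_NB n)

lemma exists_good {V : Set (ℤ × ℤ)} {a b : ℤ × ℤ} {L : ℕ} (hL : 1 ≤ L) (hab : b ∈ scomp V a)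
    (hd : (L : ℤ) ≤ |a.1 - b.1| ∨ (L : ℤ) ≤ |a.2 - b.2|) :
    ∃ x ∈ V, ∃ l ∈ goodNB L, ∀ z ∈ pts l, x + z ∈ V := by
  obtain ⟨f, h1, h2, h3⟩ := exists_path hL hab hd
  obtain ⟨l, hl, _, _, _, hpts⟩ := exists_NB f L h2 h3 L le_rfl
  refine ⟨f 0, h1 0 (by omega), l, ?_, ?_⟩
  · have hdist : ∀ i j, i ≤ j → j ≤ L → |(f i).1 - (f j).1| ≤ (j - i : ℤ) ∧ |(f i).2 - (f j).2| ≤ (j - i : ℤ) := by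
      intro i j hij
      induction j, hij using Nat.le_induction with
      | base => simp
      | succ j hj ih =>
        intro hi
        have h1 := ih (by omega)
        obtain ⟨_, h2, h3⟩ := h2 j (by omega)
        simp only [abs_le] at h1 ⊢
        push_cast
        omega
    have hdist' : ∀ i j, i ≤ L → j ≤ L → |(f i).1 - (f j).1| ≤ L ∧ |(f i).2 - (f j).2| ≤ L := by
      intro i j hi hj
      rcases le_total i j with h | h
      · have := hdist i j h hj; omega
      · have := hdist j i h hi
        rw [abs_sub_comm (f i).1, abs_sub_comm (f i).2]
        omega
    unfold goodNB
    refine Finset.mem_filter.2 ⟨hl, ?_, ?_⟩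
    · rw [hpts, Finset.card_image_of_injOn, Finset.card_range]
      intro i hi j hj hij
      simp only [sub_left_inj] at hij
      simp only [Finset.coe_range, Set.mem_Iio] at hi hj
      exact h3 (by simp; omega) (by simp; omega) hij
    · intro z hz w hw
      rw [hpts, Finset.mem_image] at hz hw
      obtain ⟨i, hi, rfl⟩ := hz
      obtain ⟨j, hj, rfl⟩ := hw
      rw [Finset.mem_range] at hi hj
      simpa using hdist' i j (by omega) (by omega)
  · intro z hz
    rw [hpts, Finset.mem_image] at hz
    obtain ⟨i, hi, rfl⟩ := hz
    rw [Finset.mem_range] at hi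
    simpa using h1 i (by omega)

end paths

section lift
variable {d N : ℕ}

/-- planar vector -/
def pl (i k : Fin (d + 1)) (z : ℤ × ℤ) : Lat d := Pi.single i z.1 + Pi.single k z.2

lemma pl_add (i k : Fin (d + 1)) (z w : ℤ × ℤ) : pl i k (z + w) = pl i k z + pl i k w := by
  unfold pl
  simp only [Prod.fst_add, Prod.snd_add, Pi.single_add]
  abel

lemma pl_fst {i k : Fin (d + 1)} (hik : i ≠ k) (z : ℤ × ℤ) : pl i k z i = z.1 := by
  simp [pl, Pi.single_eq_of_ne hik]

lemma pl_snd {i k : Fin (d + 1)} (hik : i ≠ k) (z : ℤ × ℤ) : pl i k z k = z.2 := by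
  simp [pl, Pi.single_eq_of_ne hik.symm]

lemma pl_other {i k l : Fin (d + 1)} (hi : l ≠ i) (hk : l ≠ k) (z : ℤ × ℤ) : pl i k z l = 0 := by
  simp [pl, Pi.single_eq_of_ne hi, Pi.single_eq_of_ne hk]

/-- lift of the plane -/
def lf (y : Lat d) (i k : Fin (d + 1)) (z : ℤ × ℤ) : Cyl d N := projE d N (y + pl i k z)

lemma lf_add (y : Lat d) (i k : Fin (d + 1)) (z w : ℤ × ℤ) :
    (lf y i k (z + w) : Cyl d N) = lf y i k z + projE d N (pl i k w) := by
  unfold lf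
  rw [pl_add, ← add_assoc, projE_add]

lemma Lcoll_lf {F : Set (Cyl d N)} (hF : F ∈ Lcoll d N 2) :
    ∃ y : Lat d, ∃ i k : Fin (d + 1), i < k ∧ F = Set.range (lf y i k) := by
  obtain ⟨I, hI, y, rfl⟩ := hF
  obtain ⟨i, k, hne, rfl⟩ := Finset.card_eq_two.1 hI
  have key : ∀ i k : Fin (d + 1), i ≠ k → (fun v => projE d N (y + v)) '' {v : Lat d | ∀ l ∉ ({i, k} : Finset (Fin (d + 1))), v l = 0}
      = Set.range (lf y i k) := by
    intro i k hne
    ext x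
    constructor
    · rintro ⟨v, hv, rfl⟩
      refine ⟨(v i, v k), ?_⟩
      have : pl i k (v i, v k) = v := by
        ext l
        by_cases h1 : l = i
        · subst h1; rw [pl_fst hne]
        by_cases h2 : l = k
        · subst h2; rw [pl_snd hne]
        rw [pl_other h1 h2]
        exact (hv l (by simp [h1, h2])).symm
      simp only [lf, this]
    · rintro ⟨z, rfl⟩
      refine ⟨pl i k z, ?_, rfl⟩
      intro l hl
      simp only [Finset.mem_insert, Finset.mem_singleton, not_or] at hl
      exact pl_other hl.1 hl.2 z
  rcases lt_or_gt_of_ne hne with h | h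
  · exact ⟨y, i, k, h, key i k hne⟩
  · refine ⟨y, k, i, h, ?_⟩
    rw [← key k i hne.symm, Finset.pair_comm]

lemma lf_height (y : Lat d) {i k : Fin (d + 1)} (hik : i < k) (z : ℤ × ℤ) :
    (lf y i k z : Cyl d N).2 = y (Fin.last d) + if k = Fin.last d then z.2 else 0 := by
  have hi : i ≠ Fin.last d := (lt_of_lt_of_le hik (Fin.le_last k)).ne
  simp only [lf, projE_snd, Pi.add_apply]
  congr 1
  split_ifs with h
  · subst h; exact pl_snd hik.ne z
  · exact pl_other hi.symm (Ne.symm h) z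

/-- rows of the lifted block -/
def rowsT (N : ℕ) (j : ℤ) (y : Lat d) (i k : Fin (d + 1)) : Set ℤ := {t | (lf y i k (0, t) : Cyl d N) ∈ Cblk d N j}

lemma mem_rowsT {j : ℤ} {y : Lat d} {i k : Fin (d + 1)} (hik : i < k) (z : ℤ × ℤ) :
    z.2 ∈ rowsT N j y i k ↔ (lf y i k z : Cyl d N) ∈ Cblk d N j := by
  unfold rowsT Cblk
  simp only [Set.mem_setOf_eq, lf_height y hik]

lemma rowsT_ord {j : ℤ} {y : Lat d} {i k : Fin (d + 1)} (hik : i < k) : (rowsT N j y i k).OrdConnected := by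
  refine ⟨fun a ha b hb t ht => ?_⟩
  unfold rowsT Cblk at *
  simp only [Set.mem_setOf_eq, lf_height y hik] at ha hb ⊢
  split_ifs at * with h
  · have h1 : (a : ℝ) ≤ t := by exact_mod_cast ht.1
    have h2 : (t : ℝ) ≤ b := by exact_mod_cast ht.2
    push_cast at *
    constructor <;> linarith [ha.1, hb.2]
  · exact ha

lemma rowsT_rows {j : ℤ} {y : Lat d} {i k : Fin (d + 1)} (hik : i < k) {L : ℕ} (hL : 4 * L ≤ 3 * N)
    {t0 : ℤ} (ht0 : t0 ∈ rowsT N j y i k) (y0 : ℤ) : ∃ t ∈ rowsT N j y i k, t < y0 ∨ y0 + L ≤ t := by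
  have hL' : (4 : ℝ) * L ≤ 3 * N := by exact_mod_cast hL
  have hL0 : (0 : ℝ) ≤ L := by positivity
  unfold rowsT Cblk at *
  simp only [Set.mem_setOf_eq, lf_height y hik] at ht0 ⊢
  by_cases h : k = Fin.last d
  · simp only [h, if_true] at ht0 ⊢
    by_cases hh : j * N - y (Fin.last d) < y0
    · refine ⟨j * N - y (Fin.last d), ?_, Or.inl hh⟩
      push_cast
      constructor <;> nlinarith
    · refine ⟨j * N + L - y (Fin.last d), ?_, Or.inr (by omega)⟩
      push_cast
      constructor <;> nlinarith
  · simp only [h, if_false] at ht0 ⊢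
    exact ⟨y0 - 1, ht0, Or.inl (by omega)⟩

lemma nn2_unit {a b : ℤ × ℤ} (h : nn2 a b) : ∃ s : ℤ, (s = 1 ∨ s = -1) ∧ (b = a + (s, 0) ∨ b = a + (0, s)) := by
  obtain ⟨a1, a2⟩ := a
  rcases h with rfl | rfl | rfl | rfl
  · exact ⟨1, by simp, by simp⟩
  · exact ⟨-1, by simp, by left; simp [sub_eq_add_neg]⟩
  · exact ⟨1, by simp, by simp⟩
  · exact ⟨-1, by simp, by right; simp [sub_eq_add_neg]⟩

lemma single_mem_unitVecs (i : Fin (d + 1)) {s : ℤ} (hs : s = 1 ∨ s = -1) : (Pi.single i s : Lat d) ∈ unitVecs d := by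
  unfold unitVecs
  simp only [Finset.mem_image, Finset.mem_univ, true_and]
  rcases hs with rfl | rfl
  · exact ⟨(i, true), by simp⟩
  · exact ⟨(i, false), by simp⟩

lemma lf_nn {y : Lat d} {i k : Fin (d + 1)} {a b : ℤ × ℤ} (h : nn2 a b) :
    ∃ e ∈ unitVecs d, (lf y i k b : Cyl d N) = lf y i k a + projE d N e := by
  obtain ⟨s, hs, rfl | rfl⟩ := nn2_unit h
  · exact ⟨_, single_mem_unitVecs i hs, by rw [lf_add]; simp [pl]⟩
  · exact ⟨_, single_mem_unitVecs k hs, by rw [lf_add]; simp [pl]⟩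

lemma lift_step (hN : 2 ≤ N) {y : Lat d} {i k : Fin (d + 1)} (hik : i < k) {a : ℤ × ℤ} {b : Cyl d N}
    (h : adj d N (lf y i k a) b) (hb : b ∈ Set.range (lf y i k : ℤ × ℤ → Cyl d N)) :
    ∃ b', nn2 a b' ∧ lf y i k b' = b := by
  obtain ⟨_, e, he, rfl⟩ := h
  obtain ⟨l, s, hs, rfl⟩ := mem_unitVecs he
  by_cases h1 : l = i
  · subst h1
    refine ⟨a + (s, 0), ?_, by rw [lf_add]; simp [pl]⟩
    rcases hs with rfl | rfl <;> simp [nn2, Prod.ext_iff, sub_eq_add_neg]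
  by_cases h2 : l = k
  · subst h2
    refine ⟨a + (0, s), ?_, by rw [lf_add]; simp [pl]⟩
    rcases hs with rfl | rfl <;> simp [nn2, Prod.ext_iff, sub_eq_add_neg]
  exfalso
  obtain ⟨z, hz⟩ := hb
  have h3 := congrArg (cc l) hz
  rw [cc_add] at h3
  simp only [lf, cc_projE, Pi.add_apply, pl_other h1 h2, Pi.single_eq_same] at h3
  haveI : Fact (1 < N) := ⟨by omega⟩
  rcases hs with rfl | rfl
  · simp at h3
  · simp at h3

lemma lift_path (hN : 2 ≤ N) {j : ℤ} {y : Lat d} {i k : Fin (d + 1)} (hik : i < k) {R O : Set (Cyl d N)}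
    (hO : O ⊆ (Set.range (lf y i k) ∩ Cblk d N j) \ R) {p : ℤ × ℤ} {b : Cyl d N} (h : connIn d N O (lf y i k p) b) :
    ∃ b', lf y i k b' = b ∧
      Relation.ReflTransGen (wstep (rowsT N j y i k) {z | z.2 ∈ rowsT N j y i k ∧ (lf y i k z : Cyl d N) ∈ R}) p b' := by
  unfold connIn at h
  induction h with
  | refl => exact ⟨p, rfl, .refl⟩
  | tail _ h ih =>
    obtain ⟨a', rfl, ha'⟩ := ih
    obtain ⟨h1, h2, h3⟩ := h
    obtain ⟨b', hb', rfl⟩ := lift_step hN hik h3 (hO h2).1.1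
    refine ⟨b', rfl, ha'.tail ⟨⟨?_, ?_⟩, ⟨?_, ?_⟩, hb'⟩⟩
    · exact (mem_rowsT hik _).2 (hO h1).1.2
    · exact fun hh => (hO h1).2 hh.2
    · exact (mem_rowsT hik _).2 (hO h2).1.2
    · exact fun hh => (hO h2).2 hh.2

lemma cylDist_lf {y : Lat d} {i k : Fin (d + 1)} (hik : i < k) {L : ℕ} {a b : ℤ × ℤ} (hL : 1 ≤ L)
    (h : L ≤ cylDist d N (lf y i k a) (lf y i k b)) : (L : ℤ) ≤ |a.1 - b.1| ∨ (L : ℤ) ≤ |a.2 - b.2| := by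
  by_contra hc
  push Not at hc
  have h1 : cylDist d N (lf y i k a) (lf y i k b) ≤ linf (pl i k (b - a)) := by
    unfold cylDist
    refine Nat.sInf_le ⟨_, ?_, rfl⟩
    have := lf_add (N := N) y i k a (b - a)
    rw [add_sub_cancel] at this
    rw [this]; abel
  have h2 : linf (pl i k (b - a)) < L := by
    unfold linf
    rw [Finset.sup_lt_iff (by simp; omega)]
    intro l _
    by_cases h1 : l = i
    · subst h1; rw [pl_fst hik.ne]; have := hc.1; rw [abs_lt] at this; simp only [Prod.fst_sub]; omega
    by_cases h2 : l = k
    · subst h2; rw [pl_snd hik.ne]; have := hc.2; rw [abs_lt] at this; simp only [Prod.snd_sub]; omega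
    rw [pl_other h1 h2]; simp; omega
  omega

lemma big_lift (hN : 2 ≤ N) {j : ℤ} {y : Lat d} {i k : Fin (d + 1)} (hik : i < k) {R O : Set (Cyl d N)}
    (hO : O ⊆ (Set.range (lf y i k) ∩ Cblk d N j) \ R) {L : ℕ} (hL : 1 ≤ L) (hc : IsConnIn d N O) (hd : diamGE d N O L)
    {p : ℤ × ℤ} (hp : lf y i k p ∈ O) :
    bigFrom (rowsT N j y i k) L {z | z.2 ∈ rowsT N j y i k ∧ (lf y i k z : Cyl d N) ∈ R} p := by
  obtain ⟨a, ha, b, hb, hab⟩ := hd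
  obtain ⟨a', rfl, ha'⟩ := lift_path hN hik hO (hc _ hp _ ha)
  obtain ⟨b', rfl, hb'⟩ := lift_path hN hik hO (hc _ hp _ hb)
  exact ⟨a', b', ha', hb', cylDist_lf hik hL hab⟩

theorem U_plane (hN : 2 ≤ N) {j : ℤ} {y : Lat d} {i k : Fin (d + 1)} (hik : i < k) {R O₁ O₂ : Set (Cyl d N)}
    {L : ℕ} (hL : 1 ≤ L) (hLN : 4 * L ≤ 3 * N)
    (h1 : O₁ ⊆ (Set.range (lf y i k) ∩ Cblk d N j) \ R) (h2 : O₂ ⊆ (Set.range (lf y i k) ∩ Cblk d N j) \ R)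
    (c1 : IsConnIn d N O₁) (c2 : IsConnIn d N O₂) (d1 : diamGE d N O₁ L) (d2 : diamGE d N O₂ L)
    {p q : Cyl d N} (hp : p ∈ O₁) (hq : q ∈ O₂) (hn : ¬ connIn d N ((Set.range (lf y i k) ∩ Cblk d N j) \ R) p q) :
    ∃ x : Cyl d N, x ∈ Cblk d N j ∧ ∃ l ∈ goodNB L, ∀ z ∈ pts l,
      x + projE d N (pl i k z) ∈ Cblk d N j ∧ x + projE d N (pl i k z) ∈ R := by
  obtain ⟨p', rfl⟩ := (h1 hp).1.1
  obtain ⟨q', rfl⟩ := (h2 hq).1.1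
  have b1 := big_lift hN hik h1 hL c1 d1 hp
  have b2 := big_lift hN hik h2 hL c2 d2 hq
  have hpT := (mem_rowsT hik _).2 (h1 hp).1.2
  have hqT := (mem_rowsT hik _).2 (h2 hq).1.2
  set T := rowsT N j y i k with hT
  set V : Set (ℤ × ℤ) := {z | z.2 ∈ T ∧ (lf y i k z : Cyl d N) ∈ R} with hV
  set W : Set (Cyl d N) := (Set.range (lf y i k) ∩ Cblk d N j) \ R with hW
  have hmem : ∀ z : ℤ × ℤ, z.2 ∈ T → z ∉ V → (lf y i k z : Cyl d N) ∈ W := by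
    intro z hz hzV
    exact ⟨⟨⟨z, rfl⟩, (mem_rowsT hik _).1 hz⟩, fun h => hzV ⟨hz, h⟩⟩
  by_cases hlong : ∃ a ∈ V, ∃ b ∈ scomp V a, (L : ℤ) ≤ |a.1 - b.1| ∨ (L : ℤ) ≤ |a.2 - b.2|
  · obtain ⟨a, ha, b, hb, hab⟩ := hlong
    obtain ⟨x, hx, l, hl, hz⟩ := exists_good hL hb hab
    refine ⟨lf y i k x, (mem_rowsT hik _).1 hx.1, l, hl, fun z hzz => ?_⟩
    rw [← lf_add]
    have := hz z hzz
    exact ⟨(mem_rowsT hik _).1 this.1, this.2⟩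
  · exfalso
    push Not at hlong
    let S : Set (ℤ × ℤ) := {z | z.2 ∈ T ∧ (lf y i k z : Cyl d N) ∈ W ∧ connIn d N W (lf y i k p') (lf y i k z)}
    have D : TopoData T L V S :=
      { ord := rowsT_ord hik
        rows := rowsT_rows hik hLN hpT
        disj := fun z hz hzV => hz.2.1.2 hzV.2
        clos := by
          intro a ha b hab hbT hbV
          have hbW := hmem b hbT hbV
          refine ⟨hbT, hbW, ?_⟩
          obtain ⟨e, he, heq⟩ := lf_nn (N := N) (y := y) (i := i) (k := k) hab
          by_cases hne : (lf y i k a : Cyl d N) = lf y i k b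
          · rw [← hne]; exact ha.2.2
          · exact Relation.ReflTransGen.tail ha.2.2 ⟨ha.2.1, hbW, hne, e, he, heq⟩
        inT := fun z hz => hz.1
        diam := hlong }
    exact D.contra (p := p') (q := q') ⟨hpT, h1 hp, Relation.ReflTransGen.refl⟩ (fun h => hn h.2.2) hqT b1 b2

end lift

section ubound
variable {d N : ℕ}

lemma zmod_small {a b : ℤ} {L : ℕ} (hLN : L < N) (h : |a - b| ≤ L) (hab : (a : ZMod N) = b) : a = b := by
  rw [ZMod.intCast_eq_intCast_iff_dvd_sub] at hab
  have h1 : |b - a| < N := by rw [abs_sub_comm]; omega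
  have := Int.eq_zero_of_abs_lt_dvd hab h1
  omega

lemma pl_inj {i k : Fin (d + 1)} (hik : i < k) {L : ℕ} (hLN : L < N) (x : Cyl d N) {z w : ℤ × ℤ}
    (h : |z.1 - w.1| ≤ L ∧ |z.2 - w.2| ≤ L) (he : x + projE d N (pl i k z) = x + projE d N (pl i k w)) : z = w := by
  have h1 := congrArg (cc i) he
  have h2 := congrArg (cc k) he
  rw [cc_add, cc_add, pl_fst hik.ne, pl_fst hik.ne] at h1
  rw [cc_add, cc_add, pl_snd hik.ne, pl_snd hik.ne] at h2
  exact Prod.ext (zmod_small hLN h.1 (add_left_cancel h1)) (zmod_small hLN h.2 (add_left_cancel h2))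

theorem U_bound [NeZero N] (hN : 2 ≤ N) {Pl : Cyl d N → Measure (ℕ → Cyl d N)}
    (j : ℤ) (K : ℕ) (c0 : ℝ) (n : ℕ) (hL : n + 1 = ⌊c0 * Real.log N⌋₊) (hLN : 4 * (n + 1) ≤ 3 * N)
    {lam0 : ℝ} (hcov : ∀ A ∈ Adm d N j 2, lawP d N Pl {ω | ∀ x ∈ A, x ∈ ranE ω (DD d N j K ω)} ≤
      ENNReal.ofReal (Real.exp (-lam0 * A.card))) :
    lawP d N Pl (Uev d N c0 j K)ᶜ ≤
      ENNReal.ofReal (3 * N ^ (d + 1) * (d + 1) ^ 2 * (8 * 7 ^ n * Real.exp (-lam0 * (n + 2 : ℕ)))) := by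
  set A : Cyl d N → Fin (d + 1) × Fin (d + 1) → List (ℤ × ℤ) → Finset (Cyl d N) := fun x p l =>
    (pts l).image fun z => x + projE d N (pl p.1 p.2 z) with hA
  set I : Finset (Cyl d N × (Fin (d + 1) × Fin (d + 1)) × List (ℤ × ℤ)) :=
    (Cjf d N j ×ˢ (Finset.univ ×ˢ goodNB (n + 1))).filter fun a => a.2.1.1 < a.2.1.2 ∧ ↑(A a.1 a.2.1 a.2.2) ⊆ Cblk d N j with hI
  have hsub : (Uev d N c0 j K)ᶜ ⊆ ⋃ a ∈ I, {ω | ∀ x ∈ A a.1 a.2.1 a.2.2, x ∈ ranE ω (DD d N j K ω)} := by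
    intro ω hω
    simp only [Uev, Set.mem_compl_iff, Set.mem_setOf_eq, not_forall] at hω
    obtain ⟨F, hF, t, ht, O₁, O₂, h1, h2, c1, c2, d1, d2, p, hp, q, hq, hn⟩ := hω
    rw [← hL] at d1 d2
    obtain ⟨y, i, k, hik, rfl⟩ := Lcoll_lf hF
    obtain ⟨x, hx, l, hl, hz⟩ := U_plane hN hik (by omega) hLN h1 h2 c1 c2 d1 d2 hp hq hn
    simp only [Set.mem_iUnion]
    refine ⟨(x, (i, k), l), ?_, ?_⟩
    · rw [hI, Finset.mem_filter]
      refine ⟨?_, hik, ?_⟩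
      · simp only [Finset.mem_product, Finset.mem_univ, true_and]
        exact ⟨(mem_Cjf j x).2 hx, hl⟩
      · intro w hw
        simp only [hA, Finset.coe_image] at hw
        obtain ⟨z, hzz, rfl⟩ := hw
        exact (hz z hzz).1
    · intro w hw
      simp only [hA, Finset.mem_image] at hw
      obtain ⟨z, hzz, rfl⟩ := hw
      obtain ⟨s, hs, hs'⟩ := (hz z hzz).2
      exact ⟨s, le_trans (by exact_mod_cast hs) ht, hs'⟩
  have hpt : ∀ a ∈ I, lawP d N Pl {ω | ∀ x ∈ A a.1 a.2.1 a.2.2, x ∈ ranE ω (DD d N j K ω)} ≤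
      ENNReal.ofReal (Real.exp (-lam0 * (n + 2 : ℕ))) := by
    rintro ⟨x, ⟨i, k⟩, l⟩ ha
    rw [hI, Finset.mem_filter] at ha
    obtain ⟨ha1, hik, ha2⟩ := ha
    simp only [Finset.mem_product, Finset.mem_univ, true_and] at ha1
    have hg := (Finset.mem_filter.1 ha1.2).2
    have hcard : (A x (i, k) l).card = n + 2 := by
      rw [hA]
      simp only
      rw [Finset.card_image_of_injOn, hg.1]
      intro z hz w hw h
      exact pl_inj hik (by omega) x (hg.2 z hz w hw) h
    have := hcov (A x (i, k) l) ?_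
    · rwa [hcard] at this
    · refine ⟨Finset.card_pos.1 (by omega), ha2, ?_⟩
      obtain ⟨y, rfl⟩ := projE_surj x
      refine ⟨_, ⟨{i, k}, Finset.card_pair (ne_of_lt hik), y, rfl⟩, ?_⟩
      intro w hw
      simp only [hA, Finset.coe_image] at hw
      obtain ⟨z, hzz, rfl⟩ := hw
      refine ⟨pl i k z, ?_, projE_add _ _⟩
      intro t ht
      simp only [Finset.mem_insert, Finset.mem_singleton, not_or] at ht
      exact pl_other ht.1 ht.2 z
  have hcI : (I.card : ℝ) ≤ 3 * N ^ (d + 1) * (d + 1) ^ 2 * (8 * 7 ^ n) := by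
    have : I.card ≤ 3 * N ^ (d + 1) * (((d + 1) * (d + 1)) * (8 * 7 ^ n)) := by
      refine (Finset.card_filter_le _ _).trans ?_
      rw [Finset.card_product, Finset.card_product]
      simp only [Finset.card_univ, Fintype.card_prod, Fintype.card_fin]
      gcongr
      · exact card_Cjf j
      · exact card_goodNB n
    calc (I.card : ℝ) ≤ ((3 * N ^ (d + 1) * (((d + 1) * (d + 1)) * (8 * 7 ^ n)) : ℕ) : ℝ) := by exact_mod_cast this
      _ = _ := by push_cast; ring
  refine (measure_mono hsub).trans ((measure_biUnion_finset_le _ _).trans ((Finset.sum_le_card_nsmul _ _ _ hpt).trans ?_))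
  rw [nsmul_eq_mul, ← ENNReal.ofReal_natCast, ← ENNReal.ofReal_mul (by positivity)]
  apply ENNReal.ofReal_le_ofReal
  rw [← mul_assoc]
  gcongr

end ubound

section asym

lemma const_choice {ρ : ℝ} (h0 : 0 < ρ) (h1 : ρ < 1) :
    ∃ lam r : ℝ, Real.log (7 / Real.sqrt ρ) < lam ∧ 0 < lam ∧ Real.exp lam * r < 1 ∧ ρ / 7 < r := by
  have ht0 : 0 < Real.sqrt ρ := Real.sqrt_pos.2 h0
  have ht1 : Real.sqrt ρ < 1 := by rw [Real.sqrt_lt' one_pos]; simpa using h1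
  have hsq : Real.sqrt ρ * Real.sqrt ρ = ρ := Real.mul_self_sqrt h0.le
  set t := Real.sqrt ρ
  -- `E = exp lam` with `7 / t < E < 7 / ρ`
  have hlt : 7 / t < 7 / ρ := by
    rw [div_lt_div_iff₀ ht0 h0]; nlinarith
  obtain ⟨E, hE1, hE2⟩ := exists_between hlt
  have h7t : 7 < 7 / t := by rw [lt_div_iff₀ ht0]; nlinarith
  have hE0 : 0 < E := by linarith
  have h3 : ρ / 7 < 1 / E := by
    rw [lt_div_iff₀ h0] at hE2
    rw [div_lt_div_iff₀ (by norm_num) hE0]; linarith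
  obtain ⟨r, hr1, hr2⟩ := exists_between h3
  refine ⟨Real.log E, r, Real.log_lt_log (by positivity) hE1, Real.log_pos (by linarith), ?_, hr1⟩
  rw [Real.exp_log hE0]
  rw [lt_div_iff₀ hE0] at hr2
  linarith

lemma ev_log (c0 : ℝ) : ∀ᶠ N : ℕ in atTop, c0 * Real.log N + 1 ≤ (N : ℝ) ^ (1 / 8 : ℝ) := by
  have h1 : (fun x : ℝ => c0 * Real.log x + 1) =o[atTop] fun x => x ^ (1 / 8 : ℝ) := by
    refine Asymptotics.IsLittleO.add ((isLittleO_log_rpow_atTop (by norm_num)).const_mul_left c0) ?_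
    rw [Asymptotics.isLittleO_const_left]
    right
    exact tendsto_norm_atTop_atTop.comp (tendsto_rpow_atTop (by norm_num))
  have h2 := (h1.bound one_pos)
  have h3 := tendsto_natCast_atTop_atTop (R := ℝ) |>.eventually h2
  filter_upwards [h3] with N hN
  have := (le_abs_self _).trans hN
  rw [one_mul, Real.norm_of_nonneg (by positivity)] at this
  exact this

lemma ev_ge (C : ℝ) : ∀ᶠ N : ℕ in atTop, C ≤ (N : ℝ) ^ (1 / 8 : ℝ) :=
  ((tendsto_rpow_atTop (by norm_num)).comp tendsto_natCast_atTop_atTop).eventually_ge_atTop C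

lemma pow_low {κ : ℝ} (h0 : 0 ≤ κ) (h1 : κ ≤ 1 / 2) (K : ℕ) : Real.exp (-(2 * κ * K)) ≤ (1 - κ) ^ K := by
  have h2 : Real.exp (-(2 * κ)) ≤ 1 - κ := by
    have h3 : 0 < 1 - κ := by linarith
    have h4 : (1 - κ)⁻¹ ≤ Real.exp (2 * κ) := by
      have h5 : (1 - κ)⁻¹ ≤ 1 + 2 * κ := by
        rw [inv_le_iff_one_le_mul₀ h3]; nlinarith
      linarith [Real.add_one_le_exp (2 * κ)]
    rw [Real.exp_neg]
    exact inv_le_of_inv_le₀ h3 h4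
  calc Real.exp (-(2 * κ * K)) = Real.exp (-(2 * κ)) ^ K := by rw [← Real.exp_nat_mul]; congr 1; ring
    _ ≤ _ := by gcongr

/-- real-analysis core of the `V` estimate -/
lemma V_real {d : ℕ} (hd : 2 ≤ d) {c c0 lam u : ℝ} (hc : 0 ≤ c) (hc0 : 0 ≤ c0) (hlam : 0 < lam) (hu : 0 < u)
    (hu1 : 2 * (c * u / lam) * (c0 + 1) ≤ 1 / 8) :
    ∀ᶠ N : ℕ in atTop, ∃ M : ℕ, ((M * (⌊c0 * Real.log N⌋₊ + 1) : ℕ) : ℝ) ≤ Real.sqrt N ∧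
      c * (⌊c0 * Real.log N⌋₊ + 1 : ℕ) / (N : ℝ) ^ (d - 1) / lam ≤ 1 ∧
      (N : ℝ) ^ (1 / 8 : ℝ) ≤ lam * (1 - c * (⌊c0 * Real.log N⌋₊ + 1 : ℕ) / (N : ℝ) ^ (d - 1) / lam) ^ ⌊u * (N : ℝ) ^ (d - 1)⌋₊ * M := by
  filter_upwards [ev_log c0, ev_ge 2, ev_ge (2 / lam), ev_ge (2 * c / lam), eventually_ge_atTop 3] with N h1 h2 h3 h4 hN3
  have hNr : (3 : ℝ) ≤ N := by exact_mod_cast hN3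
  set y := (N : ℝ) ^ (1 / 8 : ℝ) with hy
  have hy0 : 0 < y := by positivity
  have hy8 : y ^ 8 = N := by
    rw [hy, ← Real.rpow_natCast, ← Real.rpow_mul (by positivity)]; norm_num
  have hy4 : Real.sqrt N = y ^ 4 := by
    rw [← hy8, show y ^ 8 = (y ^ 4) ^ 2 by ring, Real.sqrt_sq (by positivity)]
  have hlog : 1 ≤ Real.log N := by
    rw [Real.le_log_iff_exp_le (by linarith)]
    linarith [Real.exp_one_lt_d9]
  set L := ⌊c0 * Real.log N⌋₊ with hL
  have hLl : (L : ℝ) ≤ c0 * Real.log N := Nat.floor_le (by positivity)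
  have hL1 : ((L : ℝ) + 1) ≤ y := by linarith
  have hLpos : (0 : ℝ) < L + 1 := by positivity
  refine ⟨⌊Real.sqrt N / (L + 1)⌋₊, ?_, ?_⟩
  · push_cast
    rw [← le_div_iff₀ hLpos]
    exact Nat.floor_le (by positivity)
  have hM : y ^ 3 - 1 ≤ (⌊Real.sqrt N / (L + 1)⌋₊ : ℝ) := by
    have h5 := Nat.lt_floor_add_one (Real.sqrt N / ((L : ℝ) + 1))
    have h6 : y ^ 3 ≤ Real.sqrt N / (L + 1) := by
      rw [le_div_iff₀ hLpos, hy4]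
      calc y ^ 3 * (L + 1) ≤ y ^ 3 * y := by gcongr
        _ = y ^ 4 := by ring
    linarith
  have hNp : (N : ℝ) ≤ (N : ℝ) ^ (d - 1) := by
    calc (N : ℝ) = (N : ℝ) ^ 1 := by simp
      _ ≤ _ := pow_le_pow_right₀ (by linarith) (by omega)
  have hNp0 : (0 : ℝ) < (N : ℝ) ^ (d - 1) := by positivity
  set κ := c * (L + 1 : ℕ) / (N : ℝ) ^ (d - 1) / lam with hκ
  have hκ0 : 0 ≤ κ := by positivity
  have hκ2 : κ ≤ 1 / 2 := by
    rw [hκ, div_le_iff₀ hlam, div_le_iff₀ hNp0]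
    push_cast
    have h7 : 2 * c ≤ lam * y := by rw [div_le_iff₀ hlam] at h4; linarith
    have h8 : y * y ≤ N := by
      rw [← hy8]
      calc y * y = y ^ 2 := by ring
        _ ≤ y ^ 8 := pow_le_pow_right₀ (by linarith) (by norm_num)
    calc c * (L + 1) ≤ c * y := by gcongr
      _ ≤ 1 / 2 * (lam * y) * y := by nlinarith
      _ = 1 / 2 * lam * (y * y) := by ring
      _ ≤ 1 / 2 * lam * N := by gcongr
      _ ≤ _ := by gcongr
  refine ⟨by linarith, ?_⟩
  set K := ⌊u * (N : ℝ) ^ (d - 1)⌋₊ with hK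
  have hKu : (K : ℝ) ≤ u * (N : ℝ) ^ (d - 1) := Nat.floor_le (by positivity)
  have hκK : 2 * κ * K ≤ 1 / 8 * Real.log N := by
    calc 2 * κ * K ≤ 2 * κ * (u * (N : ℝ) ^ (d - 1)) := by gcongr
      _ = 2 * (c * u / lam) * (L + 1) := by rw [hκ]; push_cast; field_simp
      _ ≤ 2 * (c * u / lam) * ((c0 + 1) * Real.log N) := by
        gcongr; linarith
      _ = (2 * (c * u / lam) * (c0 + 1)) * Real.log N := by ring
      _ ≤ _ := by gcongr
  have hpow : y⁻¹ ≤ (1 - κ) ^ K := by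
    refine le_trans ?_ (pow_low hκ0 hκ2 K)
    have : y⁻¹ = Real.exp (-(1 / 8 * Real.log N)) := by
      rw [Real.exp_neg, hy, Real.rpow_def_of_pos (by linarith), mul_comm]
    rw [this]
    gcongr
  have hy3 : y ^ 3 / 2 ≤ y ^ 3 - 1 := by nlinarith [pow_le_pow_left₀ (by norm_num : (0:ℝ) ≤ 2) h2 3]
  have h9 : 2 ≤ lam * y := by rw [div_le_iff₀ hlam] at h3; linarith
  calc y ≤ lam * y⁻¹ * (y ^ 3 / 2) := by
        have : lam * y⁻¹ * (y ^ 3 / 2) = (lam * y) * y / 2 := by field_simp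
        rw [this]; nlinarith
    _ ≤ lam * (1 - κ) ^ K * (⌊Real.sqrt N / (L + 1)⌋₊ : ℝ) := by
        have h10 : y ^ 3 / 2 ≤ (⌊Real.sqrt N / (L + 1)⌋₊ : ℝ) := hy3.trans hM
        have h11 : 0 ≤ (1 - κ) ^ K := le_trans (by positivity) hpow
        gcongr

lemma lim_V (C : ℝ) (k : ℕ) : Tendsto (fun N : ℕ => C * ((N : ℝ) ^ k * Real.exp (-(N : ℝ) ^ (1 / 8 : ℝ)))) atTop (nhds 0) := by
  have h1 := (Real.tendsto_pow_mul_exp_neg_atTop_nhds_zero (8 * k)).comp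
    ((tendsto_rpow_atTop (y := 1 / 8) (by norm_num)).comp (tendsto_natCast_atTop_atTop (R := ℝ)))
  have h2 := h1.const_mul C
  rw [mul_zero] at h2
  refine h2.congr fun N => ?_
  simp only [Function.comp]
  congr 2
  rw [← Real.rpow_natCast, ← Real.rpow_mul (by positivity)]
  push_cast
  rw [show (1 / 8 * (8 * (k : ℝ))) = k by ring, Real.rpow_natCast]

lemma U_real {d : ℕ} {ρ : ℝ} (h0 : 0 < ρ) (h1 : ρ < 1) {N : ℕ} (hN : 1 ≤ N) {n : ℕ}
    (hn : n + 1 = ⌊8 * d / Real.log (1 / ρ) * Real.log N⌋₊) :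
    8 * 7 ^ n * Real.exp (-Real.log (7 / Real.sqrt ρ) * (n + 2 : ℕ)) ≤ 1 / (N : ℝ) ^ (4 * d) := by
  have hNr : (0 : ℝ) < N := by exact_mod_cast hN
  have ht0 : 0 < Real.sqrt ρ := Real.sqrt_pos.2 h0
  have hlr : 0 < Real.log (1 / ρ) := Real.log_pos (by rw [lt_div_iff₀ h0]; linarith)
  have hlr' : Real.log (1 / ρ) = - Real.log ρ := by rw [one_div, Real.log_inv]
  have h2 : Real.exp (-Real.log (7 / Real.sqrt ρ) * (n + 2 : ℕ)) = (Real.sqrt ρ / 7) ^ (n + 2) := by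
    rw [mul_comm, Real.exp_nat_mul, Real.exp_neg, Real.exp_log (by positivity), inv_div]
  have h3 : Real.sqrt ρ ^ (n + 2) ≤ 1 / (N : ℝ) ^ (4 * d) := by
    have h4 : 8 * d / Real.log (1 / ρ) * Real.log N < n + 2 := by
      have := Nat.lt_floor_add_one (8 * d / Real.log (1 / ρ) * Real.log N)
      rw [← hn] at this
      push_cast at this; linarith
    have h5 : Real.sqrt ρ ^ (n + 2) = Real.exp ((n + 2) * (Real.log ρ / 2)) := by
      rw [← Real.log_sqrt h0.le]
      have := Real.exp_nat_mul (Real.log (Real.sqrt ρ)) (n + 2)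
      rw [Real.exp_log ht0] at this
      rw [← this]; push_cast; rfl
    have h6 : 1 / (N : ℝ) ^ (4 * d) = Real.exp (-(4 * d * Real.log N)) := by
      rw [Real.exp_neg, one_div]
      congr 1
      have := Real.exp_nat_mul (Real.log N) (4 * d)
      rw [Real.exp_log hNr] at this
      rw [← this]; push_cast; rfl
    rw [h5, h6]
    apply Real.exp_le_exp.2
    rw [hlr'] at h4 hlr
    have h7 : (8 * d / -Real.log ρ * Real.log N) * (-Real.log ρ / 2) ≤ (n + 2) * (-Real.log ρ / 2) := by
      gcongr
    have h8 : (8 * d / -Real.log ρ * Real.log N) * (-Real.log ρ / 2) = 4 * d * Real.log N := by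
      have h9 : Real.log ρ ≠ 0 := by intro h; rw [h] at hlr; simp at hlr
      have h10 : -Real.log ρ ≠ 0 := neg_ne_zero.2 h9
      generalize -Real.log ρ = a at *
      field_simp; ring
    rw [h8] at h7
    linarith
  rw [h2, div_pow]
  calc 8 * 7 ^ n * (Real.sqrt ρ ^ (n + 2) / 7 ^ (n + 2)) = 8 / 49 * Real.sqrt ρ ^ (n + 2) := by
        rw [pow_add 7 n 2]; field_simp; norm_num
    _ ≤ 1 * Real.sqrt ρ ^ (n + 2) := by gcongr; norm_num
    _ ≤ _ := by rw [one_mul]; exact h3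

lemma lim_U {d : ℕ} (hd : 4 ≤ d) (C : ℝ) :
    Tendsto (fun N : ℕ => C * ((N : ℝ) ^ (3 * d + 1) * (1 / (N : ℝ) ^ (4 * d)))) atTop (nhds 0) := by
  have h1 : Tendsto (fun N : ℕ => C * (1 / (N : ℝ) ^ (d - 1))) atTop (nhds 0) := by
    have : Tendsto (fun N : ℕ => ((N : ℝ) ^ (d - 1))⁻¹) atTop (nhds 0) :=
      tendsto_inv_atTop_zero.comp ((tendsto_pow_atTop (by omega)).comp tendsto_natCast_atTop_atTop)
    have h2 := this.const_mul C
    rw [mul_zero] at h2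
    simpa using h2
  refine h1.congr' ?_
  filter_upwards [eventually_ge_atTop 1] with N hN
  have hNr : (N : ℝ) ≠ 0 := by positivity
  congr 1
  have : 4 * d = (3 * d + 1) + (d - 1) := by omega
  have h2 : (N : ℝ) ^ (4 * d) = (N : ℝ) ^ (3 * d + 1) * (N : ℝ) ^ (d - 1) := by rw [this, pow_add]
  rw [h2, one_div, one_div, mul_inv, ← mul_assoc, mul_inv_cancel₀ (by positivity), one_mul]

end asym

section final

lemma ev_L {c0 : ℝ} (hc0 : 0 < c0) : ∀ᶠ N : ℕ in atTop, 1 ≤ ⌊c0 * Real.log N⌋₊ ∧ 4 * ⌊c0 * Real.log N⌋₊ ≤ 3 * N := by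
  have hlog : Tendsto (fun N : ℕ => c0 * Real.log N) atTop atTop :=
    (Real.tendsto_log_atTop.comp tendsto_natCast_atTop_atTop).const_mul_atTop hc0
  filter_upwards [ev_log c0, ev_ge 2, hlog.eventually_ge_atTop 1] with N h1 h2 h3
  refine ⟨Nat.le_floor (by simpa using h3), ?_⟩
  have hf : (⌊c0 * Real.log N⌋₊ : ℝ) ≤ c0 * Real.log N := Nat.floor_le (by linarith)
  set y := (N : ℝ) ^ (1 / 8 : ℝ) with hy
  have hy8 : y ^ 8 = N := by
    rw [hy, ← Real.rpow_natCast, ← Real.rpow_mul (by positivity)]; norm_num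
  have h4 : 4 * y ≤ N := by
    rw [← hy8]
    have : (2 : ℝ) ^ 7 ≤ y ^ 7 := pow_le_pow_left₀ (by norm_num) h2 7
    calc 4 * y ≤ y ^ 7 * y := by gcongr; linarith
      _ = _ := by ring
  have : (4 : ℝ) * ⌊c0 * Real.log N⌋₊ ≤ 3 * N := by
    have : (0 : ℝ) ≤ N := by positivity
    linarith
  exact_mod_cast this

lemma ev_pow {d : ℕ} (hd : 2 ≤ d) (C : ℝ) : ∀ᶠ N : ℕ in atTop, C ≤ (N : ℝ) ^ (d - 1) :=
  ((tendsto_pow_atTop (by omega)).comp tendsto_natCast_atTop_atTop).eventually_ge_atTop C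

theorem cov_adm {d N : ℕ} [NeZero N] (hd : 1 ≤ d) {Pl : Cyl d N → Measure (ℕ → Cyl d N)} (hPl : IsCylRW d N Pl)
    (j : ℤ) (K : ℕ) (hK : 1 ≤ K) {lam lam0 r m : ℝ} (hlam : 0 ≤ lam)
    (hr1 : Real.exp lam * r < 1) (hm : m = (Real.exp lam - 1) / (1 - Real.exp lam * r)) (hm0 : 0 ≤ m)
    (hr : ∀ F ∈ Lcoll d N 2, ∀ x ∈ F, Pop (hA j F) x ≤ r)
    (hcK : cst d m / (N : ℝ) ^ (d - 1) * (K + 1) ≤ lam - lam0)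
    (A : Finset (Cyl d N)) (hAdm : A ∈ Adm d N j 2) :
    lawP d N Pl {ω | ∀ x ∈ A, x ∈ ranE ω (DD d N j K ω)} ≤ ENNReal.ofReal (Real.exp (-lam0 * A.card)) := by
  obtain ⟨_, hC, F, hF, hAF⟩ := hAdm
  have hN : (0 : ℝ) < N := by exact_mod_cast NeZero.pos N
  have hc := cst_nonneg d hm0
  have hnear : Near j A := by
    intro x hx
    have := Cblk_abs (hC hx)
    linarith
  refine (covering hd hPl j K hK A hnear hlam hr1 hm hm0 ?_).trans (ENNReal.ofReal_le_ofReal ?_)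
  · intro A' hA' x hx
    have h1 : (A' : Set (Cyl d N)) ⊆ F := fun w hw => hAF (hA' hw)
    exact (Pop_mono fun e _ => hA_mono j h1 _).trans (hr F hF x (h1 hx))
  · set z := cst d m * A.card / (N : ℝ) ^ (d - 1) with hz
    have hz0 : 0 ≤ z := by positivity
    have h1 : (1 + z) ^ (K + 1) ≤ Real.exp ((K + 1 : ℕ) * z) := by
      rw [Real.exp_nat_mul]
      gcongr
      linarith [Real.add_one_le_exp z]
    calc _ ≤ Real.exp (-(lam * A.card)) * Real.exp ((K + 1 : ℕ) * z) := by gcongr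
      _ = Real.exp (-(lam * A.card) + (K + 1 : ℕ) * z) := by rw [Real.exp_add]
      _ ≤ _ := by
        apply Real.exp_le_exp.2
        have h2 : ((K + 1 : ℕ) : ℝ) * z = (cst d m / (N : ℝ) ^ (d - 1) * (K + 1)) * A.card := by
          rw [hz]; push_cast; ring
        rw [h2]
        have h3 : (0 : ℝ) ≤ A.card := by positivity
        nlinarith

theorem main_aux (d : ℕ) (hd : 4 ≤ d) {ρ q : ℝ} (hρ : ρ = 7 * (2 / ((d : ℝ) + 1) + (1 - 2 / ((d : ℝ) + 1)) * q))
    (hq : ∀ n, Pz (fz n) (0 : ZLat (d - 1)) ≤ q) (hρ0 : 0 < ρ) (hρ1 : ρ < 1)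
    (Pl : ∀ N : ℕ, Cyl d N → Measure (ℕ → Cyl d N)) (hPl : ∀ N : ℕ, IsCylRW d N (Pl N)) :
    ∃ u₀ : ℝ, 0 < u₀ ∧
      (∃ N₁ : ℕ, 0 < N₁ ∧ ∀ N : ℕ, N₁ ≤ N → ∀ j : ℤ, ∀ A ∈ Adm d N j 2,
        ((lawP d N (Pl N))
            {ω | ∀ x ∈ A, x ∈ ranE ω (DD d N j ⌊u₀ * (N : ℝ) ^ (d - 1)⌋₊ ω)}).toReal
          ≤ Real.exp (-(Real.log (7 / Real.sqrt ρ)) * A.card)) ∧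
      Tendsto (fun N : ℕ =>
          (N : ℝ) ^ (2 * d) * ⨆ j : ℤ,
            ((lawP d N (Pl N))
              (Vev d N (8 * d / Real.log (1 / ρ)) j ⌊u₀ * (N : ℝ) ^ (d - 1)⌋₊ ∩
                Uev d N (8 * d / Real.log (1 / ρ)) j ⌊u₀ * (N : ℝ) ^ (d - 1)⌋₊)ᶜ).toReal)
        atTop (nhds 0) := by
  obtain ⟨lam, r, hlam0, hlam, hr1, hr⟩ := const_choice hρ0 hρ1
  set lam0 := Real.log (7 / Real.sqrt ρ) with hl0
  have hlr : 0 < Real.log (1 / ρ) := Real.log_pos (by rw [lt_div_iff₀ hρ0]; linarith)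
  have hdr : (0 : ℝ) < d := by exact_mod_cast (by omega : 0 < d)
  set c0 := 8 * d / Real.log (1 / ρ) with hc0
  have hc0p : 0 < c0 := by positivity
  obtain ⟨m, hm⟩ : ∃ m, m = (Real.exp lam - 1) / (1 - Real.exp lam * r) := ⟨_, rfl⟩
  have hm0 : 0 ≤ m := by
    rw [hm]
    have := Real.add_one_le_exp lam
    exact div_nonneg (by linarith) (by linarith)
  set c := cst d m with hc
  have hcn : 0 ≤ c := cst_nonneg d hm0
  obtain ⟨N₀, hN₀⟩ := q_bound d hd q hq (r - ρ / 7) (by linarith)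
  have hPop : ∀ N : ℕ, N₀ ≤ N → ∀ j : ℤ, ∀ F ∈ Lcoll d N 2, ∀ x ∈ F, Pop (hA j F) x ≤ r := by
    intro N hN j F hF x hx
    have := hN₀ N hN j F hF x hx
    have h2 : ρ / 7 = 2 / ((d : ℝ) + 1) + (1 - 2 / ((d : ℝ) + 1)) * q := by rw [hρ]; ring
    linarith
  obtain ⟨u, hu, hu1, hu2⟩ : ∃ u : ℝ, 0 < u ∧ c * u ≤ (lam - lam0) / 2 ∧ 2 * (c * u / lam) * (c0 + 1) ≤ 1 / 8 := by
    have hdl : 0 < lam - lam0 := by linarith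
    refine ⟨min ((lam - lam0) / (2 * (c + 1))) (lam / (16 * (c + 1) * (c0 + 1))), by positivity, ?_, ?_⟩
    · calc c * _ ≤ (c + 1) * ((lam - lam0) / (2 * (c + 1))) :=
            mul_le_mul (by linarith) (min_le_left _ _) (by positivity) (by positivity)
        _ = _ := by field_simp
    · have h1 : c * min ((lam - lam0) / (2 * (c + 1))) (lam / (16 * (c + 1) * (c0 + 1))) ≤
          (c + 1) * (lam / (16 * (c + 1) * (c0 + 1))) :=
        mul_le_mul (by linarith) (min_le_right _ _) (by positivity) (by positivity)
      calc _ ≤ 2 * ((c + 1) * (lam / (16 * (c + 1) * (c0 + 1))) / lam) * (c0 + 1) := by gcongr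
        _ = 1 / 8 := by field_simp; norm_num
  set K : ℕ → ℕ := fun N => ⌊u * (N : ℝ) ^ (d - 1)⌋₊ with hK
  have evK : ∀ᶠ N : ℕ in atTop, 1 ≤ K N := by
    filter_upwards [ev_pow (by omega : 2 ≤ d) (1 / u)] with N hN
    rw [div_le_iff₀ hu] at hN
    exact Nat.le_floor (by push_cast; linarith)
  have evcov : ∀ᶠ N : ℕ in atTop, ∀ j : ℤ, ∀ A ∈ Adm d N j 2,
      lawP d N (Pl N) {ω | ∀ x ∈ A, x ∈ ranE ω (DD d N j (K N) ω)} ≤ ENNReal.ofReal (Real.exp (-lam0 * A.card)) := by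
    filter_upwards [evK, eventually_ge_atTop N₀, eventually_ge_atTop 1,
      ev_pow (by omega : 2 ≤ d) (2 * c / (lam - lam0))] with N h1 h2 h3 h4 j A hAdm
    haveI : NeZero N := ⟨by omega⟩
    refine cov_adm (by omega) (hPl N) j (K N) h1 hlam.le hr1 hm hm0 (hPop N h2 j) ?_ A hAdm
    have hNp0 : (0 : ℝ) < (N : ℝ) ^ (d - 1) := by positivity
    have hKu : (K N : ℝ) ≤ u * (N : ℝ) ^ (d - 1) := Nat.floor_le (by positivity)
    rw [div_le_iff₀ (by linarith)] at h4
    rw [← hc]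
    calc c / (N : ℝ) ^ (d - 1) * (K N + 1) ≤ c / (N : ℝ) ^ (d - 1) * (u * (N : ℝ) ^ (d - 1) + 1) := by gcongr
      _ = c * u + c / (N : ℝ) ^ (d - 1) := by field_simp
      _ ≤ (lam - lam0) / 2 + (lam - lam0) / 2 := by
        have h5 : c / (N : ℝ) ^ (d - 1) ≤ (lam - lam0) / 2 := by
          rw [div_le_iff₀ hNp0]; linarith
        exact add_le_add hu1 h5
      _ = _ := by ring
  refine ⟨u, hu, ?_, ?_⟩
  · obtain ⟨N₁, hN₁⟩ := eventually_atTop.1 evcov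
    refine ⟨N₁ + 1, by omega, fun N hN j A hAdm => ?_⟩
    have := ENNReal.toReal_mono ENNReal.ofReal_ne_top (hN₁ N (by omega) j A hAdm)
    rwa [ENNReal.toReal_ofReal (by positivity)] at this
  · set Cv : ℝ := 3 * (2 * (d + 1)) * (1 + m) with hCv
    set Cu : ℝ := 3 * (d + 1) ^ 2 with hCu
    have hCv0 : 0 ≤ Cv := by positivity
    have hlim : Tendsto (fun N : ℕ => Cv * ((N : ℝ) ^ (3 * d + 1) * Real.exp (-(N : ℝ) ^ (1 / 8 : ℝ))) +
        Cu * ((N : ℝ) ^ (3 * d + 1) * (1 / (N : ℝ) ^ (4 * d)))) atTop (nhds 0) := by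
      have := (lim_V Cv (3 * d + 1)).add (lim_U hd Cu)
      rwa [add_zero] at this
    refine tendsto_of_tendsto_of_tendsto_of_le_of_le' tendsto_const_nhds hlim ?_ ?_
    · refine Eventually.of_forall fun N => ?_
      exact mul_nonneg (by positivity) (Real.iSup_nonneg fun j => ENNReal.toReal_nonneg)
    · filter_upwards [evK, evcov, ev_L hc0p, V_real (by omega : 2 ≤ d) hcn hc0p.le hlam hu hu2, eventually_ge_atTop N₀,
        eventually_ge_atTop 64] with N h1 h2 h3 h4 h5 h6
      haveI : NeZero N := ⟨by omega⟩
      obtain ⟨M, hM1, hM2, hM3⟩ := h4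
      have hb : ∀ j : ℤ, ((lawP d N (Pl N)) (Vev d N c0 j (K N) ∩ Uev d N c0 j (K N))ᶜ).toReal ≤
          Cv * ((N : ℝ) ^ (d + 1) * Real.exp (-(N : ℝ) ^ (1 / 8 : ℝ))) + Cu * ((N : ℝ) ^ (d + 1) * (1 / (N : ℝ) ^ (4 * d))) := by
        intro j
        have hV := V_bound (by omega) h6 (hPl N) j (K N) h1 c0 M ⌊c0 * Real.log N⌋₊ rfl hM1 hlam hr1 hm hm0 rfl hM2 (hPop N h5 j)
        obtain ⟨n, hn⟩ : ∃ n, n + 1 = ⌊c0 * Real.log N⌋₊ := ⟨⌊c0 * Real.log N⌋₊ - 1, by omega⟩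
        have hU := U_bound (by omega) j (K N) c0 n hn (by rw [hn]; exact h3.2) (h2 j)
        have hUr := U_real (d := d) hρ0 hρ1 (by omega : 1 ≤ N) hn
        refine ENNReal.toReal_le_of_le_ofReal (by positivity) ?_
        rw [Set.compl_inter, ENNReal.ofReal_add (by positivity) (by positivity)]
        refine (measure_union_le _ _).trans (add_le_add (hV.trans ?_) (hU.trans ?_))
        · apply ENNReal.ofReal_le_ofReal
          calc _ ≤ 3 * (N : ℝ) ^ (d + 1) * (2 * (d + 1)) * ((1 + m) * Real.exp (-(N : ℝ) ^ (1 / 8 : ℝ))) := by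
                gcongr
            _ = _ := by rw [hCv]; ring
        · apply ENNReal.ofReal_le_ofReal
          calc _ ≤ 3 * (N : ℝ) ^ (d + 1) * (d + 1) ^ 2 * (1 / (N : ℝ) ^ (4 * d)) := by
                gcongr
            _ = _ := by rw [hCu]; ring
      refine (mul_le_mul_of_nonneg_left (Real.iSup_le hb (by positivity)) (by positivity)).trans (le_of_eq ?_)
      have : (N : ℝ) ^ (3 * d + 1) = (N : ℝ) ^ (2 * d) * (N : ℝ) ^ (d + 1) := by rw [← pow_add]; congr 1; ring
      rw [this]; ring

end final

/-- **Corollary 1.6, claim (1.49).** If `d ≥ 4` and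
`ρ = 7(2/(d+1) + (1 - 2/(d+1)) q(d-1)) < 1`, `c₀ = 8d/log(1/ρ)`, and `u₀ > 0` is the
constant of Theorem 1.2 part 2 with `m = 2` and `λ = λ₀ = log(7 ρ^{-1/2})`, then
`lim_N N^{2d} sup_j P[(G_{j, u₀N^{d-1}})^c] = 0` with `G = V_{c₀} ∩ U_{c₀}`. -/
theorem statement_11 (d : ℕ) (hd : 4 ≤ d)
    (Q : ZLat (d - 1) → Measure (ℕ → ZLat (d - 1))) (hQ : IsLatRW (d - 1) Q)
    (hrho : 7 * (2 / ((d : ℝ) + 1) + (1 - 2 / ((d : ℝ) + 1)) * retProb (d - 1) Q) < 1)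
    (Pl : ∀ N : ℕ, Cyl d N → Measure (ℕ → Cyl d N))
    (hPl : ∀ N : ℕ, IsCylRW d N (Pl N)) :
    ∃ u₀ : ℝ, 0 < u₀ ∧
      -- `u₀` is a constant as provided by Theorem 1.2 part 2 for `m = 2`, `λ = λ₀`:
      (∃ N₁ : ℕ, 0 < N₁ ∧ ∀ N : ℕ, N₁ ≤ N → ∀ j : ℤ, ∀ A ∈ Adm d N j 2,
        ((lawP d N (Pl N))
            {ω | ∀ x ∈ A, x ∈ ranE ω (DD d N j ⌊u₀ * (N : ℝ) ^ (d - 1)⌋₊ ω)}).toReal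
          ≤ Real.exp
              (-(Real.log (7 / Real.sqrt
                  (7 * (2 / ((d : ℝ) + 1)
                    + (1 - 2 / ((d : ℝ) + 1)) * retProb (d - 1) Q)))) * A.card)) ∧
      Tendsto (fun N : ℕ =>
          (N : ℝ) ^ (2 * d) * ⨆ j : ℤ,
            ((lawP d N (Pl N))
              (Vev d N
                  (8 * d / Real.log
                    (1 / (7 * (2 / ((d : ℝ) + 1)
                      + (1 - 2 / ((d : ℝ) + 1)) * retProb (d - 1) Q))))
                  j ⌊u₀ * (N : ℝ) ^ (d - 1)⌋₊ ∩
                Uev d N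
                  (8 * d / Real.log
                    (1 / (7 * (2 / ((d : ℝ) + 1)
                      + (1 - 2 / ((d : ℝ) + 1)) * retProb (d - 1) Q))))
                  j ⌊u₀ * (N : ℝ) ^ (d - 1)⌋₊)ᶜ).toReal)
        atTop (nhds 0) := by
  have hq0 : 0 ≤ retProb (d - 1) Q := ENNReal.toReal_nonneg
  have hd4 : (4 : ℝ) ≤ d := by exact_mod_cast hd
  have h1 : (0 : ℝ) < 2 / ((d : ℝ) + 1) := by positivity
  have h2 : 2 / ((d : ℝ) + 1) ≤ 1 := by
    rw [div_le_one (by positivity)]; linarith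
  have hρ0 : 0 < 7 * (2 / ((d : ℝ) + 1) + (1 - 2 / ((d : ℝ) + 1)) * retProb (d - 1) Q) := by
    have := mul_nonneg (sub_nonneg.2 h2) hq0
    linarith
  exact main_aux d hd rfl (fun n => ret_bound (by omega) Q hQ n) hρ0 hrho Pl hPl

end DiscCyl
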